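/- Let n ≥ 1, let F be the free group on generators x₁, …, xₙ, let R_i be the normal closure of x_i in F for 1 ≤ i ≤ n, and let R₀ be the normal closure of x₁x₂⋯xₙ in F. Then the (n+1)-st homotopy group of the 2-sphere, π_{n+1}(S²), is isomorphic as a group to the quotient (R₀ ∩ R₁ ∩ ⋯ ∩ Rₙ)/[R₀, R₁, …, Rₙ]_S, where the symmetric commutator subgroup [R₀, …, Rₙ]_S is a normal subgroup of F contained in the intersection R₀ ∩ R₁ ∩ ⋯ ∩ Rₙ. -/

import Mathlib

/-- The left-normed iterated commutator subgroup
`[N₁, …, N_k] = [[…[[N₁, N₂], N₃]…], N_k]` of a list of subgroups. -/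
def iterComm {G : Type*} [Group G] : List (Subgroup G) → Subgroup G
  | [] => ⊥
  | N :: l => l.foldl (fun A B => ⁅A, B⁆) N

/-- The symmetric commutator subgroup `[N₁, …, N_k]_S`: the subgroup generated by all
left-normed iterated commutator subgroups `[N_{σ(1)}, …, N_{σ(k)}]` over permutations `σ`. -/
def symmComm {G : Type*} [Group G] {k : ℕ} (N : Fin k → Subgroup G) : Subgroup G :=
  ⨆ σ : Equiv.Perm (Fin k), iterComm (List.ofFn fun i => N (σ i))

/-- In the free group on `n` generators `x₁, …, xₙ` (indexed by `Fin n`), `R n 0` is the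
normal closure of the product `x₁x₂⋯xₙ`, and `R n i` for `i ≠ 0` is the normal closure of
the generator `x_i`. -/
def R (n : ℕ) (i : Fin (n + 1)) : Subgroup (FreeGroup (Fin n)) :=
  if h : i = 0 then
    Subgroup.normalClosure {(List.ofFn fun j : Fin n => FreeGroup.of j).prod}
  else
    Subgroup.normalClosure {FreeGroup.of (i.pred h)}

namespace Wu

section Comm
variable {G : Type*} [Group G]

theorem iterComm_concat (l : List (Subgroup G)) (hl : l ≠ []) (N : Subgroup G) :
    iterComm (l ++ [N]) = ⁅iterComm l, N⁆ := by
  cases l with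
  | nil => exact absurd rfl hl
  | cons a l => simp [iterComm, List.foldl_append]

theorem iterComm_normal (l : List (Subgroup G)) (h : ∀ N ∈ l, N.Normal) : (iterComm l).Normal := by
  induction l using List.reverseRecOn with
  | nil => exact Subgroup.normal_bot
  | append_singleton l N ih =>
    by_cases hl : l = []
    · subst hl; simpa [iterComm] using h
    · rw [iterComm_concat l hl]
      have := ih fun N hN => h N (by simp [hN])
      have := h N (by simp)
      infer_instance

theorem iterComm_le (l : List (Subgroup G)) (h : ∀ N ∈ l, N.Normal) :
    ∀ N ∈ l, iterComm l ≤ N := by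
  induction l using List.reverseRecOn with
  | nil => simp
  | append_singleton l N ih =>
    by_cases hl : l = []
    · subst hl; simp [iterComm]
    · rw [iterComm_concat l hl]
      have h1 : ∀ N ∈ l, N.Normal := fun N hN => h N (by simp [hN])
      have := iterComm_normal l h1
      have := h N (by simp)
      intro N' hN'
      rcases List.mem_append.1 hN' with h2 | h2
      · exact (Subgroup.commutator_le_left _ _).trans (ih h1 N' h2)
      · rw [List.mem_singleton.1 h2]; exact Subgroup.commutator_le_right _ _

theorem iterComm_map {H : Type*} [Group H] (f : G →* H) (l : List (Subgroup G)) :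
    (iterComm l).map f = iterComm (l.map (Subgroup.map f)) := by
  induction l using List.reverseRecOn with
  | nil => simp [iterComm]
  | append_singleton l N ih =>
    by_cases hl : l = []
    · subst hl; simp [iterComm]
    · rw [iterComm_concat l hl, List.map_append, List.map_singleton,
        iterComm_concat _ (by simpa using hl), Subgroup.map_commutator, ih]

theorem iterComm_mono {ι : Type*} (A B : ι → Subgroup G) (l : List ι) (h : ∀ i ∈ l, A i ≤ B i) :
    iterComm (l.map A) ≤ iterComm (l.map B) := by
  induction l using List.reverseRecOn with
  | nil => simp [iterComm]
  | append_singleton l N ih =>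
    by_cases hl : l = []
    · subst hl; simpa [iterComm] using h
    · rw [List.map_append, List.map_append, List.map_singleton, List.map_singleton,
        iterComm_concat _ (by simpa using hl), iterComm_concat _ (by simpa using hl)]
      exact Subgroup.commutator_mono (ih fun i hi => h i (by simp [hi])) (h _ (by simp))

/-- The symmetric commutator subgroup of a list of indices. -/
def SC {ι : Type*} (N : ι → Subgroup G) (l : List ι) : Subgroup G :=
  ⨆ l' : {l' : List ι // l'.Perm l}, iterComm (l'.1.map N)

variable {ι : Type*} (N : ι → Subgroup G)

theorem le_SC {l l' : List ι} (h : l'.Perm l) : iterComm (l'.map N) ≤ SC N l :=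
  le_iSup (fun l' : {l' : List ι // l'.Perm l} => iterComm (l'.1.map N)) ⟨l', h⟩

theorem SC_le {l : List ι} {K : Subgroup G} (h : ∀ l' : List ι, l'.Perm l → iterComm (l'.map N) ≤ K) :
    SC N l ≤ K := iSup_le fun l' => h l'.1 l'.2

theorem SC_normal (hN : ∀ i, (N i).Normal) (l : List ι) : (SC N l).Normal := by
  unfold SC
  have : ∀ l' : {l' : List ι // l'.Perm l}, (iterComm (l'.1.map N)).Normal := fun l' =>
    iterComm_normal _ (by simp only [List.mem_map]; rintro _ ⟨i, -, rfl⟩; exact hN i)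
  exact Subgroup.iSup_normal _

theorem SC_le_mem (hN : ∀ i, (N i).Normal) (l : List ι) (i : ι) (hi : i ∈ l) : SC N l ≤ N i := by
  refine SC_le N fun l' h => iterComm_le _ ?_ _ (List.mem_map_of_mem (h.mem_iff.2 hi))
  simp only [List.mem_map]; rintro _ ⟨i, -, rfl⟩; exact hN i

theorem SC_map {H : Type*} [Group H] (f : G →* H) (l : List ι) :
    (SC N l).map f = SC (fun i => (N i).map f) l := by
  simp only [SC, Subgroup.map_iSup, iterComm_map, List.map_map]; rfl

theorem symmComm_eq {k : ℕ} (N : Fin k → Subgroup G) : symmComm N = SC N (List.finRange k) := by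
  apply le_antisymm
  · refine iSup_le fun σ => ?_
    have : (List.ofFn fun i => N (σ i)) = ((List.finRange k).map σ).map N := by
      rw [List.map_map, List.ofFn_eq_map]; rfl
    rw [this]
    exact le_SC N (Equiv.Perm.map_finRange_perm σ)
  · refine SC_le N fun l' h => ?_
    have hlen : l'.length = k := by simpa using h.length_eq
    have hnd : l'.Nodup := h.nodup_iff.2 (List.nodup_finRange k)
    let g : Fin k → Fin k := fun i => l'.get (i.cast hlen.symm)
    have hinj : Function.Injective g := fun i j hij =>
      Fin.cast_injective _ (List.nodup_iff_injective_get.1 hnd hij)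
    let σ : Equiv.Perm (Fin k) := Equiv.ofBijective g (Finite.injective_iff_bijective.1 hinj)
    have : l'.map N = List.ofFn fun i => N (σ i) := by
      apply List.ext_getElem
      · simp [hlen]
      · intro i h1 h2
        simp [σ, g]
    rw [this]
    exact le_iSup (fun σ : Equiv.Perm (Fin k) => iterComm (List.ofFn fun i => N (σ i))) σ

/-- If all commutators of elements of `A i` with `y` lie in `K`, so do those of the supremum. -/
theorem commutator_SC_le (l : List ι) (B K : Subgroup G) [K.Normal]
    (h : ∀ l' : List ι, l'.Perm l → ⁅iterComm (l'.map N), B⁆ ≤ K) : ⁅SC N l, B⁆ ≤ K := by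
  have key : ∀ A : Subgroup G, ⁅A, B⁆ ≤ K ↔
      A ≤ (Subgroup.centralizer ((QuotientGroup.mk' K) '' (B : Set G))).comap
        (QuotientGroup.mk' K) := by
    intro A
    rw [Subgroup.commutator_le]
    constructor
    · intro h a ha
      rw [Subgroup.mem_comap, Subgroup.mem_centralizer_iff_commutator_eq_one']
      rintro _ ⟨b, hb, rfl⟩
      rw [← map_commutatorElement]
      exact (QuotientGroup.eq_one_iff _).2 (h a ha b hb)
    · intro h a ha b hb
      have := h ha
      rw [Subgroup.mem_comap, Subgroup.mem_centralizer_iff_commutator_eq_one'] at this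
      have := this _ ⟨b, hb, rfl⟩
      rw [← map_commutatorElement] at this
      exact (QuotientGroup.eq_one_iff _).1 this
  rw [key]
  exact SC_le N fun l' hl => (key _).1 (h l' hl)

theorem three_le (A B C K : Subgroup G) [A.Normal] [B.Normal] [C.Normal] [K.Normal]
    (h1 : ⁅⁅A, B⁆, C⁆ ≤ K) (h2 : ⁅⁅A, C⁆, B⁆ ≤ K) : ⁅A, ⁅B, C⁆⁆ ≤ K := by
  rw [Subgroup.commutator_comm]
  have key : ∀ X Y Z : Subgroup G, ⁅⁅X, Y⁆, Z⁆ ≤ K ↔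
      ⁅⁅X.map (QuotientGroup.mk' K), Y.map (QuotientGroup.mk' K)⁆,
        Z.map (QuotientGroup.mk' K)⁆ = ⊥ := by
    intro X Y Z
    rw [← Subgroup.map_commutator, ← Subgroup.map_commutator, Subgroup.map_eq_bot_iff,
      QuotientGroup.ker_mk']
  rw [key]
  refine Subgroup.commutator_commutator_eq_bot_of_rotate ?_ ?_
  · rw [← key, Subgroup.commutator_comm C A]; exact h2
  · rw [← key]; exact h1

end Comm

section Free
set_option linter.unusedSectionVars false
variable {ι : Type*} [DecidableEq ι]

/-- The endomorphism of a free group that kills the generators `i` with `i ∈ s`. -/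
def kill (s : Set ι) [DecidablePred (· ∈ s)] : FreeGroup ι →* FreeGroup ι :=
  FreeGroup.lift fun i => if i ∈ s then 1 else FreeGroup.of i

/-- Normal closure of a generator. -/
def NC (i : ι) : Subgroup (FreeGroup ι) := Subgroup.normalClosure {FreeGroup.of i}

instance (i : ι) : (NC i).Normal := Subgroup.normalClosure_normal

theorem of_mem_NC (i : ι) : FreeGroup.of i ∈ NC i :=
  Subgroup.subset_normalClosure (Set.mem_singleton _)

theorem kill_mod (a : ι) (x : FreeGroup ι) : x * (kill {a} x)⁻¹ ∈ NC a := by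
  rw [← QuotientGroup.eq_one_iff, QuotientGroup.mk_mul, QuotientGroup.mk_inv, mul_inv_eq_one]
  have : QuotientGroup.mk' (NC a) = (QuotientGroup.mk' (NC a)).comp (kill {a}) := by
    ext i
    by_cases h : i = a
    · subst h
      simpa [kill] using of_mem_NC i
    · simp [kill, h]
  exact DFunLike.congr_fun this x

theorem kill_mem (a i : ι) {x : FreeGroup ι} (hx : x ∈ NC i) : kill {a} x ∈ NC i := by
  have : NC i ≤ (NC i).comap (kill {a}) := by
    refine Subgroup.normalClosure_le_normal ?_
    rintro _ rfl
    by_cases h : i = a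
    · simp [kill, h]
    · simpa [kill, h] using of_mem_NC i
  exact this hx

theorem kill_eq_one (a : ι) {x : FreeGroup ι} (hx : x ∈ NC a) : kill {a} x = 1 := by
  have : NC a ≤ (kill {a}).ker := by
    refine Subgroup.normalClosure_le_normal ?_
    rintro _ rfl
    simp [kill]
  exact this hx

theorem kill_mem_iterComm (a : ι) (l : List ι) {x : FreeGroup ι} (hx : x ∈ iterComm (l.map NC)) :
    kill {a} x ∈ iterComm (l.map NC) := by
  have : (iterComm (l.map NC)).map (kill {a}) ≤ iterComm (l.map NC) := by
    rw [iterComm_map, List.map_map]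
    exact iterComm_mono _ _ _ fun i _ => Subgroup.map_le_iff_le_comap.2 fun x hx => kill_mem a i hx
  exact this ⟨x, hx, rfl⟩

theorem commutator_eq_of_commute {Q : Type*} [Group Q] {x y x' y' : Q} (h1 : Commute (x * x'⁻¹) y)
    (h3 : Commute (y * y'⁻¹) x') (h4 : Commute (x * x'⁻¹) (x' * y' * x'⁻¹ * y'⁻¹))
    (h5 : Commute (y * y'⁻¹) (x' * y' * x'⁻¹ * y'⁻¹)) :
    x * y * x⁻¹ * y⁻¹ = x' * y' * x'⁻¹ * y'⁻¹ := by
  obtain ⟨d, rfl⟩ : ∃ d, x = d * x' := ⟨x * x'⁻¹, by simp⟩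
  obtain ⟨e, rfl⟩ : ∃ e, y = e * y' := ⟨y * y'⁻¹, by simp⟩
  simp only [mul_inv_cancel_right] at h1 h3 h4 h5
  have e1 : d * x' * (e * y') * (d * x')⁻¹ * (e * y')⁻¹
      = d * ((x' * e) * y' * x'⁻¹) * (d⁻¹ * (e * y')⁻¹) := by group
  have e2 : d⁻¹ * (e * y')⁻¹ = (e * y')⁻¹ * d⁻¹ := (h1.inv_inv).eq
  have e3 : d * (e * x' * y' * x'⁻¹) * ((e * y')⁻¹ * d⁻¹)
      = d * ((e * (x' * y' * x'⁻¹ * y'⁻¹)) * e⁻¹) * d⁻¹ := by group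
  rw [e1, e2, ← h3.eq, e3, h5.eq, mul_inv_cancel_right, h4.eq, mul_inv_cancel_right]

theorem NC_kill_mod {a i : ι} (hia : i ≠ a) (K : Subgroup (FreeGroup ι)) [hK : K.Normal]
    (h : ⁅NC i, NC a⁆ ≤ K) {x : FreeGroup ι} (hx : x ∈ NC i) : x * (kill {a} x)⁻¹ ∈ K := by
  suffices NC i ≤ (QuotientGroup.mk' K).eqLocus ((QuotientGroup.mk' K).comp (kill {a})) by
    have h := this hx
    rw [← QuotientGroup.eq_one_iff, QuotientGroup.mk_mul, QuotientGroup.mk_inv, mul_inv_eq_one]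
    exact h
  have hai : ∀ y ∈ NC i, ∀ r ∈ NC a,
      Commute (QuotientGroup.mk' K r) (QuotientGroup.mk' K y) := by
    intro y hy r hr
    rw [← commutatorElement_eq_one_iff_commute, ← map_commutatorElement]
    rw [Subgroup.commutator_comm] at h
    exact (QuotientGroup.eq_one_iff _).2 (h (Subgroup.commutator_mem_commutator hr hy))
  refine (Subgroup.closure_le _).2 ?_
  intro z hz
  simp only [Group.mem_conjugatesOfSet_iff, Set.mem_singleton_iff, exists_eq_left] at hz
  obtain ⟨g, rfl⟩ := isConj_iff.1 hz
  show QuotientGroup.mk' K _ = QuotientGroup.mk' K (kill {a} _)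
  have h1 : kill {a} (FreeGroup.of i) = FreeGroup.of i := by simp [kill, hia]
  have h3 := hai _ ((inferInstance : (NC i).Normal).conj_mem _ (of_mem_NC i) (kill {a} g))
    _ (kill_mod a g)
  rw [map_mul (kill {a}), map_mul (kill {a}), map_inv (kill {a}), h1]
  simp only [map_mul, map_inv] at h3 ⊢
  generalize QuotientGroup.mk' K g = G at *
  generalize QuotientGroup.mk' K (kill {a} g) = G' at *
  generalize QuotientGroup.mk' K (FreeGroup.of i) = X at *
  have h4 := h3.eq
  calc G * X * G⁻¹ = (G * G'⁻¹) * (G' * X * G'⁻¹) * (G * G'⁻¹)⁻¹ := by group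
    _ = _ := by rw [h4]; group

theorem iterComm_kill_mod (a : ι) (l : List ι) (hl : l ≠ []) (ha : a ∉ l) {x : FreeGroup ι}
    (hx : x ∈ iterComm (l.map NC)) : x * (kill {a} x)⁻¹ ∈ SC NC (a :: l) := by
  induction l using List.reverseRecOn generalizing x with
  | nil => exact absurd rfl hl
  | append_singleton l i ih =>
    have hia : i ≠ a := fun h => ha (by simp [h])
    have hal : a ∉ l := fun h => ha (by simp [h])
    set K := SC NC (a :: (l ++ [i])) with hK
    have hKn : K.Normal := SC_normal _ inferInstance _
    have hcomm : ∀ A B : Subgroup (FreeGroup ι), ⁅A, B⁆ ≤ K → ∀ p ∈ A, ∀ q ∈ B,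
        Commute (QuotientGroup.mk' K p) (QuotientGroup.mk' K q) := by
      intro A B h p hp q hq
      rw [← commutatorElement_eq_one_iff_commute, ← map_commutatorElement]
      exact (QuotientGroup.eq_one_iff _).2 (h (Subgroup.commutator_mem_commutator hp hq))
    by_cases hl' : l = []
    · subst hl'
      simp only [List.nil_append, List.map_singleton, iterComm, List.foldl_nil] at hx
      refine NC_kill_mod hia K ?_ hx
      exact le_SC NC (l := a :: ([] ++ [i])) (l' := [i, a]) (List.Perm.swap _ _ _)
    · suffices iterComm ((l ++ [i]).map NC) ≤
          (QuotientGroup.mk' K).eqLocus ((QuotientGroup.mk' K).comp (kill {a})) by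
        have h := this hx
        rw [← QuotientGroup.eq_one_iff, QuotientGroup.mk_mul, QuotientGroup.mk_inv, mul_inv_eq_one]
        exact h
      rw [List.map_append, List.map_singleton, iterComm_concat _ (by simpa using hl'),
        Subgroup.commutator_le]
      have hL : (iterComm (l.map NC)).Normal :=
        iterComm_normal _ (by simp only [List.mem_map]; rintro _ ⟨i, -, rfl⟩; infer_instance)
      have hD : ⁅SC NC (a :: l), NC i⁆ ≤ K := by
        refine commutator_SC_le _ _ _ _ fun l' h => ?_
        rw [← iterComm_concat _ (by rintro h'; simp_all), ← List.map_singleton, ← List.map_append]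
        exact le_SC NC (h.append_right [i])
      have hE : ⁅iterComm (l.map NC), ⁅NC i, NC a⁆⁆ ≤ K := by
        have hp : ∀ b c : ι, (l ++ [b, c]).Perm (a :: (l ++ [i])) →
            ⁅⁅iterComm (l.map NC), NC b⁆, NC c⁆ ≤ K := by
          intro b c h
          rw [← iterComm_concat _ (by simpa using hl'), ← iterComm_concat _ (by simp)]
          have := le_SC NC h
          simpa using this
        refine three_le _ _ _ _ (hp _ _ ?_) (hp _ _ ?_)
        · rw [show l ++ [i, a] = (l ++ [i]) ++ [a] by simp]
          exact List.perm_append_singleton _ _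
        · rw [show l ++ [a, i] = l ++ a :: [i] by simp]
          exact List.perm_middle
      have hE' : ∀ y ∈ NC i, y * (kill {a} y)⁻¹ ∈ ⁅NC i, NC a⁆ := fun y hy =>
        NC_kill_mod hia _ le_rfl hy
      intro x hx y hy
      show QuotientGroup.mk' K _ = QuotientGroup.mk' K (kill {a} _)
      have hx' := kill_mem_iterComm a l hx
      have hy' := kill_mem a i hy
      have d := ih hl' hal hx
      have e := hE' y hy
      have c1 := hcomm _ _ hD _ d y hy
      have c3 := (hcomm _ _ hE _ hx' _ e).symm
      have c4 := hcomm _ _ hD _ d _ (Subgroup.commutator_le_right _ _ (Subgroup.commutator_mem_commutator hx' hy'))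
      have c5 := (hcomm _ _ hE _ (Subgroup.commutator_le_left _ _ (Subgroup.commutator_mem_commutator hx' hy')) _ e).symm
      rw [map_commutatorElement (kill {a})]
      simp only [map_mul, map_inv, commutatorElement_def] at c1 c3 c4 c5 ⊢
      exact commutator_eq_of_commute c1 c3 c4 c5

theorem mem_SC_of_mem_NC (l : List ι) (hl : l ≠ []) (hnd : l.Nodup) {x : FreeGroup ι}
    (hx : ∀ i ∈ l, x ∈ NC i) : x ∈ SC NC l := by
  induction l with
  | nil => exact absurd rfl hl
  | cons a l ih =>
    rw [List.nodup_cons] at hnd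
    by_cases hl' : l = []
    · subst hl'
      exact le_SC NC (l := [a]) (l' := [a]) (List.Perm.refl _) (hx a (by simp))
    · have h1 := ih hl' hnd.2 fun i hi => hx i (by simp [hi])
      have hK : (SC NC (a :: l)).Normal := SC_normal _ inferInstance _
      have hmem : ∀ y, y ∈ (QuotientGroup.mk' (SC NC (a :: l))).eqLocus
          ((QuotientGroup.mk' (SC NC (a :: l))).comp (kill {a})) ↔
            y * (kill {a} y)⁻¹ ∈ SC NC (a :: l) := by
        intro y
        rw [← QuotientGroup.eq_one_iff (N := SC NC (a :: l)) (y * _), QuotientGroup.mk_mul, QuotientGroup.mk_inv, mul_inv_eq_one]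
        rfl
      have h2 : SC NC l ≤ (QuotientGroup.mk' (SC NC (a :: l))).eqLocus
          ((QuotientGroup.mk' (SC NC (a :: l))).comp (kill {a})) := by
        refine SC_le NC fun l' h y hy => (hmem y).2 ?_
        have h3 := iterComm_kill_mod a l' (by rintro rfl; simp_all)
          (by rw [h.mem_iff]; exact hnd.1) hy
        have h4 : SC NC (a :: l') ≤ SC NC (a :: l) := SC_le NC fun l'' h'' =>
          le_SC NC (h''.trans (h.cons a))
        exact h4 h3
      have h3 := (hmem x).1 (h2 h1)
      rwa [kill_eq_one a (hx a (by simp)), inv_one, mul_one] at h3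

end Free
end Wu

namespace Wu
noncomputable section

/-- The free group on all real labels. -/
abbrev F := FreeGroup ℝ

/-- The product of the generators labelled by `s` in increasing order. -/
def pw (s : Finset ℝ) : F := (s.sort.map FreeGroup.of).prod

@[simp] theorem pw_empty : pw ∅ = 1 := by simp [pw]
@[simp] theorem pw_singleton (a : ℝ) : pw {a} = FreeGroup.of a := by simp [pw]

theorem pw_union (s t : Finset ℝ) (h : ∀ x ∈ s, ∀ y ∈ t, x < y) : pw (s ∪ t) = pw s * pw t := by
  have : (s ∪ t).sort = s.sort ++ t.sort := by
    apply List.SortedLT.eq_of_mem_iff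
    · exact Finset.sortedLT_sort _
    · rw [List.sortedLT_iff_pairwise, List.pairwise_append]
      exact ⟨(Finset.sortedLT_sort _).pairwise, (Finset.sortedLT_sort _).pairwise,
        fun a ha b hb => h a ((Finset.mem_sort _).1 ha) b ((Finset.mem_sort _).1 hb)⟩
    · simp
  simp [pw, this]

theorem pw_insert_max (a : ℝ) (s : Finset ℝ) (h : ∀ x ∈ s, x < a) :
    pw (insert a s) = pw s * FreeGroup.of a := by
  rw [Finset.insert_eq, Finset.union_comm, pw_union _ _ (by simpa using h), pw_singleton]

theorem pw_split {s : Finset ℝ} {p : ℝ} (hp : p ∈ s) :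
    pw s = pw (s.filter (· < p)) * FreeGroup.of p * pw (s.filter (p < ·)) := by
  rw [← pw_insert_max _ _ (by simp), ← pw_union]
  · congr 1
    ext x
    simp only [Finset.mem_union, Finset.mem_insert, Finset.mem_filter]
    rcases lt_trichotomy x p with h | h | h
    · simp [h, h.ne, h.not_gt]
    · simp [h, hp]
    · simp [h, h.ne', h.not_gt]
  · intro x hx y hy
    simp only [Finset.mem_insert, Finset.mem_filter] at hx hy
    rcases hx with rfl | hx <;> linarith

theorem map_pw_congr {G : Type*} [Group G] (φ ψ : F →* G) (s : Finset ℝ)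
    (h : ∀ q ∈ s, φ (FreeGroup.of q) = ψ (FreeGroup.of q)) : φ (pw s) = ψ (pw s) := by
  induction s using Finset.induction_on_max with
  | empty => simp
  | insert a s ha ih =>
    rw [pw_insert_max _ _ ha, map_mul, map_mul, ih fun q hq => h q (by simp [hq]), h a (by simp)]

theorem map_pw_sub {G : Type*} [Group G] (φ : F →* G) (s t : Finset ℝ) (hts : t ⊆ s)
    (h : ∀ q ∈ s, q ∉ t → φ (FreeGroup.of q) = 1) : φ (pw s) = φ (pw t) := by
  induction s using Finset.induction_on_max generalizing t with
  | empty => simp [Finset.subset_empty.1 hts]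
  | insert a s ha ih =>
    rw [pw_insert_max _ _ ha, map_mul]
    have hr := ih (t.erase a) (Finset.subset_insert_iff.1 hts)
      fun q hq hqt => h q (by simp [hq]) (by
        intro h'; exact hqt (by simp [h', (ha q hq).ne]))
    rw [hr]
    by_cases hat : a ∈ t
    · rw [← map_mul, ← pw_insert_max, Finset.insert_erase hat]
      intro x hx
      rw [Finset.mem_erase] at hx
      exact ha x ((Finset.mem_insert.1 (hts hx.2)).resolve_left hx.1)
    · rw [h a (by simp) hat, mul_one, Finset.erase_eq_of_notMem hat]

/-- The relators for the set `P`. -/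
def relSet (P : Finset ℝ) : Set F := insert (pw P) {x | ∃ q ∉ P, x = FreeGroup.of q}

/-- The kernel of the word map for the set `P`. -/
def NN (P : Finset ℝ) : Subgroup F := Subgroup.normalClosure (relSet P)

instance (P : Finset ℝ) : (NN P).Normal := Subgroup.normalClosure_normal

theorem pw_mem_NN (P : Finset ℝ) : pw P ∈ NN P :=
  Subgroup.subset_normalClosure (Set.mem_insert _ _)

theorem of_mem_NN {P : Finset ℝ} {q : ℝ} (h : q ∉ P) : FreeGroup.of q ∈ NN P :=
  Subgroup.subset_normalClosure (Set.mem_insert_of_mem _ ⟨q, h, rfl⟩)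

theorem NN_le {P : Finset ℝ} {K : Subgroup F} [K.Normal] (h1 : pw P ∈ K)
    (h2 : ∀ q ∉ P, FreeGroup.of q ∈ K) : NN P ≤ K := by
  refine Subgroup.normalClosure_le_normal ?_
  rintro x (rfl | ⟨q, hq, rfl⟩)
  · exact h1
  · exact h2 q hq

theorem mk_of_eq_one {P : Finset ℝ} {q : ℝ} (h : q ∉ P) :
    QuotientGroup.mk' (NN P) (FreeGroup.of q) = 1 := (QuotientGroup.eq_one_iff _).2 (of_mem_NN h)

theorem NN_anti {P Q : Finset ℝ} (h : P ⊆ Q) : NN Q ≤ NN P := by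
  refine NN_le ?_ fun _ hq => of_mem_NN fun h' => hq (h h')
  rw [← QuotientGroup.eq_one_iff, ← QuotientGroup.mk'_apply,
    map_pw_sub _ Q P h fun _ _ hq => mk_of_eq_one hq]
  exact (QuotientGroup.eq_one_iff _).2 (pw_mem_NN P)

/-- The retraction with kernel `NN P`, eliminating the generator `p ∈ P`. -/
def ret (P : Finset ℝ) (p : ℝ) : F →* F :=
  FreeGroup.lift fun q => if q = p then (pw (P.filter (· < p)))⁻¹ * (pw (P.filter (p < ·)))⁻¹
    else if q ∈ P then FreeGroup.of q else 1

theorem ret_of_ne {P : Finset ℝ} {p q : ℝ} (h : q ∈ P) (hq : q ≠ p) :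
    ret P p (FreeGroup.of q) = FreeGroup.of q := by simp [ret, h, hq]

theorem ret_pw {P : Finset ℝ} {p : ℝ} (s : Finset ℝ) (hs : s ⊆ P) (hp : p ∉ s) :
    ret P p (pw s) = pw s :=
  map_pw_congr (ret P p) (MonoidHom.id F) s fun _ hq => ret_of_ne (hs hq) fun h => hp (h ▸ hq)

theorem mk_ret {P : Finset ℝ} {p : ℝ} (hp : p ∈ P) (x : F) : x⁻¹ * ret P p x ∈ NN P := by
  rw [← QuotientGroup.eq]
  have : QuotientGroup.mk' (NN P) = (QuotientGroup.mk' (NN P)).comp (ret P p) := by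
    ext q
    by_cases h : q = p
    · subst h
      simp only [ret, MonoidHom.comp_apply, FreeGroup.lift_apply_of, if_true]
      have := (QuotientGroup.eq_one_iff _).2 (pw_mem_NN P)
      rw [pw_split hp, ← QuotientGroup.mk'_apply, map_mul, map_mul] at this
      rw [map_mul, map_inv, map_inv]
      rw [eq_mul_inv_iff_mul_eq, eq_inv_iff_mul_eq_one]
      exact mul_eq_one_comm.1 (by rwa [mul_assoc] at this)
    · by_cases h' : q ∈ P
      · rw [MonoidHom.comp_apply, ret_of_ne h' h]
      · simpa [ret, h, h'] using of_mem_NN h'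
  exact DFunLike.congr_fun this x

theorem ker_ret {P : Finset ℝ} {p : ℝ} (hp : p ∈ P) : (ret P p).ker = NN P := by
  apply le_antisymm
  · intro x hx
    have := mk_ret hp x
    rw [MonoidHom.mem_ker] at hx
    rw [hx, mul_one] at this
    simpa using this
  · refine NN_le ?_ fun q hq => ?_
    · rw [MonoidHom.mem_ker, pw_split hp, map_mul, map_mul, ret_pw _ (by simp) (by simp),
        ret_pw _ (by simp) (by simp)]
      simp [ret]
    · have : q ≠ p := fun h => hq (h ▸ hp)
      simp [MonoidHom.mem_ker, ret, hq, this]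

theorem ret_ret {P Q : Finset ℝ} {p : ℝ} (hP : p ∈ P) (hQ : p ∈ Q) (x : F) :
    ret Q p (ret P p x) = ret (P ∩ Q) p x := by
  have key : ∀ s : Finset ℝ, s ⊆ P → p ∉ s → ret Q p (pw s) = pw (s ∩ Q) := by
    intro s hs hp
    rw [map_pw_sub (ret Q p) s (s ∩ Q) Finset.inter_subset_left,
      ret_pw _ Finset.inter_subset_right fun h => hp (Finset.mem_inter.1 h).1]
    intro q hq hq'
    have h1 : q ∉ Q := fun h => hq' (Finset.mem_inter.2 ⟨hq, h⟩)
    have h2 : q ≠ p := fun h => hp (h ▸ hq)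
    simp [ret, h1, h2]
  have : (ret Q p).comp (ret P p) = ret (P ∩ Q) p := by
    ext q
    rw [MonoidHom.comp_apply]
    by_cases h : q = p
    · subst h
      have e : ∀ s, ret s q (FreeGroup.of q) =
        (pw (s.filter (· < q)))⁻¹ * (pw (s.filter (q < ·)))⁻¹ := by intro s; simp [ret]
      rw [e, e, map_mul, map_inv, map_inv, key _ (by simp) (by simp), key _ (by simp) (by simp),
        ← Finset.filter_inter, ← Finset.filter_inter]
    · by_cases hP : q ∈ P <;> by_cases hQ : q ∈ Q <;> simp [ret, h, hP, hQ]
  exact DFunLike.congr_fun this x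

/-- The Kan extension condition for a family of subgroups indexed by finite sets, at `P`. -/
def Kan {V A : Type*} [DecidableEq V] [Group A] (N : Finset V → Subgroup A) (P : Finset V) : Prop :=
  ∀ p ∈ P, ∀ S ⊆ P.erase p, ∀ a : V → A,
    (∀ i ∈ S, ∀ j ∈ S, i ≠ j → (a i)⁻¹ * a j ∈ N ((P.erase i).erase j)) →
    ∃ g, ∀ i ∈ S, g⁻¹ * a i ∈ N (P.erase i)

theorem ret_eq_iff {P : Finset ℝ} {p : ℝ} (hp : p ∈ P) (x y : F) :
    ret P p x = ret P p y ↔ x⁻¹ * y ∈ NN P := by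
  rw [← ker_ret hp, MonoidHom.mem_ker, map_mul, map_inv, inv_mul_eq_one]

theorem kan_NN (P : Finset ℝ) : Kan NN P := by
  intro p hp S
  induction S using Finset.induction_on with
  | empty => intro _ a _; exact ⟨1, by simp⟩
  | insert i S hi ih =>
    intro hS a ha
    obtain ⟨g, hg⟩ := ih (fun x hx => hS (by simp [hx])) a
      fun i hi j hj => ha i (by simp [hi]) j (by simp [hj])
    have hne : ∀ j ∈ insert i S, p ∈ P.erase j := fun j hj =>
      Finset.mem_erase.2 ⟨(Finset.ne_of_mem_erase (hS hj)).symm, hp⟩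
    have hpi := hne i (by simp)
    refine ⟨g * (ret (P.erase i) p g)⁻¹ * ret (P.erase i) p (a i), fun j hj => ?_⟩
    rw [← ret_eq_iff (hne j hj)]
    rw [Finset.mem_insert] at hj
    rw [map_mul, map_mul, map_inv, ret_ret hpi (hne j (by simpa using hj)),
      ret_ret hpi (hne j (by simpa using hj))]
    rcases hj with rfl | hj
    · rw [Finset.inter_self, mul_inv_cancel, one_mul]
    · have hij : i ≠ j := fun h => hi (h ▸ hj)
      have hpj := hne j (by simp [hj])
      have h1 := hg j hj
      rw [← ret_eq_iff hpj] at h1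
      have h2 := ha i (by simp) j (by simp [hj]) hij
      have hpij : p ∈ (P.erase i).erase j := by
        simp only [Finset.mem_erase] at hpi hpj ⊢
        exact ⟨hpj.1, hpi⟩
      have e : P.erase i ∩ P.erase j = (P.erase i).erase j := by
        ext x; simp only [Finset.mem_inter, Finset.mem_erase]; tauto
      have e' : P.erase j ∩ P.erase i = (P.erase i).erase j := by rw [Finset.inter_comm, e]
      rw [← ret_eq_iff hpij] at h2
      have h3 : ret ((P.erase i).erase j) p g = ret ((P.erase i).erase j) p (a j) := by
        rw [← e', ← ret_ret hpj hpi, h1, ret_ret hpj hpi]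
      rw [e, h1, h3, h2, inv_mul_cancel_right]

end
end Wu

namespace Wu
noncomputable section

section Basis
variable (P : Finset ℝ) (m : ℝ)

/-- The basis element attached to the label `t`; trivial at the largest label. -/
def gen (t : ℝ) : FreeGroup ℝ := if t ∈ P.erase m then FreeGroup.of t else 1

/-- The basis element attached to the largest label of `s`. -/
def genMax (s : Finset ℝ) : FreeGroup ℝ := if h : s.Nonempty then gen P m (s.max' h) else 1

/-- The change of basis from the generators to the partial products. -/
def toBasis : F →* FreeGroup ℝ :=
  FreeGroup.lift fun q => if q ∈ P then (genMax P m (P.filter (· < q)))⁻¹ * gen P m q else 1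

theorem toBasis_pw (s : Finset ℝ) (hs : s ⊆ P)
    (h : ∀ x ∈ s, P.filter (· < x) = s.filter (· < x)) : toBasis P m (pw s) = genMax P m s := by
  induction s using Finset.induction_on_max with
  | empty => simp [genMax]
  | insert a s ha ih =>
    have hf : P.filter (· < a) = s := by
      rw [h a (by simp)]
      ext x
      simp only [Finset.mem_filter, Finset.mem_insert]
      constructor
      · rintro ⟨rfl | h1, h2⟩
        · exact absurd h2 (lt_irrefl _)
        · exact h1
      · exact fun hx => ⟨Or.inr hx, ha x hx⟩
    rw [pw_insert_max _ _ ha, map_mul, ih fun x hx => hs (by simp [hx])]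
    · have h1 : (insert a s).max' (by simp) = a := by
        apply le_antisymm
        · refine Finset.max'_le _ _ _ fun y hy => ?_
          rcases Finset.mem_insert.1 hy with rfl | hy
          · exact le_rfl
          · exact (ha y hy).le
        · exact Finset.le_max' _ _ (by simp)
      have h2 : toBasis P m (FreeGroup.of a) = (genMax P m s)⁻¹ * gen P m a := by
        simp only [toBasis, FreeGroup.lift_apply_of, hs (Finset.mem_insert_self a s), if_true, hf]
      rw [h2, mul_inv_cancel_left]
      simp [genMax, h1]
    · intro x hx
      rw [h x (by simp [hx]), Finset.filter_insert, if_neg (ha x hx).not_gt]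

variable {P m}

theorem toBasis_filter_le (t : ℝ) (ht : t ∈ P) :
    toBasis P m (pw (P.filter (· ≤ t))) = gen P m t := by
  rw [toBasis_pw]
  · have hne : (P.filter (· ≤ t)).Nonempty := ⟨t, by simp [ht]⟩
    have : (P.filter (· ≤ t)).max' hne = t := by
      apply le_antisymm
      · exact Finset.max'_le _ _ _ fun y hy => (Finset.mem_filter.1 hy).2
      · exact Finset.le_max' _ _ (by simp [ht])
    simp [genMax, hne, this]
  · exact Finset.filter_subset _ _
  · intro x hx
    ext y
    simp only [Finset.mem_filter] at hx ⊢
    exact ⟨fun h => ⟨⟨h.1, h.2.le.trans hx.2⟩, h.2⟩, fun h => ⟨h.1.1, h.2⟩⟩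

theorem ker_toBasis (hm : m ∈ P) (hP : ∀ x ∈ P, x ≤ m) : (toBasis P m).ker = NN P := by
  have hPm : P.filter (· ≤ m) = P := Finset.filter_true_of_mem hP
  apply le_antisymm
  · let η : FreeGroup ℝ →* F ⧸ NN P :=
      FreeGroup.lift fun t => QuotientGroup.mk' (NN P) (pw (P.filter (· ≤ t)))
    have hgen : ∀ t ∈ P, η (gen P m t) = QuotientGroup.mk' (NN P) (pw (P.filter (· ≤ t))) := by
      intro t ht
      by_cases h : t = m
      · subst h
        rw [hPm]
        simp only [gen, Finset.mem_erase, ne_eq, not_true_eq_false, false_and, if_false, map_one]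
        exact ((QuotientGroup.eq_one_iff _).2 (pw_mem_NN P)).symm
      · simp [gen, h, ht, η]
    have hmax : ∀ q ∈ P, η (genMax P m (P.filter (· < q))) =
        QuotientGroup.mk' (NN P) (pw (P.filter (· < q))) := by
      intro q hq
      by_cases h : (P.filter (· < q)).Nonempty
      · have hmem := Finset.max'_mem _ h
        rw [Finset.mem_filter] at hmem
        rw [genMax, dif_pos h, hgen _ hmem.1]
        congr 2
        ext x
        simp only [Finset.mem_filter, and_congr_right_iff]
        exact fun hx => ⟨fun h' => h'.trans_lt hmem.2, fun h' =>
          Finset.le_max' _ _ (Finset.mem_filter.2 ⟨hx, h'⟩)⟩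
      · rw [genMax, dif_neg h, Finset.not_nonempty_iff_eq_empty.1 h]; simp
    have : η.comp (toBasis P m) = QuotientGroup.mk' (NN P) := by
      ext q
      rw [MonoidHom.comp_apply]
      by_cases hq : q ∈ P
      · have : toBasis P m (FreeGroup.of q) = (genMax P m (P.filter (· < q)))⁻¹ * gen P m q := by
          simp [toBasis, hq]
        rw [this, map_mul, map_inv, hmax q hq, hgen q hq, ← map_inv, ← map_mul]
        congr 1
        rw [inv_mul_eq_iff_eq_mul, ← pw_insert_max _ _ (by simp)]
        congr 1
        ext x
        simp only [Finset.mem_filter, Finset.mem_insert, le_iff_lt_or_eq]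
        constructor
        · rintro ⟨h, h' | h'⟩
          · exact Or.inr ⟨h, h'⟩
          · exact Or.inl h'
        · rintro (rfl | h)
          · exact ⟨hq, Or.inr rfl⟩
          · exact ⟨h.1, Or.inl h.2⟩
      · rw [mk_of_eq_one hq]; simp [toBasis, hq]
    intro x hx
    have h1 := DFunLike.congr_fun this x
    rw [MonoidHom.comp_apply, MonoidHom.mem_ker.1 hx, map_one] at h1
    exact (QuotientGroup.eq_one_iff _).1 h1.symm
  · refine NN_le ?_ fun q hq => ?_
    · have := toBasis_filter_le (P := P) (m := m) m hm
      rw [hPm] at this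
      rw [MonoidHom.mem_ker, this]; simp [gen]
    · simp [MonoidHom.mem_ker, toBasis, hq]

end Basis

section Theta
variable (n : ℕ)

/-- The labels `0, 1, …, n`. -/
def lab : Finset ℝ := (Finset.range (n + 1)).image (Nat.cast)

/-- The homomorphism to the free group of the statement. -/
def theta : F →* FreeGroup (Fin n) :=
  FreeGroup.lift fun q => if q = 0 then ((List.ofFn fun j : Fin n => FreeGroup.of j).prod)⁻¹
    else if h : ∃ i : Fin n, q = (i : ℝ) + 1 then FreeGroup.of h.choose else 1

/-- A section of `theta`. -/
def sec : FreeGroup (Fin n) →* F := FreeGroup.lift fun i => FreeGroup.of ((i : ℝ) + 1)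

variable {n}

theorem theta_succ (i : Fin n) : theta n (FreeGroup.of ((i : ℝ) + 1)) = FreeGroup.of i := by
  have h1 : ((i : ℝ) + 1) ≠ 0 := by positivity
  have h : ∃ j : Fin n, ((i : ℝ) + 1) = (j : ℝ) + 1 := ⟨i, rfl⟩
  have h2 := h.choose_spec
  have h3 : h.choose = i := by
    apply Fin.ext
    have : ((i : ℕ) : ℝ) = (h.choose : ℕ) := by linarith
    exact_mod_cast this.symm
  simp only [theta, FreeGroup.lift_apply_of, h1, if_false, dif_pos h, h3]

theorem theta_sec (x : FreeGroup (Fin n)) : theta n (sec n x) = x := by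
  have : (theta n).comp (sec n) = MonoidHom.id _ := by
    ext i; simp [sec, theta_succ]
  exact DFunLike.congr_fun this x

theorem theta_surj : Function.Surjective (theta n) := fun x => ⟨_, theta_sec x⟩

theorem cast_mem_lab (i : Fin (n + 1)) : ((i : ℕ) : ℝ) ∈ lab n := by
  simp only [lab, Finset.mem_image, Finset.mem_range]; exact ⟨i, i.2, rfl⟩

theorem zero_mem_lab : (0 : ℝ) ∈ lab n := by simpa using cast_mem_lab (0 : Fin (n + 1))

theorem pw_lab_pos : pw ((lab n).filter (0 < ·)) = sec n (List.ofFn fun j : Fin n => FreeGroup.of j).prod := by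
  have : ((lab n).filter (0 < ·)).sort = List.ofFn fun j : Fin n => ((j : ℝ) + 1) := by
    apply List.SortedLT.eq_of_mem_iff
    · exact Finset.sortedLT_sort _
    · rw [List.sortedLT_iff_pairwise, List.pairwise_ofFn]
      intro i j hij
      have : ((i : ℕ) : ℝ) < (j : ℕ) := by exact_mod_cast hij
      linarith
    · intro a
      simp only [Finset.mem_sort, Finset.mem_filter, lab, Finset.mem_image, Finset.mem_range,
        List.mem_ofFn]
      constructor
      · rintro ⟨⟨k, hk, rfl⟩, h⟩
        have hk0 : 0 < k := by exact_mod_cast h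
        refine ⟨⟨k - 1, by omega⟩, ?_⟩
        have : ((k - 1 : ℕ) : ℝ) + 1 = ((k - 1 + 1 : ℕ) : ℝ) := by push_cast; rfl
        simp only [this]; congr 1; omega
      · rintro ⟨j, rfl⟩
        exact ⟨⟨j + 1, by omega, by push_cast; rfl⟩, by positivity⟩
  rw [pw, this, map_list_prod]
  simp only [List.map_ofFn]
  congr 2

theorem sec_theta (x : F) : sec n (theta n x) = ret (lab n) 0 x := by
  have : (sec n).comp (theta n) = ret (lab n) 0 := by
    ext q
    rw [MonoidHom.comp_apply]
    by_cases h : q = 0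
    · subst h
      have h1 : (lab n).filter (· < 0) = ∅ := by
        refine Finset.filter_eq_empty_iff.2 fun x hx => ?_
        simp only [lab, Finset.mem_image] at hx
        obtain ⟨k, -, rfl⟩ := hx
        exact not_lt.2 (Nat.cast_nonneg k)
      simp only [ret, theta, FreeGroup.lift_apply_of, if_true, h1, pw_empty, pw_lab_pos, inv_one,
        one_mul, map_inv]
    · by_cases h' : ∃ i : Fin n, q = (i : ℝ) + 1
      · obtain ⟨i, rfl⟩ := h'
        rw [theta_succ, ret_of_ne _ h]
        · simp [sec]
        · have := cast_mem_lab i.succ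
          simpa using this
      · have h2 : q ∉ lab n := by
          intro hq
          simp only [lab, Finset.mem_image, Finset.mem_range] at hq
          obtain ⟨k, hk, rfl⟩ := hq
          have hk0 : k ≠ 0 := by rintro rfl; exact h (by simp)
          refine h' ⟨⟨k - 1, by omega⟩, ?_⟩
          have : ((k - 1 : ℕ) : ℝ) + 1 = ((k - 1 + 1 : ℕ) : ℝ) := by push_cast; rfl
          simp only [this]; congr 1; omega
        simp [theta, ret, h, h', h2]
  exact DFunLike.congr_fun this x

theorem ker_theta : (theta n).ker = NN (lab n) := by
  rw [← ker_ret zero_mem_lab]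
  ext x
  rw [MonoidHom.mem_ker, MonoidHom.mem_ker, ← sec_theta]
  constructor
  · intro h; rw [h, map_one]
  · intro h; rw [← theta_sec (theta n x), h, map_one]

theorem map_NC (i : Fin (n + 1)) : (NC ((i : ℕ) : ℝ)).map (theta n) = R n i := by
  rw [NC, Subgroup.map_normalClosure _ _ theta_surj, Set.image_singleton]
  refine Fin.cases ?_ (fun j => ?_) i
  · have : theta n (FreeGroup.of (((0 : Fin (n + 1)) : ℕ) : ℝ)) =
      ((List.ofFn fun j : Fin n => FreeGroup.of j).prod)⁻¹ := by simp [theta]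
    rw [this, R, dif_pos rfl]
    apply le_antisymm
    · refine Subgroup.normalClosure_le_normal ?_
      rintro _ rfl
      exact inv_mem (Subgroup.subset_normalClosure rfl)
    · refine Subgroup.normalClosure_le_normal ?_
      rintro _ rfl
      exact inv_mem_iff.1 (Subgroup.subset_normalClosure rfl)
  · have := theta_succ j
    rw [R, dif_neg (Fin.succ_ne_zero j), Fin.pred_succ, ← this]
    simp

theorem NC_le_NN {P : Finset ℝ} {q : ℝ} : NC q ≤ NN (P.erase q) := by
  refine Subgroup.normalClosure_le_normal ?_
  rintro _ rfl
  exact of_mem_NN (by simp)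

theorem comap_R (i : Fin (n + 1)) : (R n i).comap (theta n) = NN ((lab n).erase ((i : ℕ) : ℝ)) := by
  rw [← map_NC]
  apply le_antisymm
  · rw [Subgroup.comap_map_eq, ker_theta]
    exact sup_le NC_le_NN (NN_anti (Finset.erase_subset _ _))
  · rw [Subgroup.comap_map_eq, ker_theta]
    set K := NC ((i : ℕ) : ℝ) ⊔ NN (lab n) with hK
    have hn : K.Normal := inferInstance
    refine NN_le ?_ fun q hq => ?_
    · rw [← QuotientGroup.eq_one_iff, ← QuotientGroup.mk'_apply,
        ← map_pw_sub (QuotientGroup.mk' K) (lab n) _ (Finset.erase_subset _ _)]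
      · exact (QuotientGroup.eq_one_iff _).2 ((le_sup_right : _ ≤ K) (pw_mem_NN _))
      · intro q hq hq'
        have : q = ((i : ℕ) : ℝ) := by
          by_contra h; exact hq' (Finset.mem_erase.2 ⟨h, hq⟩)
        subst this
        exact (QuotientGroup.eq_one_iff _).2 ((le_sup_left : _ ≤ K) (of_mem_NC _))
    · by_cases h : q = ((i : ℕ) : ℝ)
      · subst h; exact (le_sup_left : _ ≤ K) (of_mem_NC _)
      · exact (le_sup_right : _ ≤ K) (of_mem_NN fun h' => hq (Finset.mem_erase.2 ⟨h, h'⟩))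

theorem SC_comp {ι κ G : Type*} [Group G] (N : κ → Subgroup G) (f : ι → κ) (g : κ → ι)
    (hfg : ∀ i, g (f i) = i) (l : List ι) : SC N (l.map f) = SC (fun i => N (f i)) l := by
  apply le_antisymm
  · refine SC_le _ fun l' h => ?_
    have h1 : (l'.map g).Perm l := by
      have := h.map g
      rwa [List.map_map, show g ∘ f = id from funext hfg, List.map_id] at this
    have h2 : (l'.map g).map f = l' := by
      rw [List.map_map]
      conv_rhs => rw [← List.map_id l']
      refine List.map_congr_left fun x hx => ?_
      obtain ⟨i, -, rfl⟩ := List.mem_map.1 (h.mem_iff.1 hx)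
      simp [hfg]
    have h3 := le_SC (fun i => N (f i)) h1
    have h4 : (l'.map g).map (fun i => N (f i)) = l'.map N := by
      conv_rhs => rw [← h2]
      rw [List.map_map (f := f)]; rfl
    rwa [h4] at h3
  · refine SC_le _ fun l' h => ?_
    have := le_SC N (h.map f)
    rwa [List.map_map] at this

theorem theta_mem_symmComm (w : F) : theta n w ∈ symmComm (R n) ↔
    ∃ u, (∀ i : Fin (n + 1), u ∈ NN ((insert (-1) (lab n)).erase ((i : ℕ) : ℝ))) ∧
      u⁻¹ * w ∈ NN (lab n) := by
  have hS : symmComm (R n) =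
      (SC (fun i : Fin (n + 1) => NC ((i : ℕ) : ℝ)) (List.finRange (n + 1))).map (theta n) := by
    rw [symmComm_eq, SC_map]; simp only [map_NC]
  have hinj : Function.Injective fun i : Fin (n + 1) => ((i : ℕ) : ℝ) := fun i j h =>
    Fin.ext (Nat.cast_injective h)
  constructor
  · intro h
    rw [hS] at h
    obtain ⟨u, hu, hw⟩ := h
    refine ⟨u, fun i => ?_, ?_⟩
    · exact NC_le_NN (SC_le_mem _ (fun _ => inferInstance) _ i (List.mem_finRange i) hu)
    · rw [← ker_theta, MonoidHom.mem_ker, map_mul, map_inv, hw, inv_mul_cancel]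
  · rintro ⟨u, hu, hw⟩
    set Q : Finset ℝ := insert (-1) (lab n) with hQ
    have hm : (-1 : ℝ) ∈ Q := by simp [hQ]
    set v := ret Q (-1) u with hv
    have h1 : u⁻¹ * v ∈ NN (lab n) := NN_anti (Finset.subset_insert _ _) (mk_ret hm u)
    have h2 : theta n w = theta n v := by
      rw [← ker_theta, MonoidHom.mem_ker, map_mul, map_inv, inv_mul_eq_one] at h1 hw
      rw [← hw, h1]
    have h3 : ∀ i : Fin (n + 1), v ∈ NC ((i : ℕ) : ℝ) := by
      intro i
      have hi : ((i : ℕ) : ℝ) ≠ -1 := by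
        have : (0 : ℝ) ≤ ((i : ℕ) : ℝ) := by positivity
        linarith
      have hiQ : ((i : ℕ) : ℝ) ∈ Q := by simp [hQ, cast_mem_lab]
      suffices NN (Q.erase ((i : ℕ) : ℝ)) ≤ (NC ((i : ℕ) : ℝ)).comap (ret Q (-1)) from this (hu i)
      have hoi : ret Q (-1) (FreeGroup.of ((i : ℕ) : ℝ)) ∈ NC ((i : ℕ) : ℝ) := by
        rw [ret_of_ne hiQ hi]; exact of_mem_NC _
      refine NN_le ?_ fun q hq => ?_
      · rw [Subgroup.mem_comap, ← QuotientGroup.eq_one_iff, ← QuotientGroup.mk'_apply,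
          ← MonoidHom.comp_apply, ← map_pw_sub _ Q _ (Finset.erase_subset _ _)]
        · rw [MonoidHom.comp_apply, (MonoidHom.mem_ker (f := ret Q (-1))).1, map_one]
          rw [ker_ret hm]; exact pw_mem_NN _
        · intro q hq hq'
          have : q = ((i : ℕ) : ℝ) := by
            by_contra h; exact hq' (Finset.mem_erase.2 ⟨h, hq⟩)
          subst this
          exact (QuotientGroup.eq_one_iff _).2 hoi
      · by_cases h : q = ((i : ℕ) : ℝ)
        · subst h; exact hoi
        · have : q ∉ Q := fun h' => hq (Finset.mem_erase.2 ⟨h, h'⟩)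
          have h' : q ≠ -1 := fun h => this (h ▸ hm)
          rw [Subgroup.mem_comap]
          have : ret Q (-1) (FreeGroup.of q) = 1 := by simp [ret, h', this]
          rw [this]; exact one_mem _
    have h4 := mem_SC_of_mem_NC ((List.finRange (n + 1)).map fun i : Fin (n + 1) => ((i : ℕ) : ℝ))
      (by simp) ((List.nodup_map_iff hinj).2 (List.nodup_finRange _)) (x := v) (by
        simp only [List.mem_map]; rintro _ ⟨i, -, rfl⟩; exact h3 i)
    rw [SC_comp _ _ (Function.invFun fun i : Fin (n + 1) => ((i : ℕ) : ℝ))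
      (Function.leftInverse_invFun hinj)] at h4
    rw [h2, hS]
    exact ⟨v, h4, rfl⟩

theorem R_normal (i : Fin (n + 1)) : (R n i).Normal := by
  rw [← map_NC]
  exact Subgroup.Normal.map inferInstance _ theta_surj

end Theta
end
end Wu

namespace Wu

section LP
variable {V : Type*} [DecidableEq V]

/-- Every compatible family of cosets indexed by the simplices of `K` comes from a single
element, for all families of normal subgroups satisfying the Kan condition. -/
def LP (W : Finset V) (K : Finset V → Prop) : Prop :=
  ∀ (A : Type) [Group A] (N : Finset V → Subgroup A), (∀ σ, (N σ).Normal) →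
    (∀ σ τ, σ ⊆ τ → N τ ≤ N σ) → (∀ P ⊆ W, Kan N P) → ∀ a : Finset V → A,
    (∀ σ τ, K σ → τ ⊆ σ → τ.Nonempty → (a τ)⁻¹ * a σ ∈ N τ) →
    ∃ u, ∀ σ, K σ → σ.Nonempty → u⁻¹ * a σ ∈ N σ

theorem Kan.move {A : Type*} [Group A] {N : Finset V → Subgroup A} {W : Finset V}
    (hN : ∀ σ τ, σ ⊆ τ → N τ ≤ N σ) (hK : ∀ P ⊆ W, Kan N P) {v : V} (hv : v ∈ W) {σ : Finset V}
    (hσ : σ ⊆ W.erase v) (hne : σ.Nonempty) {x : A} (hx : x ∈ N σ) :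
    ∃ y ∈ N (W.erase v), y⁻¹ * x ∈ N (insert v σ) := by
  suffices ∀ T ⊆ W.erase v, ∃ y ∈ N (σ ∪ T), y⁻¹ * x ∈ N (insert v σ) by
    simpa [Finset.union_eq_right.2 hσ] using this _ subset_rfl
  intro T
  induction T using Finset.induction_on with
  | empty => intro _; exact ⟨x, by simpa using hx, by simp⟩
  | insert w T hw ih =>
    intro hT
    obtain ⟨y, hy, hyx⟩ := ih fun z hz => hT (by simp [hz])
    by_cases hwσ : w ∈ σ ∪ T
    · refine ⟨y, ?_, hyx⟩
      rwa [Finset.union_insert, Finset.insert_eq_of_mem hwσ]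
    have hwW := Finset.mem_erase.1 (hT (Finset.mem_insert_self w T))
    have hST : σ ∪ T ⊆ W.erase v :=
      Finset.union_subset hσ fun z hz => hT (by simp [hz])
    have hvσ : v ∉ σ ∪ T := fun h => (Finset.mem_erase.1 (hST h)).1 rfl
    obtain ⟨p, hp⟩ := hne
    have hpσ : p ∈ σ ∪ T := by simp [hp]
    have hpv : p ≠ v := fun h => hvσ (h ▸ hpσ)
    have hpw : p ≠ w := fun h => hwσ (h ▸ hpσ)
    set P := insert w (insert v (σ ∪ T)) with hP
    have hPv : P.erase v = insert w (σ ∪ T) := by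
      rw [hP, Finset.insert_comm, Finset.erase_insert]
      simp only [Finset.mem_insert, not_or]; exact ⟨hwW.1.symm, hvσ⟩
    have hPw : P.erase w = insert v (σ ∪ T) := by
      rw [hP, Finset.erase_insert]
      simp only [Finset.mem_insert, not_or]; exact ⟨hwW.1, hwσ⟩
    obtain ⟨g, hg⟩ := hK P (by
      intro z hz
      simp only [hP, Finset.mem_insert] at hz
      rcases hz with rfl | rfl | hz
      · exact hwW.2
      · exact hv
      · exact Finset.mem_of_mem_erase (hST hz)) p (by simp [hP, hpσ]) {v, w} (by
        intro z hz
        simp only [Finset.mem_insert, Finset.mem_singleton] at hz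
        rcases hz with rfl | rfl
        · simp [hP, hpv.symm]
        · simp [hP, hpw.symm]) (fun i => if i = v then 1 else y) (by
        intro i hi j hj hij
        simp only [Finset.mem_insert, Finset.mem_singleton] at hi hj
        rcases hi with rfl | rfl <;> rcases hj with rfl | rfl
        · exact absurd rfl hij
        · rw [hPv, Finset.erase_insert hwσ]
          simpa [hwW.1] using hy
        · rw [hPw, Finset.erase_insert hvσ]
          simpa [hwW.1] using hy
        · exact absurd rfl hij)
    have h1 := hg v (by simp)
    have h2 := hg w (by simp)
    rw [hPv] at h1
    rw [hPw] at h2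
    simp only [if_true, mul_one, inv_mem_iff, hwW.1, if_false] at h1 h2
    refine ⟨g, by rwa [Finset.union_insert], ?_⟩
    have h3 := mul_mem (hN _ _ (Finset.insert_subset_insert v Finset.subset_union_left) h2) hyx
    simpa [mul_assoc] using h3

theorem LP.step {W : Finset V} {K : Finset V → Prop} {v : V} (hv : v ∈ W)
    (hdown : ∀ σ τ, K σ → τ ⊆ σ → K τ) (hKW : ∀ σ, K σ → σ ⊆ W)
    (h1 : LP (W.erase v) (fun σ => K σ ∧ v ∉ σ))
    (h2 : LP (W.erase v) (fun σ => v ∉ σ ∧ K (insert v σ)))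
    (hne : ∃ τ : Finset V, τ.Nonempty ∧ v ∉ τ ∧ K (insert v τ)) : LP W K := by
  classical
  intro A _ N hn hN hK a ha
  have hWv : W.erase v ⊆ W := Finset.erase_subset _ _
  obtain ⟨u₁, hu₁⟩ := h1 A N hn hN (fun P hP => hK P (hP.trans hWv)) a
    fun σ τ hσ hτ hτn => ha σ τ hσ.1 hτ hτn
  -- the family divided by `u₁`
  have hb : ∀ σ, v ∉ σ → K (insert v σ) → σ.Nonempty → ∃ y ∈ N (W.erase v),
      y⁻¹ * (u₁⁻¹ * a (insert v σ)) ∈ N (insert v σ) := by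
    intro σ hvσ hσ hσn
    refine Kan.move hN hK hv ?_ hσn ?_
    · intro z hz
      exact Finset.mem_erase.2 ⟨fun h => hvσ (h ▸ hz), hKW _ hσ (by simp [hz])⟩
    · have e1 := hu₁ σ ⟨hdown _ _ hσ (Finset.subset_insert _ _), hvσ⟩ hσn
      have e2 := ha _ σ hσ (Finset.subset_insert _ _) hσn
      simpa [mul_assoc] using mul_mem e1 e2
  choose! b hbN hb using hb
  let A' := N (W.erase v)
  let N' : Finset V → Subgroup A' := fun σ => (N (insert v σ)).subgroupOf A'
  have hn' : ∀ σ, (N' σ).Normal := fun σ => inferInstance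
  obtain ⟨u₂, hu₂⟩ := h2 A' N' hn'
    (fun σ τ h x hx => hN _ _ (Finset.insert_subset_insert v h) hx)
    (by
      intro P hP p hp S hS c hc
      have hvP : v ∉ P := fun h => (Finset.mem_erase.1 (hP h)).1 rfl
      have hpv : p ≠ v := fun h => hvP (h ▸ hp)
      have hSP : ∀ i ∈ S, i ∈ P := fun i hi => Finset.mem_of_mem_erase (hS hi)
      have hSv : ∀ i ∈ S, i ≠ v := fun i hi h => hvP (h ▸ hSP i hi)
      have hPW : insert v P ⊆ W := Finset.insert_subset hv (hP.trans hWv)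
      obtain ⟨g, hg⟩ := hK (insert v P) hPW p (by simp [hp]) (insert v S) (by
        intro z hz
        rcases Finset.mem_insert.1 hz with rfl | hz
        · simp [hpv.symm]
        · exact Finset.mem_erase.2 ⟨Finset.ne_of_mem_erase (hS hz), by simp [hSP z hz]⟩)
        (fun i => if i = v then 1 else (c i : A)) (by
        have hcm : ∀ i, (c i : A) ∈ N (P.erase i) := fun i =>
          hN _ _ ((Finset.erase_subset _ _).trans hP) (c i).2
        intro i hi j hj hij
        rcases Finset.mem_insert.1 hi with rfl | hi' <;> rcases Finset.mem_insert.1 hj with rfl | hj'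
        · exact absurd rfl hij
        · rw [Finset.erase_insert hvP]
          simpa [hSv j hj'] using hcm j
        · rw [Finset.erase_right_comm, Finset.erase_insert hvP]
          simpa [hSv i hi'] using hcm i
        · have : (c i : A)⁻¹ * (c j : A) ∈ N (insert v ((P.erase i).erase j)) := hc i hi' j hj' hij
          rw [Finset.erase_insert_of_ne (hSv i hi').symm, Finset.erase_insert_of_ne (hSv j hj').symm]
          simpa [hSv i hi', hSv j hj'] using this)
      have hgv := hg v (by simp)
      rw [Finset.erase_insert hvP] at hgv
      simp only [if_true, mul_one, inv_mem_iff] at hgv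
      obtain ⟨y, hy, hyg⟩ := Kan.move hN hK hv hP ⟨p, hp⟩ hgv
      refine ⟨⟨y, hy⟩, fun i hi => ?_⟩
      have h3 := hg i (by simp [hi])
      rw [Finset.erase_insert_of_ne (hSv i hi).symm, if_neg (hSv i hi)] at h3
      have h4 := mul_mem (hN _ _ (Finset.insert_subset_insert v (Finset.erase_subset i P)) hyg) h3
      show y⁻¹ * (c i : A) ∈ N (insert v (P.erase i))
      simpa [mul_assoc] using h4)
    (fun σ => if h : v ∉ σ ∧ K (insert v σ) ∧ σ.Nonempty then ⟨b σ, hbN σ h.1 h.2.1 h.2.2⟩ else 1)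
    (by
      intro σ τ hσ hτ hτn
      have hvτ : v ∉ τ := fun h => hσ.1 (hτ h)
      have hKτ : K (insert v τ) := hdown _ _ hσ.2 (Finset.insert_subset_insert v hτ)
      have hσn : σ.Nonempty := hτn.mono hτ
      rw [dif_pos (c := v ∉ σ ∧ _) ⟨hσ.1, hσ.2, hσn⟩, dif_pos (c := v ∉ τ ∧ _) ⟨hvτ, hKτ, hτn⟩]
      show (b τ)⁻¹ * b σ ∈ N (insert v τ)
      have e1 := hb τ hvτ hKτ hτn
      have e2 := hN _ _ (Finset.insert_subset_insert v hτ) (hb σ hσ.1 hσ.2 hσn)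
      have e3 := ha _ (insert v τ) hσ.2 (Finset.insert_subset_insert v hτ) (by simp)
      have e4 := mul_mem (mul_mem e1 e3) (inv_mem e2)
      have e5 : (b τ)⁻¹ * (u₁⁻¹ * a (insert v τ)) * ((a (insert v τ))⁻¹ * a (insert v σ)) *
        ((b σ)⁻¹ * (u₁⁻¹ * a (insert v σ)))⁻¹ = (b τ)⁻¹ * b σ := by group
      rwa [e5] at e4)
  have key : ∀ σ, v ∉ σ → K (insert v σ) → σ.Nonempty →
      (u₁ * u₂)⁻¹ * a (insert v σ) ∈ N (insert v σ) := by
    intro σ hvσ hσ hσn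
    have e1 := hu₂ σ ⟨hvσ, hσ⟩ hσn
    rw [dif_pos ⟨hvσ, hσ, hσn⟩] at e1
    have e1 : (u₂ : A)⁻¹ * b σ ∈ N (insert v σ) := e1
    have e2 := mul_mem e1 (hb σ hvσ hσ hσn)
    simpa [mul_assoc] using e2
  refine ⟨u₁ * u₂, fun σ hσ hσn => ?_⟩
  by_cases hvσ : v ∈ σ
  · by_cases hs : (σ.erase v).Nonempty
    · have := key (σ.erase v) (by simp) (by rwa [Finset.insert_erase hvσ]) hs
      rwa [Finset.insert_erase hvσ] at this
    · have hσv : σ = {v} := by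
        rw [Finset.not_nonempty_iff_eq_empty] at hs
        rw [← Finset.insert_erase hvσ, hs, Finset.insert_empty]
      obtain ⟨τ, hτn, hvτ, hτ⟩ := hne
      have hsub : ({v} : Finset V) ⊆ insert v τ := by simp
      have e1 := hN _ _ hsub (key τ hvτ hτ hτn)
      have e2 := ha _ {v} hτ hsub (by simp)
      rw [hσv]
      simpa [mul_assoc] using mul_mem e1 (inv_mem e2)
  · have e1 := hu₁ σ ⟨hσ, hvσ⟩ hσn
    have e2 : (u₂ : A) ∈ N σ := hN σ (W.erase v) (fun z hz =>
      Finset.mem_erase.2 ⟨by rintro rfl; exact hvσ hz, hKW σ hσ hz⟩) u₂.2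
    simpa [mul_assoc] using mul_mem (inv_mem e2) e1

theorem LP.mono {W W' : Finset V} {K K' : Finset V → Prop} (h : LP W K) (hW : W ⊆ W')
    (hK : ∀ σ, σ.Nonempty → (K' σ ↔ K σ)) : LP W' K' := by
  intro A _ N hn hN hKan a ha
  obtain ⟨u, hu⟩ := h A N hn hN (fun P hP => hKan P (hP.trans hW)) a
    fun σ τ hσ hτ hτn => ha σ τ ((hK σ (hτn.mono hτ)).2 hσ) hτ hτn
  exact ⟨u, fun σ hσ hσn => hu σ ((hK σ hσn).1 hσ) hσn⟩

/-- Cones have the lifting property. -/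
theorem LP.cone {W : Finset V} {K : Finset V → Prop} {c : V} (hc : c ∈ W)
    (hdown : ∀ σ τ, K σ → τ ⊆ σ → K τ) (hKW : ∀ σ, K σ → σ ⊆ W) (hKc : K {c})
    (hcone : ∀ σ, K σ → K (insert c σ)) : LP W K := by
  induction W using Finset.strongInduction generalizing K with
  | H W ih =>
    by_cases hW : ∃ v ∈ W, v ≠ c
    · obtain ⟨v, hv, hvc⟩ := hW
      have hcW : c ∈ W.erase v := Finset.mem_erase.2 ⟨hvc.symm, hc⟩
      have hlt := Finset.erase_ssubset hv
      have hins : ∀ σ, K σ → v ∉ σ → σ ⊆ W.erase v := fun σ hσ hvσ z hz =>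
        Finset.mem_erase.2 ⟨fun h => hvσ (h ▸ hz), hKW σ hσ hz⟩
      have hnot : ∀ σ, v ∉ σ → v ∉ insert c σ := fun σ h h' =>
        (Finset.mem_insert.1 h').elim hvc h
      have h1 : LP (W.erase v) (fun σ => K σ ∧ v ∉ σ) :=
        ih _ hlt hcW (fun σ τ hσ hτ => ⟨hdown _ _ hσ.1 hτ, fun h => hσ.2 (hτ h)⟩)
          (fun σ hσ => hins σ hσ.1 hσ.2) ⟨hKc, by simpa using hvc⟩
          fun σ hσ => ⟨hcone σ hσ.1, hnot σ hσ.2⟩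
      by_cases hKv : K {v}
      · have hcv : K (insert v {c}) := by rw [Finset.pair_comm]; exact hcone _ hKv
        refine LP.step hv hdown hKW h1 ?_ ⟨{c}, by simp, by simpa using hvc, hcv⟩
        refine ih _ hlt hcW (fun σ τ hσ hτ =>
          ⟨fun h => hσ.1 (hτ h), hdown _ _ hσ.2 (Finset.insert_subset_insert v hτ)⟩)
          (fun σ hσ => hins σ (hdown _ _ hσ.2 (Finset.subset_insert _ _)) hσ.1)
          ⟨by simpa using hvc, hcv⟩
          fun σ hσ => ⟨hnot σ hσ.1, by rw [Finset.insert_comm]; exact hcone _ hσ.2⟩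
      · refine h1.mono hlt.subset fun σ _ => ⟨fun hσ => ⟨hσ, fun h => hKv (hdown _ _ hσ ?_)⟩,
          fun h => h.1⟩
        simpa using h
    · push Not at hW
      intro A _ N hn hN hK a ha
      refine ⟨a {c}, fun σ hσ hσn => ?_⟩
      have : σ = {c} := Finset.eq_singleton_iff_nonempty_unique_mem.2
        ⟨hσn, fun x hx => hW x (hKW σ hσ hx)⟩
      rw [this, inv_mul_cancel]
      exact one_mem _

/-- A vertex whose link is a cone can be removed. -/
theorem LP.dominated {W : Finset V} {K : Finset V → Prop} {v c : V} (hv : v ∈ W) (hc : c ∈ W)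
    (hvc : v ≠ c) (hdown : ∀ σ τ, K σ → τ ⊆ σ → K τ) (hKW : ∀ σ, K σ → σ ⊆ W)
    (h1 : LP (W.erase v) (fun σ => K σ ∧ v ∉ σ)) (hcone : ∀ σ, v ∈ σ → K σ → K (insert c σ)) :
    LP W K := by
  by_cases hKv : K {v}
  · have hcv : K (insert v {c}) := by
      rw [Finset.pair_comm]; exact hcone _ (by simp) hKv
    refine LP.step hv hdown hKW h1 ?_ ⟨{c}, by simp, by simpa using hvc, hcv⟩
    refine LP.cone (Finset.mem_erase.2 ⟨hvc.symm, hc⟩) (fun σ τ hσ hτ =>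
      ⟨fun h => hσ.1 (hτ h), hdown _ _ hσ.2 (Finset.insert_subset_insert v hτ)⟩)
      (fun σ hσ z hz => Finset.mem_erase.2 ⟨fun h => hσ.1 (h ▸ hz), hKW _ hσ.2 (by simp [hz])⟩)
      ⟨by simpa using hvc, hcv⟩ fun σ hσ => ⟨fun h => (Finset.mem_insert.1 h).elim hvc hσ.1, ?_⟩
    rw [Finset.insert_comm]; exact hcone _ (by simp) hσ.2
  · refine h1.mono (Finset.erase_subset _ _) fun σ _ =>
      ⟨fun hσ => ⟨hσ, fun h => hKv (hdown _ _ hσ ?_)⟩, fun h => h.1⟩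
    simpa using h

theorem LP.map {V' : Type*} [DecidableEq V'] {W' : Finset V'} {K' : Finset V' → Prop}
    (h : LP W' K') (e : V' ↪ V) {W : Finset V} {K : Finset V → Prop} (hW : W'.map e ⊆ W)
    (hK' : ∀ σ' : Finset V', K (σ'.map e) ↔ K' σ')
    (hK : ∀ σ, K σ → ∃ σ' : Finset V', σ = σ'.map e) : LP W K := by
  intro A _ N hn hN hKan a ha
  obtain ⟨u, hu⟩ := h A (fun σ' => N (σ'.map e)) (fun σ' => hn _)
    (fun σ τ hst => hN _ _ (Finset.map_subset_map.2 hst)) (by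
      intro P hP p hp S hS c hc
      have herase : ∀ (Q : Finset V') i, (Q.map e).erase (e i) = (Q.erase i).map e := by
        intro Q i; rw [Finset.map_erase]
      obtain ⟨g, hg⟩ := hKan (P.map e) ((Finset.map_subset_map.2 hP).trans hW) (e p) (by simpa)
        (S.map e) (by rw [herase]; exact Finset.map_subset_map.2 hS)
        (Function.extend e c 1) (by
          intro i hi j hj hij
          obtain ⟨i, hi', rfl⟩ := Finset.mem_map.1 hi
          obtain ⟨j, hj', rfl⟩ := Finset.mem_map.1 hj
          rw [e.injective.extend_apply, e.injective.extend_apply, herase, herase]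
          exact hc i hi' j hj' fun h => hij (by rw [h]))
      refine ⟨g, fun i hi => ?_⟩
      have := hg (e i) (by simpa using hi)
      rwa [e.injective.extend_apply, herase] at this)
    (fun σ' => a (σ'.map e)) (fun σ τ hσ hτ hτn =>
      ha _ _ ((hK' σ).2 hσ) (Finset.map_subset_map.2 hτ) (by simpa))
  refine ⟨u, fun σ hσ hσn => ?_⟩
  obtain ⟨σ', rfl⟩ := hK σ hσ
  exact hu σ' ((hK' σ').1 hσ) (by simpa using hσn)

end LP
end Wu

namespace Wu

/-- The unit interval. -/
abbrev I := unitInterval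

/-- A cover of the boundary of the cube by `n + 1` closed sets with the combinatorics of the
facets of a simplex. -/
def E : (n : ℕ) → Fin (n + 1) → Set (Fin n → I)
  | 0, _ => ∅
  | n + 1, i => Fin.cases {x | x 0 = 1} (fun j => {x | x 0 = 0 ∨ Fin.tail x ∈ E n j}) i

theorem mem_E_zero {n : ℕ} {x : Fin (n + 1) → I} : x ∈ E (n + 1) 0 ↔ x 0 = 1 := Iff.rfl

theorem mem_E_succ {n : ℕ} {j : Fin (n + 1)} {x : Fin (n + 1) → I} :
    x ∈ E (n + 1) j.succ ↔ x 0 = 0 ∨ Fin.tail x ∈ E n j := Iff.rfl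

theorem continuous_tail {n : ℕ} {X : Type*} [TopologicalSpace X] :
    Continuous (Fin.tail : (Fin (n + 1) → X) → Fin n → X) :=
  continuous_pi fun i => continuous_apply i.succ

theorem isClosed_E : ∀ (n : ℕ) (i : Fin (n + 1)), IsClosed (E n i)
  | 0, _ => isClosed_empty
  | n + 1, i => by
    refine Fin.cases ?_ (fun j => ?_) i
    · exact isClosed_eq (continuous_apply 0) continuous_const
    · exact (isClosed_eq (continuous_apply (0 : Fin (n + 1))) continuous_const).union
        ((isClosed_E n j).preimage continuous_tail)

theorem exists_mem_E : ∀ (n : ℕ) (x : Fin n → I), (∃ i, x ∈ E n i) ↔ x ∈ Cube.boundary (Fin n)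
  | 0, x => by simp [E, Cube.boundary]
  | n + 1, x => by
    have ih := exists_mem_E n (Fin.tail x)
    simp only [Cube.boundary, Set.mem_ofPred_eq, Fin.exists_fin_succ, mem_E_zero, mem_E_succ,
      exists_or, exists_const] at ih ⊢
    rw [ih]
    simp only [Fin.tail]
    tauto

theorem exists_notMem_E : ∀ (n : ℕ) (x : Fin n → I), ∃ i, x ∉ E n i
  | 0, x => ⟨0, id⟩
  | n + 1, x => by
    by_cases h : x 0 = 1
    · obtain ⟨i, hi⟩ := exists_notMem_E n (Fin.tail x)
      refine ⟨i.succ, fun hx => (mem_E_succ.1 hx).elim (fun h0 => ?_) hi⟩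
      exact one_ne_zero (h.symm.trans h0)
    · exact ⟨0, h⟩

theorem exists_mem_E_of_ne : ∀ (n : ℕ) (j : Fin (n + 1)), ∃ x, ∀ i, i ≠ j → x ∈ E n i
  | 0, j => ⟨fun _ => 0, fun i hi => (hi (Subsingleton.elim (α := Fin 1) _ _)).elim⟩
  | n + 1, j => by
    refine Fin.cases ?_ (fun j => ?_) j
    · refine ⟨fun _ => 0, fun i => Fin.cases (fun h => (h rfl).elim) (fun i _ => ?_) i⟩
      exact mem_E_succ.2 (Or.inl rfl)
    · obtain ⟨x, hx⟩ := exists_mem_E_of_ne n j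
      refine ⟨Fin.cons 1 x, fun i => Fin.cases (fun _ => ?_) (fun i hi => ?_) i⟩
      · simp [mem_E_zero]
      · exact mem_E_succ.2 (Or.inr (by simpa using hx i fun h => hi (by rw [h])))

section Grid
variable (M : ℕ)

/-- The vertices of the nerve: the boxes of a grid and the sets `E n i`. -/
abbrev GV (n : ℕ) := (Fin n → Fin (M + 1)) ⊕ Fin (n + 1)

/-- The closed interval number `c` of the grid. -/
def seg (c : Fin (M + 1)) : Set I := {s | (c : ℝ) ≤ s * (M + 1) ∧ (s : ℝ) * (M + 1) ≤ c + 1}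

/-- The closed set that belongs to a vertex of the nerve. -/
def cell {n : ℕ} : GV M n → Set (Fin n → I)
  | Sum.inl c => {x | ∀ k, x k ∈ seg M (c k)}
  | Sum.inr i => E n i

/-- The nerve of the cover. -/
def nerve (n : ℕ) (σ : Finset (GV M n)) : Prop := ∃ x, ∀ v ∈ σ, x ∈ cell M v

theorem isClosed_seg (c : Fin (M + 1)) : IsClosed (seg M c) :=
  have h : Continuous fun s : I => (s : ℝ) * (M + 1) := by fun_prop
  (isClosed_le continuous_const h).inter (isClosed_le h continuous_const)

theorem isClosed_cell {n : ℕ} (v : GV M n) : IsClosed (cell M v) := by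
  cases v with
  | inl c =>
    simp only [cell, Set.ofPred_forall]
    exact isClosed_iInter fun k => (isClosed_seg M _).preimage (continuous_apply k)
  | inr i => exact isClosed_E n i

theorem exists_mem_seg (s : I) : ∃ c, s ∈ seg M c := by
  by_cases h : s = 1
  · refine ⟨Fin.last M, ?_⟩
    subst h
    simp [seg]
  · have h0 : 0 ≤ (s : ℝ) * (M + 1) := mul_nonneg s.2.1 (by positivity)
    have h1 : (s : ℝ) * (M + 1) < (M + 1 : ℕ) := by
      push_cast
      have : (s : ℝ) < 1 := lt_of_le_of_ne s.2.2 fun h' => h (Subtype.ext h')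
      nlinarith [(Nat.cast_nonneg M : (0 : ℝ) ≤ M)]
    refine ⟨⟨⌊(s : ℝ) * (M + 1)⌋₊, (Nat.floor_lt h0).2 h1⟩, Nat.floor_le h0, ?_⟩
    exact (Nat.lt_floor_add_one _).le

theorem exists_mem_box {n : ℕ} (x : Fin n → I) : ∃ c : Fin n → Fin (M + 1), x ∈ cell M (Sum.inl c) := by
  choose c hc using fun k => exists_mem_seg M (x k)
  exact ⟨c, hc⟩

theorem one_mem_seg {c : Fin (M + 1)} : (1 : I) ∈ seg M c ↔ c = Fin.last M := by
  constructor
  · intro h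
    have := h.2
    simp only [Set.Icc.coe_one, one_mul, add_le_add_iff_right, Nat.cast_le] at this
    exact Fin.ext (le_antisymm (Nat.lt_succ_iff.1 c.2) this)
  · rintro rfl
    simp [seg]

theorem seg_nonempty (c : Fin (M + 1)) : (seg M c).Nonempty := by
  have h : (0 : ℝ) < M + 1 := by positivity
  have hc : (c : ℝ) ≤ M := by exact_mod_cast Nat.lt_succ_iff.1 c.2
  refine ⟨⟨c / (M + 1), by positivity, (div_le_one h).2 (by linarith)⟩, ?_⟩
  simp only [seg, Set.mem_ofPred_eq, div_mul_cancel₀ _ h.ne']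
  exact ⟨le_rfl, by linarith⟩

theorem box_nonempty {n : ℕ} (c : Fin n → Fin (M + 1)) : (cell M (Sum.inl c)).Nonempty :=
  ⟨fun k => (seg_nonempty M (c k)).some, fun k => (seg_nonempty M (c k)).some_mem⟩

theorem mem_box_succ {n : ℕ} {c : Fin (n + 1) → Fin (M + 1)} {x : Fin (n + 1) → I} :
    x ∈ cell M (Sum.inl c) ↔ x 0 ∈ seg M (c 0) ∧ Fin.tail x ∈ cell M (Sum.inl (Fin.tail c)) := by
  simp only [cell, Set.mem_ofPred_eq, Fin.forall_fin_succ]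
  rfl

theorem nerve_mono {n : ℕ} {σ τ : Finset (GV M n)} (h : nerve M n σ) (hτ : τ ⊆ σ) : nerve M n τ :=
  h.imp fun _ hx v hv => hx v (hτ hv)

/-- Collapsing the boxes layer by layer. -/
theorem LP_nerve_sub {n : ℕ} (W : Finset (GV M (n + 1))) (h0 : Sum.inr 0 ∉ W)
    (hE : ∀ i : Fin (n + 1), Sum.inr i.succ ∈ W)
    (hW : ∀ c c' : Fin (n + 1) → Fin (M + 1), c' 0 < c 0 → Sum.inl c ∈ W → Sum.inl c' ∈ W) :
    LP W (fun σ => nerve M (n + 1) σ ∧ σ ⊆ W) := by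
  induction W using Finset.strongInduction with
  | H W ih =>
  have hdown : ∀ σ τ, (nerve M (n + 1) σ ∧ σ ⊆ W) → τ ⊆ σ → (nerve M (n + 1) τ ∧ τ ⊆ W) :=
    fun σ τ hσ hτ => ⟨nerve_mono M hσ.1 hτ, hτ.trans hσ.2⟩
  by_cases hB : ∃ c, Sum.inl c ∈ W
  · obtain ⟨c, hc, hmax⟩ : ∃ c, Sum.inl c ∈ W ∧ ∀ c', Sum.inl c' ∈ W → c' 0 ≤ c 0 := by
      obtain ⟨c₀, hc₀⟩ := hB
      obtain ⟨c, hc, hm⟩ := Finset.exists_max_image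
        (Finset.univ.filter fun c : Fin (n + 1) → Fin (M + 1) => Sum.inl c ∈ W)
        (fun c => c 0) ⟨c₀, by simpa using hc₀⟩
      exact ⟨c, by simpa using hc, fun c' hc' => hm c' (by simpa using hc')⟩
    have h1 := ih _ (Finset.erase_ssubset hc) (fun h => h0 (Finset.mem_of_mem_erase h))
      (fun i => Finset.mem_erase.2 ⟨by simp, hE i⟩)
      (fun d d' hd hdW => Finset.mem_erase.2 ⟨fun h => by
        have := hmax d (Finset.mem_of_mem_erase hdW)
        rw [Sum.inl.injEq] at h
        subst h
        exact absurd hd (not_lt.2 this), hW d d' hd (Finset.mem_of_mem_erase hdW)⟩)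
    have h1' : LP (W.erase (Sum.inl c))
        (fun σ => (nerve M (n + 1) σ ∧ σ ⊆ W) ∧ Sum.inl c ∉ σ) := by
      refine h1.mono subset_rfl fun σ _ => ?_
      rw [Finset.subset_erase]
      tauto
    -- the point with first coordinate moved to the lower side of the layer
    have hmove : ∀ σ, Sum.inl c ∈ σ → σ ⊆ W → nerve M (n + 1) σ → ∃ x : Fin (n + 1) → I,
        (∀ v ∈ σ, x ∈ cell M v) ∧ (x 0 : ℝ) * (M + 1) = c 0 := by
      rintro σ hcσ hσW ⟨x, hx⟩
      have hxc := (mem_box_succ M).1 (hx _ hcσ)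
      have hM : (0 : ℝ) < M + 1 := by positivity
      have hc0 : ((c 0 : ℕ) : ℝ) ≤ M := by exact_mod_cast Nat.lt_succ_iff.1 (c 0).2
      let s : I := ⟨(c 0 : ℕ) / (M + 1), by positivity, (div_le_one hM).2 (by linarith)⟩
      have hs : (s : ℝ) * (M + 1) = c 0 := div_mul_cancel₀ _ hM.ne'
      refine ⟨Fin.cons s (Fin.tail x), fun v hv => ?_, by simpa using hs⟩
      rcases v with d | i
      · have hd := (mem_box_succ M).1 (hx _ hv)
        refine (mem_box_succ M).2 ⟨?_, by simpa using hd.2⟩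
        have hle : ((d 0 : ℕ) : ℝ) ≤ c 0 := by exact_mod_cast hmax d (hσW hv)
        rw [Fin.cons_zero]
        refine ⟨by rw [hs]; exact hle, ?_⟩
        rw [hs]
        exact hxc.1.1.trans hd.1.2
      · induction i using Fin.cases with
        | zero => exact absurd (hσW hv) h0
        | succ i =>
          refine mem_E_succ.2 ((mem_E_succ.1 (hx _ hv)).imp (fun h => ?_) (fun h => by simpa using h))
          rw [Fin.cons_zero]
          have h2 := hxc.1.1
          rw [h] at h2
          simp only [Set.Icc.coe_zero, zero_mul] at h2
          apply Subtype.ext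
          show ((c 0 : ℕ) : ℝ) / (M + 1) = 0
          rw [le_antisymm h2 (Nat.cast_nonneg _), zero_div]
    by_cases hc0 : c 0 = 0
    · refine LP.dominated hc (hE 0) (by simp) hdown (fun σ hσ => hσ.2) h1' fun σ hcσ hσ => ?_
      refine ⟨?_, Finset.insert_subset (hE 0) hσ.2⟩
      obtain ⟨x, hx, hx0⟩ := hmove σ hcσ hσ.2 hσ.1
      refine ⟨x, fun v hv => ?_⟩
      rcases Finset.mem_insert.1 hv with rfl | hv
      · refine mem_E_succ.2 (Or.inl ?_)
        have hM : (M + 1 : ℝ) ≠ 0 := by positivity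
        rw [hc0] at hx0
        simpa [hM] using hx0
      · exact hx v hv
    · obtain ⟨j, hj⟩ : ∃ j : Fin (M + 1), (j : ℕ) + 1 = c 0 := by
        have : (c 0 : ℕ) ≠ 0 := fun h => hc0 (Fin.ext h)
        exact ⟨⟨(c 0 : ℕ) - 1, by have := (c 0).2; omega⟩, by simp only; omega⟩
      have hdW : Sum.inl (Fin.cons j (Fin.tail c)) ∈ W :=
        hW c _ (by rw [Fin.cons_zero, Fin.lt_def]; omega) hc
      have hne : (Sum.inl c : GV M (n + 1)) ≠ Sum.inl (Fin.cons j (Fin.tail c)) := fun h => by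
        rw [Sum.inl.injEq] at h
        have := congrFun h 0
        rw [Fin.cons_zero] at this
        rw [this] at hj
        omega
      refine LP.dominated hc hdW hne hdown (fun σ hσ => hσ.2) h1' fun σ hcσ hσ => ?_
      refine ⟨?_, Finset.insert_subset hdW hσ.2⟩
      obtain ⟨x, hx, hx0⟩ := hmove σ hcσ hσ.2 hσ.1
      refine ⟨x, fun v hv => ?_⟩
      rcases Finset.mem_insert.1 hv with rfl | hv
      · refine (mem_box_succ M).2 ⟨?_, by simpa using ((mem_box_succ M).1 (hx _ hcσ)).2⟩
        rw [Fin.cons_zero]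
        have : ((c 0 : ℕ) : ℝ) = j + 1 := by rw [← hj]; push_cast; rfl
        refine ⟨by rw [hx0, this]; linarith, by rw [hx0, this]⟩
      · exact hx v hv
  · push Not at hB
    have hall : ∀ σ ⊆ W, nerve M (n + 1) σ := by
      intro σ hσ
      refine ⟨fun _ => 0, fun v hv => ?_⟩
      rcases v with d | i
      · exact absurd (hσ hv) (hB d)
      · induction i using Fin.cases with
        | zero => exact absurd (hσ hv) h0
        | succ i => exact mem_E_succ.2 (Or.inl rfl)
    refine LP.cone (hE 0) hdown (fun σ hσ => hσ.2) ⟨hall _ (by simpa using hE 0), by simpa using hE 0⟩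
      fun σ hσ => ?_
    have := Finset.insert_subset (hE 0) hσ.2
    exact ⟨hall _ this, this⟩

theorem LP_nerve : ∀ n : ℕ, LP Finset.univ (nerve M n)
  | 0 => by
    refine LP.cone (c := Sum.inl fun _ => 0) (Finset.mem_univ _)
      (fun σ τ hσ hτ => nerve_mono M hσ hτ) (fun _ _ => Finset.subset_univ _) ?_ ?_
    · exact ⟨fun _ => 0, fun v hv => by rw [Finset.mem_singleton.1 hv]; exact fun k => k.elim0⟩
    · rintro σ ⟨x, hx⟩
      refine ⟨x, fun v hv => ?_⟩
      rcases Finset.mem_insert.1 hv with rfl | hv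
      · exact fun k => k.elim0
      · exact hx v hv
  | n + 1 => by
    have hv : (Sum.inr 0 : GV M (n + 1)) ∈ Finset.univ := Finset.mem_univ _
    refine LP.step hv (fun σ τ hσ hτ => nerve_mono M hσ hτ) (fun _ _ => Finset.subset_univ _) ?_ ?_ ?_
    · refine (LP_nerve_sub M (Finset.univ.erase (Sum.inr 0)) (by simp) (fun i => by simp)
        (fun c c' _ _ => by simp)).mono subset_rfl fun σ _ => ?_
      simp only [Finset.subset_erase, Finset.subset_univ, true_and]
    · let e : GV M n ↪ GV M (n + 1) :=
        ⟨Sum.map (fun c => Fin.cons (Fin.last M) c) Fin.succ, by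
          refine Function.Injective.sumMap (fun c c' h => ?_) (Fin.succ_injective _)
          simpa using h⟩
      have he : ∀ (v : GV M n) (x : Fin (n + 1) → I), x 0 = 1 →
          (x ∈ cell M (e v) ↔ Fin.tail x ∈ cell M v) := by
        rintro (c | i) x hx
        · show x ∈ cell M (Sum.inl (Fin.cons (Fin.last M) c : Fin (n + 1) → Fin (M + 1))) ↔ _
          rw [mem_box_succ, Fin.tail_cons, Fin.cons_zero, hx, one_mem_seg]
          simp
        · show x ∈ E (n + 1) i.succ ↔ _
          rw [mem_E_succ, hx]
          simp [cell]
      have hne : ∀ v, e v ≠ Sum.inr 0 := by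
        rintro (c | i)
        · simp [e]
        · simp [e]
      refine (LP_nerve n).map e (fun w hw => ?_) (fun σ' => ⟨?_, ?_⟩) ?_
      · obtain ⟨v, _, rfl⟩ := Finset.mem_map.1 hw
        simp [hne]
      · rintro ⟨_, x, hx⟩
        have hx0 : x 0 = 1 := hx (Sum.inr 0) (Finset.mem_insert_self _ _)
        exact ⟨Fin.tail x, fun v hv => (he v x hx0).1
          (hx _ (Finset.mem_insert_of_mem (Finset.mem_map_of_mem e hv)))⟩
      · rintro ⟨x, hx⟩
        refine ⟨fun h => ?_, Fin.cons 1 x, fun w hw => ?_⟩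
        · obtain ⟨v, _, h⟩ := Finset.mem_map.1 h
          exact hne v h
        · rcases Finset.mem_insert.1 hw with rfl | hw
          · exact Fin.cons_zero _ _
          · obtain ⟨v, hv, rfl⟩ := Finset.mem_map.1 hw
            exact (he v _ (Fin.cons_zero _ _)).2 (by simpa using hx v hv)
      · rintro σ ⟨hσ0, x, hx⟩
        have hx0 : x 0 = 1 := hx (Sum.inr 0) (Finset.mem_insert_self _ _)
        refine ⟨σ.preimage e e.injective.injOn, ?_⟩
        ext w
        simp only [Finset.mem_map, Finset.mem_preimage]
        refine ⟨fun hw => ?_, ?_⟩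
        · suffices ∃ v, e v = w by
            obtain ⟨v, rfl⟩ := this
            exact ⟨v, hw, rfl⟩
          rcases w with c | i
          · have h1 := ((mem_box_succ M).1 (hx _ (Finset.mem_insert_of_mem hw))).1
            rw [hx0, one_mem_seg] at h1
            refine ⟨Sum.inl (Fin.tail c), ?_⟩
            show Sum.inl (Fin.cons (Fin.last M) (Fin.tail c)) = _
            rw [← h1, Fin.cons_self_tail]
          · induction i using Fin.cases with
            | zero => exact absurd hw hσ0
            | succ i => exact ⟨Sum.inr i, rfl⟩
        · rintro ⟨v, hv, rfl⟩
          exact hv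
    · obtain ⟨x, hx⟩ := box_nonempty M (fun _ : Fin n => (0 : Fin (M + 1)))
      refine ⟨{Sum.inl (Fin.cons (Fin.last M) fun _ => 0)}, by simp, by simp, Fin.cons 1 x, fun v hv => ?_⟩
      rw [Finset.mem_insert, Finset.mem_singleton] at hv
      rcases hv with rfl | rfl
      · exact Fin.cons_zero _ _
      · rw [mem_box_succ, Fin.cons_zero, Fin.cons_zero, one_mem_seg]
        exact ⟨rfl, by simpa using hx⟩

theorem ordConnected_seg (c : Fin (M + 1)) : (seg M c).OrdConnected := by
  refine ⟨fun x hx y hy z hz => ?_⟩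
  have hM : (0 : ℝ) ≤ M + 1 := by positivity
  have h1 : (x : ℝ) ≤ z := hz.1
  have h2 : (z : ℝ) ≤ y := hz.2
  exact ⟨hx.1.trans (mul_le_mul_of_nonneg_right h1 hM),
    (mul_le_mul_of_nonneg_right h2 hM).trans hy.2⟩

theorem isPreconnected_cells : ∀ (n : ℕ) (σ : Set (GV M n)), IsPreconnected {x | ∀ v ∈ σ, x ∈ cell M v}
  | 0, σ => Set.Subsingleton.isPreconnected fun x _ y _ => Subsingleton.elim x y
  | n + 1, σ => by
    let J : Set I := {s | (∀ c, Sum.inl c ∈ σ → s ∈ seg M (c 0)) ∧ (Sum.inr 0 ∈ σ → s = 1)}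
    let B : Set (GV M n) := {v | ∃ c, Sum.inl c ∈ σ ∧ v = Sum.inl (Fin.tail c)}
    let T : Set (GV M n) := {v | ∃ i : Fin (n + 1), Sum.inr i.succ ∈ σ ∧ v = Sum.inr i}
    have hJ : IsPreconnected J := by
      apply Set.OrdConnected.isPreconnected
      refine ⟨fun x hx y hy z hz => ⟨fun c hc => (ordConnected_seg M _).out (hx.1 c hc) (hy.1 c hc) hz,
        fun h => ?_⟩⟩
      have h1 := hz.1
      rw [hx.2 h] at h1
      exact le_antisymm z.2.2 h1
    have hcons : Continuous fun p : I × (Fin n → I) => (Fin.cons p.1 p.2 : Fin (n + 1) → I) :=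
      continuous_pi fun i => by
        refine Fin.cases ?_ (fun i => ?_) i
        · simpa using continuous_fst
        · simp only [Fin.cons_succ]; fun_prop
    set S₁ : Set (I × (Fin n → I)) := J ×ˢ {y | ∀ v ∈ B ∪ T, y ∈ cell M v}
    set S₂ : Set (I × (Fin n → I)) := (J ∩ {0}) ×ˢ {y | ∀ v ∈ B, y ∈ cell M v}
    have hS₁ : IsPreconnected S₁ := hJ.prod (isPreconnected_cells n _)
    have hS₂ : IsPreconnected S₂ :=
      (Set.Subsingleton.isPreconnected fun x hx y hy => hx.2.trans hy.2.symm).prod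
        (isPreconnected_cells n _)
    have hS : IsPreconnected (S₁ ∪ S₂) := by
      by_cases h1 : S₁.Nonempty
      · by_cases h2 : S₂.Nonempty
        · obtain ⟨⟨s, y⟩, hsy⟩ := h1
          obtain ⟨⟨s', y'⟩, hsy'⟩ := h2
          refine IsPreconnected.union (s', y) ⟨hsy'.1.1, hsy.2⟩
            ⟨hsy'.1, fun v hv => hsy.2 v (Or.inl hv)⟩ hS₁ hS₂
        · rwa [Set.not_nonempty_iff_eq_empty.1 h2, Set.union_empty]
      · rwa [Set.not_nonempty_iff_eq_empty.1 h1, Set.empty_union]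
    convert hS.image _ hcons.continuousOn
    ext x
    simp only [Set.mem_ofPred_eq, Set.mem_image]
    constructor
    · intro hx
      refine ⟨(x 0, Fin.tail x), ?_, Fin.cons_self_tail x⟩
      have hJx : x 0 ∈ J := ⟨fun c hc => ((mem_box_succ M).1 (hx _ hc)).1, fun h => hx _ h⟩
      have hBx : ∀ v ∈ B, Fin.tail x ∈ cell M v := by
        rintro v ⟨c, hc, rfl⟩
        exact ((mem_box_succ M).1 (hx _ hc)).2
      by_cases h0 : x 0 = 0
      · exact Or.inr ⟨⟨hJx, h0⟩, hBx⟩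
      · refine Or.inl ⟨hJx, fun v hv => hv.elim (hBx v) ?_⟩
        rintro ⟨i, hi, rfl⟩
        exact (mem_E_succ.1 (hx _ hi)).resolve_left h0
    · rintro ⟨⟨s, y⟩, hsy, rfl⟩ v hv
      have hsJ : s ∈ J := hsy.elim (fun h => h.1) (fun h => h.1.1)
      have hyB : ∀ v ∈ B, y ∈ cell M v := hsy.elim (fun h v hv => h.2 v (Or.inl hv)) (fun h => h.2)
      rcases v with c | i
      · refine (mem_box_succ M).2 ⟨hsJ.1 c hv, ?_⟩
        simpa using hyB _ ⟨c, hv, rfl⟩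
      · induction i using Fin.cases with
        | zero => exact hsJ.2 hv
        | succ i =>
          refine mem_E_succ.2 (hsy.elim (fun h => Or.inr ?_) (fun h => Or.inl h.1.2))
          have := h.2 _ (Or.inr ⟨i, hv, rfl⟩)
          rwa [Fin.tail_cons]

end Grid
end Wu

namespace Wu

open Topology Bundle

/-- Data for a covering space with two charts whose deck group is the discrete group `G`. -/
structure Glue (B G : Type) [TopologicalSpace B] [Group G] where
  U : Bool → Set B
  isOpen_U : ∀ i, IsOpen (U i)
  idx : B → Bool
  mem_idx : ∀ x, x ∈ U (idx x)
  y : B → G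
  y_cont : ∀ x ∈ U true, x ∈ U false → ∀ᶠ x' in 𝓝 x, y x' = y x

namespace Glue

variable {B G : Type} [TopologicalSpace B] [Group G] (D : Glue B G)

/-- The change of the label on passing from the chart `true` to the chart `i`. -/
def Y (i : Bool) (x : B) : G := if i then 1 else D.y x

theorem Y_cont {i j : Bool} {x : B} (hi : x ∈ D.U i) (hj : x ∈ D.U j) (hij : i ≠ j) (k : Bool) :
    ∀ᶠ x' in 𝓝 x, D.Y k x' = D.Y k x := by
  cases k
  · have h : x ∈ D.U true ∧ x ∈ D.U false := by cases i <;> cases j <;> simp_all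
    simpa [Y] using D.y_cont x h.1 h.2
  · simp [Y]

variable [TopologicalSpace G] [DiscreteTopology G]

/-- The fiber bundle of the covering. -/
def core : FiberBundleCore Bool B G where
  baseSet := D.U
  isOpen_baseSet := D.isOpen_U
  indexAt := D.idx
  mem_baseSet_at := D.mem_idx
  coordChange i j x a := a * (D.Y i x)⁻¹ * D.Y j x
  coordChange_self i x _ v := by group
  coordChange_comp i j k x _ v := by group
  continuousOn_coordChange i j := by
    rintro ⟨x, a⟩ hx
    by_cases hij : i = j
    · subst hij
      refine (continuous_snd.continuousWithinAt).congr (fun p _ => ?_) ?_ <;>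
      · exact inv_mul_cancel_right (G := G) _ _
    · apply ContinuousAt.continuousWithinAt
      refine ContinuousAt.congr (f := fun p : B × G => p.2 * (D.Y i x)⁻¹ * D.Y j x) ?_ ?_
      · exact (continuous_of_discreteTopology (f := fun a : G =>
          a * (D.Y i x)⁻¹ * D.Y j x)).continuousAt.comp continuousAt_snd
      · have h1 := D.Y_cont hx.1.1 hx.1.2 hij i
        have h2 := D.Y_cont hx.1.1 hx.1.2 hij j
        filter_upwards [continuousAt_fst.eventually h1, continuousAt_fst.eventually h2] with p h1 h2
        rw [h1, h2]

/-- The total space of the covering. -/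
abbrev T : Type := D.core.TotalSpace

/-- The projection of the covering. -/
def pr : D.T → B := D.core.proj

theorem isCoveringMap_pr : IsCoveringMap D.pr :=
  FiberBundle.isCoveringMap (F := G) (E := D.core.Fiber)

theorem continuous_pr : Continuous D.pr := D.isCoveringMap_pr.continuous

/-- The label of a point in its preferred chart. -/
def lbl (z : D.T) : G := z.2

/-- The label of a point in the chart `i`. -/
def co (i : Bool) (z : D.T) : G := D.lbl z * (D.Y (D.idx z.1) z.1)⁻¹ * D.Y i z.1

/-- The sheet over the chart `i` with label `g`. -/
def sec (i : Bool) (g : G) (x : B) : D.T := ⟨x, (g * (D.Y i x)⁻¹ * D.Y (D.idx x) x : G)⟩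

@[simp] theorem pr_sec (i : Bool) (g : G) (x : B) : D.pr (D.sec i g x) = x := rfl

@[simp] theorem co_sec (i : Bool) (g : G) (x : B) : D.co i (D.sec i g x) = g := by
  show g * (D.Y i x)⁻¹ * D.Y (D.idx x) x * (D.Y (D.idx x) x)⁻¹ * D.Y i x = g
  group

theorem co_sec' (i j : Bool) (g : G) (x : B) :
    D.co j (D.sec i g x) = g * (D.Y i x)⁻¹ * D.Y j x := by
  show g * (D.Y i x)⁻¹ * D.Y (D.idx x) x * (D.Y (D.idx x) x)⁻¹ * D.Y j x = _
  group

theorem sec_co (i : Bool) (z : D.T) : D.sec i (D.co i z) (D.pr z) = z := by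
  have h : D.lbl z * (D.Y (D.idx z.1) z.1)⁻¹ * D.Y i z.1 * (D.Y i z.1)⁻¹ *
      D.Y (D.idx z.1) z.1 = D.lbl z := by group
  exact congrArg (fun g : G => (⟨z.1, g⟩ : D.T)) h

theorem co_change (i j : Bool) (z : D.T) :
    D.co j z = D.co i z * (D.Y i (D.pr z))⁻¹ * D.Y j (D.pr z) := by
  show D.lbl z * _ * D.Y j z.1 = D.lbl z * _ * D.Y i z.1 * (D.Y i z.1)⁻¹ * D.Y j z.1
  group

theorem continuousOn_sec (i : Bool) (g : G) : ContinuousOn (D.sec i g) (D.U i) := by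
  have h : ∀ x, D.sec i g x = (D.core.localTriv i).toOpenPartialHomeomorph.symm (x, (g : G)) := fun x => rfl
  have h2 : ContinuousOn (fun x : B => (x, (g : G))) (D.U i) := by fun_prop
  refine ContinuousOn.congr ?_ fun x _ => h x
  exact (D.core.localTriv i).toOpenPartialHomeomorph.continuousOn_symm.comp h2
    fun x hx => (D.core.mem_localTriv_target i _).2 hx

theorem co_eventually {i : Bool} {z : D.T} (hz : D.pr z ∈ D.U i) :
    ∀ᶠ z' in 𝓝 z, D.co i z' = D.co i z := by
  have h : ContinuousAt (fun z' : D.T => ((D.core.localTriv i) z').2) z :=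
    continuousAt_snd.comp ((D.core.localTriv i).continuousAt ((D.core.mem_localTriv_source i z).2 hz))
  have h2 : ∀ z' : D.T, ((D.core.localTriv i) z').2 = (D.co i z' : G) := fun z' => rfl
  have h3 := h.eventually (show ∀ᶠ g in 𝓝 _, g = _ by rw [nhds_discrete]; exact rfl)
  exact h3

theorem continuousAt_T {Z : Type*} [TopologicalSpace Z] {f : Z → D.T} {z : Z} {i : Bool}
    (h1 : ContinuousAt (fun z => D.pr (f z)) z) (hi : D.pr (f z) ∈ D.U i)
    (h2 : ∀ᶠ z' in 𝓝 z, D.co i (f z') = D.co i (f z)) : ContinuousAt f z := by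
  have h3 : ContinuousAt (fun z' => D.sec i (D.co i (f z)) (D.pr (f z'))) z :=
    ContinuousAt.comp (f := fun z' => D.pr (f z'))
      ((D.continuousOn_sec i _).continuousAt ((D.isOpen_U i).mem_nhds hi)) h1
  refine h3.congr ?_
  filter_upwards [h2] with z' hz'
  rw [← hz', sec_co]

end Glue
end Wu

namespace Wu

open Topology

/-- Every continuous map into `U` from a closed subset of a compact Hausdorff space extends. -/
def EP {Z : Type} [TopologicalSpace Z] (U : Set Z) : Prop :=
  ∀ (Y : Type) [TopologicalSpace Y] [CompactSpace Y] [T2Space Y] (C : Set Y) (f : Y → Z),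
    IsClosed C → ContinuousOn f C → Set.MapsTo f C U →
    ∃ g : Y → Z, Continuous g ∧ (∀ y, g y ∈ U) ∧ Set.EqOn g f C

theorem EP.of_retract {Z Z' : Type} [TopologicalSpace Z] [TopologicalSpace Z'] {U : Set Z} {U' : Set Z'}
    (h : EP U') (s : Z' → Z) (r : Z → Z') (hs : ContinuousOn s U') (hsU : Set.MapsTo s U' U)
    (hr : ContinuousOn r U) (hrU : Set.MapsTo r U U') (hsr : ∀ z ∈ U, s (r z) = z) : EP U := by
  intro Y _ _ _ C f hC hf hfU
  obtain ⟨g, hg, hgU, hgf⟩ := h Y C (r ∘ f) hC (hr.comp hf hfU) (hrU.comp hfU)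
  refine ⟨s ∘ g, hs.comp_continuous hg hgU, fun y => hsU (hgU y), fun y hy => ?_⟩
  simp only [Function.comp_apply, hgf hy]
  exact hsr _ (hfU hy)

theorem EP.union {Z : Type} [TopologicalSpace Z] {A B : Set Z} (hA : IsOpen A) (hB : IsOpen B)
    (hEA : EP A) (hEB : EP B) (hEAB : EP (A ∩ B)) : EP (A ∪ B) := by
  classical
  intro Y _ _ _ C f hC hf hfU
  have hCA : IsClosed (C ∩ f ⁻¹' Aᶜ) := hf.preimage_isClosed_of_isClosed hC hA.isClosed_compl
  have hCB : IsClosed (C ∩ f ⁻¹' Bᶜ) := hf.preimage_isClosed_of_isClosed hC hB.isClosed_compl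
  obtain ⟨u, hu0, hu1, -⟩ := exists_continuous_zero_one_of_isClosed hCA hCB (by
    rw [Set.disjoint_left]
    rintro y ⟨hy, hyA⟩ ⟨-, hyB⟩
    exact (hfU hy).elim hyA hyB)
  have hZ : IsClosed {y | u y = 1 / 2} := isClosed_eq u.continuous continuous_const
  obtain ⟨g₀, hg₀, hg₀U, hg₀f⟩ := hEAB Y (C ∩ {y | u y = 1 / 2}) f (hC.inter hZ)
    (hf.mono Set.inter_subset_left) (by
      rintro y ⟨hy, hyu⟩
      constructor
      · by_contra h
        have := hu0 (show y ∈ C ∩ f ⁻¹' Aᶜ from ⟨hy, h⟩)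
        simp only [Pi.zero_apply] at this
        have hyu : u y = 1 / 2 := hyu
        linarith
      · by_contra h
        have := hu1 (show y ∈ C ∩ f ⁻¹' Bᶜ from ⟨hy, h⟩)
        simp only [Pi.one_apply] at this
        have hyu : u y = 1 / 2 := hyu
        linarith)
  let f₁ : Y → Z := C.piecewise f g₀
  have hf₁C : Set.EqOn f₁ f C := fun y hy => Set.piecewise_eq_of_mem _ _ _ hy
  have hf₁Z : Set.EqOn f₁ g₀ {y | u y = 1 / 2} := fun y hy => by
    by_cases h : y ∈ C
    · rw [hf₁C h, hg₀f ⟨h, hy⟩]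
    · exact Set.piecewise_eq_of_notMem _ _ _ h
  have hf₁ : ContinuousOn f₁ (C ∪ {y | u y = 1 / 2}) :=
    (hf.congr hf₁C).union_of_isClosed (hg₀.continuousOn.congr hf₁Z) hC hZ
  have hle : IsClosed {y | 1 / 2 ≤ u y} := isClosed_le continuous_const u.continuous
  have hge : IsClosed {y | u y ≤ 1 / 2} := isClosed_le u.continuous continuous_const
  obtain ⟨gA, hgA, hgAU, hgAf⟩ := hEA Y ((C ∪ {y | u y = 1 / 2}) ∩ {y | 1 / 2 ≤ u y}) f₁
    ((hC.union hZ).inter hle) (hf₁.mono Set.inter_subset_left) (by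
      rintro y ⟨hy | hy, hyu⟩
      · rw [hf₁C hy]
        by_contra h
        have := hu0 (show y ∈ C ∩ f ⁻¹' Aᶜ from ⟨hy, h⟩)
        simp only [Pi.zero_apply] at this
        have hyu : 1 / 2 ≤ u y := hyu
        linarith
      · rw [hf₁Z hy]; exact (hg₀U y).1)
  obtain ⟨gB, hgB, hgBU, hgBf⟩ := hEB Y ((C ∪ {y | u y = 1 / 2}) ∩ {y | u y ≤ 1 / 2}) f₁
    ((hC.union hZ).inter hge) (hf₁.mono Set.inter_subset_left) (by
      rintro y ⟨hy | hy, hyu⟩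
      · rw [hf₁C hy]
        by_contra h
        have := hu1 (show y ∈ C ∩ f ⁻¹' Bᶜ from ⟨hy, h⟩)
        simp only [Pi.one_apply] at this
        have hyu : u y ≤ 1 / 2 := hyu
        linarith
      · rw [hf₁Z hy]; exact (hg₀U y).2)
  refine ⟨fun y => if 1 / 2 ≤ u y then gA y else gB y,
    Continuous.if_le hgA hgB continuous_const u.continuous fun y hy => ?_, fun y => ?_, fun y hy => ?_⟩
  · rw [hgAf ⟨Or.inr hy.symm, hy.le⟩, hgBf ⟨Or.inr hy.symm, hy.ge⟩]
  · dsimp only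
    split_ifs
    · exact Or.inl (hgAU y)
    · exact Or.inr (hgBU y)
  · dsimp only
    split_ifs with h
    · rw [hgAf ⟨Or.inl hy, h⟩, hf₁C hy]
    · rw [hgBf ⟨Or.inl hy, (not_le.1 h).le⟩, hf₁C hy]

/-- The space in which everything takes place. -/
abbrev E3 := ℝ × ℝ × ℝ

theorem EP.of_starConvex {U : Set E3} {c : E3} (hU : IsOpen U) (hc : c ∈ U) (hst : StarConvex ℝ c U) :
    EP U := by
  intro Y _ _ _ C f hC hf hfU
  obtain ⟨F, hF⟩ := ContinuousMap.exists_restrict_eq hC ⟨C.domRestrict f, hf.domRestrict⟩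
  have hFf : Set.EqOn F f C := fun y hy => DFunLike.congr_fun hF ⟨y, hy⟩
  have hV : IsClosed (F ⁻¹' Uᶜ) := hU.isClosed_compl.preimage F.continuous
  obtain ⟨u, hu0, hu1, hu⟩ := exists_continuous_zero_one_of_isClosed hV hC (by
    rw [Set.disjoint_left]
    intro y hy hyC
    rw [Set.mem_preimage, hFf hyC] at hy
    exact hy (hfU hyC))
  refine ⟨fun y => c + u y • (F y - c), by fun_prop, fun y => ?_, fun y hy => ?_⟩
  · by_cases hy : F y ∈ U
    · have := hst hy (sub_nonneg.2 (hu y).2) (hu y).1 (by ring)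
      convert this using 1
      module
    · have : u y = 0 := hu0 (show y ∈ F ⁻¹' Uᶜ from hy)
      simpa [this] using hc
  · have : u y = 1 := hu1 hy
    simp [this, hFf hy]

section Tree
variable {S : Type} [DecidableEq S]

/-- The parent of a vertex of the Cayley tree of a free group. -/
def parent (w : FreeGroup S) : FreeGroup S := FreeGroup.mk w.toWord.tail

theorem toWord_parent (w : FreeGroup S) : (parent w).toWord = w.toWord.tail := by
  rw [parent, FreeGroup.toWord_mk]
  exact FreeGroup.IsReduced.reduce_eq (List.IsChain.tail FreeGroup.isReduced_toWord)

theorem parent_of_adj {w v : FreeGroup S} (x : S × Bool) (hv : v = FreeGroup.mk [x] * w)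
    (hle : v.toWord.length ≤ w.toWord.length) : v = parent w := by
  have h : v.toWord = FreeGroup.reduce (x :: w.toWord) := by
    rw [hv, FreeGroup.toWord_mul, FreeGroup.toWord_mk, FreeGroup.reduce_singleton]
    rfl
  rw [FreeGroup.reduce.cons, FreeGroup.reduce_toWord] at h
  rw [← FreeGroup.toWord_inj, toWord_parent]
  rcases hw : w.toWord with _ | ⟨a, l⟩
  · rw [hw] at h hle
    rw [h] at hle
    simp at hle
  · rw [hw] at h hle
    dsimp only at h
    split_ifs at h with h1
    · rw [h]; rfl
    · rw [h] at hle
      simp at hle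

theorem parent_adj {w : FreeGroup S} (hw : w ≠ 1) : ∃ x, parent w = FreeGroup.mk [x] * w := by
  rcases h : w.toWord with _ | ⟨⟨a, b⟩, l⟩
  · rw [FreeGroup.toWord_eq_nil_iff] at h
    exact (hw h).elim
  · refine ⟨(a, !b), ?_⟩
    have hw' : w = FreeGroup.mk ((a, b) :: l) := by rw [← h, FreeGroup.mk_toWord]
    have h2 : FreeGroup.mk [(a, !b)] * w = FreeGroup.mk ((a, !b) :: (a, b) :: l) := by
      rw [hw', FreeGroup.mul_mk]; rfl
    rw [h2, parent, h]
    exact (Quot.sound (FreeGroup.Red.Step.cons_not_rev (x := a) (b := b))).symm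

theorem EP.tree {Z : Type} [TopologicalSpace Z] (D : FreeGroup S → Set Z) (hD : ∀ w, IsOpen (D w))
    (hE : ∀ w, EP (D w)) (hadj : ∀ w v, w ≠ v → (D w ∩ D v).Nonempty → ∃ x, v = FreeGroup.mk [x] * w)
    (hED : ∀ w x, EP (D w ∩ D (FreeGroup.mk [x] * w))) : EP (⋃ w, D w) := by
  -- finite subtrees
  have key : ∀ A : Finset (FreeGroup S), A.Nonempty → (∀ w ∈ A, w ≠ 1 → parent w ∈ A) →
      EP (⋃ w ∈ A, D w) := by
    intro A
    induction A using Finset.strongInduction with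
    | H A ih =>
    intro hne hA
    obtain ⟨w, hw, hmax⟩ := Finset.exists_max_image A (fun w => w.toWord.length) hne
    by_cases h1 : (A.erase w).Nonempty
    · have hw1 : w ≠ 1 := by
        rintro rfl
        obtain ⟨v, hv⟩ := h1
        have : v.toWord.length ≤ (1 : FreeGroup S).toWord.length := hmax v (Finset.mem_of_mem_erase hv)
        rw [FreeGroup.toWord_one, List.length_nil, Nat.le_zero, List.length_eq_zero_iff] at this
        exact (Finset.ne_of_mem_erase hv) (FreeGroup.toWord_eq_nil_iff.1 this)
      have hpw : ∀ v : FreeGroup S, v ≠ 1 → parent v ≠ v := by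
        intro v hv h
        have h2 := congrArg List.length (toWord_parent v)
        rw [h, List.length_tail] at h2
        have h3 : v.toWord.length ≠ 0 := by
          rwa [Ne, List.length_eq_zero_iff, FreeGroup.toWord_eq_nil_iff]
        omega
      have hpA : parent w ∈ A.erase w := Finset.mem_erase.2 ⟨hpw w hw1, hA w hw hw1⟩
      have h2 := ih _ (Finset.erase_ssubset hw) h1 fun v hv hv1 => by
        refine Finset.mem_erase.2 ⟨fun h => ?_, hA v (Finset.mem_of_mem_erase hv) hv1⟩
        have h2 := congrArg List.length (toWord_parent v)
        have h3 := hmax v (Finset.mem_of_mem_erase hv)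
        have h4 : v.toWord.length ≠ 0 := by
          rwa [Ne, List.length_eq_zero_iff, FreeGroup.toWord_eq_nil_iff]
        rw [h, List.length_tail] at h2
        omega
      have hAw : (⋃ v ∈ A, D v) = D w ∪ ⋃ v ∈ A.erase w, D v := by
        rw [← Finset.insert_erase hw, Finset.set_biUnion_insert, Finset.erase_insert_eq_erase,
          Finset.erase_idem]
      rw [hAw]
      refine EP.union (hD w) (isOpen_biUnion fun v _ => hD v) (hE w) h2 ?_
      have hD_inter : D w ∩ ⋃ v ∈ A.erase w, D v = D w ∩ D (parent w) := by
        ext z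
        simp only [Set.mem_inter_iff, Set.mem_iUnion, and_congr_right_iff]
        refine fun hz => ⟨?_, fun h => ⟨_, hpA, h⟩⟩
        rintro ⟨v, hv, hzv⟩
        obtain ⟨x, hx⟩ := hadj w v (Finset.ne_of_mem_erase hv).symm ⟨z, hz, hzv⟩
        rwa [← parent_of_adj x hx (hmax v (Finset.mem_of_mem_erase hv))]
      rw [hD_inter]
      obtain ⟨x, hx⟩ := parent_adj hw1
      rw [hx]
      exact hED w x
    · have : A = {w} := by
        rw [Finset.not_nonempty_iff_eq_empty] at h1
        rw [← Finset.insert_erase hw, h1, Finset.insert_empty]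
      rw [this]
      simpa using hE w
  have hclo : ∀ n (w : FreeGroup S), w.toWord.length ≤ n → ∃ A : Finset (FreeGroup S), w ∈ A ∧
      (∀ w ∈ A, w ≠ 1 → parent w ∈ A) := by
    intro n
    induction n with
    | zero =>
      intro w hw
      rw [Nat.le_zero, List.length_eq_zero_iff, FreeGroup.toWord_eq_nil_iff] at hw
      exact ⟨{1}, by simp [hw], fun v hv hv1 => (hv1 (Finset.mem_singleton.1 hv)).elim⟩
    | succ n ih =>
      intro w hw
      obtain ⟨A, hwA, hA⟩ := ih (parent w) (by rw [toWord_parent, List.length_tail]; omega)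
      refine ⟨insert w A, by simp, fun v hv hv1 => ?_⟩
      rcases Finset.mem_insert.1 hv with rfl | hv
      · exact Finset.mem_insert_of_mem hwA
      · exact Finset.mem_insert_of_mem (hA v hv hv1)
  choose! A hwA hA using fun w : FreeGroup S => hclo _ w le_rfl
  intro Y _ _ _ C f hC hf hfU
  obtain ⟨t, ht⟩ := (hC.isCompact.image_of_continuousOn hf).elim_finite_subcover D hD (by
    rintro _ ⟨y, hy, rfl⟩; exact hfU hy)
  have hsub : ∀ w ∈ A 1 ∪ t.biUnion A, w ≠ 1 → parent w ∈ A 1 ∪ t.biUnion A := by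
    intro w hw hw1
    rcases Finset.mem_union.1 hw with hw | hw
    · exact Finset.mem_union_left _ (hA _ _ hw hw1)
    · obtain ⟨v, hv, hw⟩ := Finset.mem_biUnion.1 hw
      exact Finset.mem_union_right _ (Finset.mem_biUnion.2 ⟨v, hv, hA _ _ hw hw1⟩)
  obtain ⟨g, hg, hgU, hgf⟩ := key (A 1 ∪ t.biUnion A) ⟨1, Finset.mem_union_left _ (hwA 1)⟩ hsub Y C f hC hf (by
    intro y hy
    obtain ⟨w, hw, hyw⟩ := Set.mem_iUnion₂.1 (ht (Set.mem_image_of_mem f hy))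
    exact Set.mem_biUnion (Finset.mem_union_right _ (Finset.mem_biUnion.2 ⟨w, hw, hwA w⟩)) hyw)
  refine ⟨g, hg, fun y => ?_, hgf⟩
  obtain ⟨w, _, hw⟩ := Set.mem_iUnion₂.1 (hgU y)
  exact Set.mem_iUnion.2 ⟨w, hw⟩

end Tree
end Wu

namespace Wu

open Topology

noncomputable section

/-- The group of words modulo the relators for `P`, with the discrete topology. -/
def Phi (P : Finset ℝ) : Type := F ⧸ NN P

instance (P : Finset ℝ) : Group (Phi P) := inferInstanceAs (Group (F ⧸ NN P))
instance (P : Finset ℝ) : TopologicalSpace (Phi P) := ⊥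
instance (P : Finset ℝ) : DiscreteTopology (Phi P) := ⟨rfl⟩

/-- The class of a word. -/
def cl (P : Finset ℝ) : F →* Phi P := QuotientGroup.mk' (NN P)

theorem cl_surjective (P : Finset ℝ) : Function.Surjective (cl P) := QuotientGroup.mk'_surjective _

theorem cl_eq_one {P : Finset ℝ} {x : F} : cl P x = 1 ↔ x ∈ NN P := QuotientGroup.eq_one_iff x

theorem cl_eq {P : Finset ℝ} {x y : F} : cl P x = cl P y ↔ x⁻¹ * y ∈ NN P := by
  rw [← cl_eq_one, map_mul, map_inv, inv_mul_eq_one]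

/-- The map of words modulo relators for a smaller set of labels. -/
def clMap {Q P : Finset ℝ} (h : Q ⊆ P) : Phi P →* Phi Q :=
  QuotientGroup.map (NN P) (NN Q) (MonoidHom.id F) (NN_anti h)

theorem clMap_cl {Q P : Finset ℝ} (h : Q ⊆ P) (x : F) : clMap h (cl P x) = cl Q x := rfl

/-- The free basis of the group of words modulo relators. -/
def freeMap (P : Finset ℝ) (m : ℝ) : FreeGroup ↥(P.erase m) →* Phi P :=
  FreeGroup.lift fun t => cl P (pw (P.filter (· ≤ (t : ℝ))))

theorem freeMap_of {P : Finset ℝ} {m : ℝ} (t : ↥(P.erase m)) :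
    freeMap P m (FreeGroup.of t) = cl P (pw (P.filter (· ≤ (t : ℝ)))) := by simp [freeMap]

theorem freeMap_injective {P : Finset ℝ} {m : ℝ} (hm : m ∈ P) (hP : ∀ x ∈ P, x ≤ m) :
    Function.Injective (freeMap P m) := by
  let Tb : Phi P →* FreeGroup ℝ := QuotientGroup.lift (NN P) (toBasis P m) (ker_toBasis hm hP).ge
  have h : Tb.comp (freeMap P m) = FreeGroup.map Subtype.val := by
    ext t
    rw [MonoidHom.comp_apply, freeMap_of]
    show toBasis P m _ = _
    rw [toBasis_filter_le _ (Finset.mem_of_mem_erase t.2), gen, if_pos t.2, FreeGroup.map.of]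
  have h2 : Function.Injective (Tb.comp (freeMap P m)) := by
    rw [h]; exact FreeGroup.map_injective Subtype.val_injective
  exact Function.Injective.of_comp (f := Tb) h2

theorem freeMap_surjective {P : Finset ℝ} {m : ℝ} (hP : ∀ x ∈ P, x ≤ m) :
    Function.Surjective (freeMap P m) := by
  have h1 : ∀ t ∈ P, cl P (pw (P.filter (· ≤ t))) ∈ (freeMap P m).range := by
    intro t ht
    by_cases h : t = m
    · rw [h, Finset.filter_true_of_mem hP, cl_eq_one.2 (pw_mem_NN P)]
      exact one_mem _
    · exact ⟨FreeGroup.of ⟨t, Finset.mem_erase.2 ⟨h, ht⟩⟩, freeMap_of _⟩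
  have h2 : ∀ t, cl P (pw (P.filter (· < t))) ∈ (freeMap P m).range := by
    intro t
    by_cases h : (P.filter (· < t)).Nonempty
    · have h3 := Finset.mem_filter.1 ((P.filter (· < t)).max'_mem h)
      convert h1 _ h3.1 using 3
      ext x
      simp only [Finset.mem_filter, and_congr_right_iff]
      exact fun hx => ⟨fun hxt => Finset.le_max' _ _ (Finset.mem_filter.2 ⟨hx, hxt⟩),
        fun hxt => lt_of_le_of_lt hxt h3.2⟩
    · rw [Finset.not_nonempty_iff_eq_empty.1 h, pw_empty, map_one]
      exact one_mem _
  have h3 : ∀ q, cl P (FreeGroup.of q) ∈ (freeMap P m).range := by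
    intro q
    by_cases hq : q ∈ P
    · have h4 : insert q (P.filter (· < q)) = P.filter (· ≤ q) := by
        ext x
        simp only [Finset.mem_insert, Finset.mem_filter, le_iff_eq_or_lt]
        constructor
        · rintro (rfl | h)
          · exact ⟨hq, Or.inl rfl⟩
          · exact ⟨h.1, Or.inr h.2⟩
        · rintro ⟨h, rfl | h'⟩
          · exact Or.inl rfl
          · exact Or.inr ⟨h, h'⟩
      have h5 := pw_insert_max q (P.filter (· < q)) (by simp)
      rw [h4] at h5
      rw [← inv_mul_eq_iff_eq_mul.2 h5, map_mul, map_inv]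
      exact mul_mem (inv_mem (h2 q)) (h1 q hq)
    · rw [cl_eq_one.2 (of_mem_NN hq)]
      exact one_mem _
  intro g
  obtain ⟨w, rfl⟩ := cl_surjective P g
  suffices h : w ∈ (freeMap P m).range.comap (cl P) from h
  have h6 : (⊤ : Subgroup F) ≤ (freeMap P m).range.comap (cl P) := by
    rw [← FreeGroup.closure_range_of, Subgroup.closure_le]
    rintro _ ⟨q, rfl⟩
    exact h3 q
  exact h6 (Subgroup.mem_top w)

/-- The point lies on none of the rays labelled by `P`, disregarding the height. -/
def good (P : Finset ℝ) : Set E3 := {x | ∀ p ∈ P, ¬ (0 ≤ x.2.1 ∧ x.2.2 = p * x.2.1)}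

/-- The complement of the rays labelled by `P`. -/
def XP (P : Finset ℝ) : Set E3 := {x | x.1 ≠ 0 ∨ x ∈ good P}

/-- The two contractible open sets covering the complement of the rays. -/
def WP (P : Finset ℝ) (i : Bool) : Set E3 := {x | (if i then 0 < x.1 else x.1 < 0) ∨ x ∈ good P}

theorem WP_subset_XP (P : Finset ℝ) (i : Bool) : WP P i ⊆ XP P := by
  rintro x (hx | hx)
  · left
    cases i
    · exact (by simpa using hx : x.1 < 0).ne
    · exact (by simpa using hx : 0 < x.1).ne'
  · exact Or.inr hx

theorem mem_good_of_mem_WP {P : Finset ℝ} {x : E3} (h1 : x ∈ WP P true) (h2 : x ∈ WP P false) :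
    x ∈ good P := by
  rcases h1 with h1 | h1
  · rcases h2 with h2 | h2
    · have h1 : 0 < x.1 := by simpa using h1
      have h2 : x.1 < 0 := by simpa using h2
      exact absurd h1 h2.not_gt
    · exact h2
  · exact h1

theorem good_anti {Q P : Finset ℝ} (h : Q ⊆ P) : good P ⊆ good Q := fun _ hx p hp => hx p (h hp)

theorem XP_anti {Q P : Finset ℝ} (h : Q ⊆ P) : XP P ⊆ XP Q := fun _ hx => hx.imp id (good_anti h ·)

theorem WP_anti {Q P : Finset ℝ} (h : Q ⊆ P) (i : Bool) : WP P i ⊆ WP Q i :=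
  fun _ hx => hx.imp id (good_anti h ·)

theorem isOpen_good (P : Finset ℝ) : IsOpen (good P) := by
  have : good P = ⋂ p ∈ P, {x | ¬ (0 ≤ x.2.1 ∧ x.2.2 = p * x.2.1)} := by
    ext x; simp [good]
  rw [this]
  refine isOpen_biInter_finset fun p _ => IsClosed.isOpen_compl (s := {x : E3 | 0 ≤ x.2.1 ∧ x.2.2 = p * x.2.1}) (self := ?_)
  exact (isClosed_le (f := fun _ : E3 => (0 : ℝ)) (g := fun x : E3 => x.2.1) (by fun_prop)
    (by fun_prop)).inter (isClosed_eq (f := fun x : E3 => x.2.2) (g := fun x : E3 => p * x.2.1)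
    (by fun_prop) (by fun_prop))

theorem isOpen_WP (P : Finset ℝ) (i : Bool) : IsOpen (WP P i) := by
  refine IsOpen.union (s₁ := {x : E3 | if i then 0 < x.1 else x.1 < 0}) ?_ (isOpen_good P)
  cases i
  · simpa using isOpen_lt (f := fun x : E3 => x.1) (by fun_prop) continuous_const
  · simpa using isOpen_lt (g := fun x : E3 => x.1) continuous_const (by fun_prop)

/-- The transition function of the covering. -/
def trans (P : Finset ℝ) (x : E3) : F :=
  if x.2.1 ≤ 0 then 1 else pw (P.filter fun p => p * x.2.1 < x.2.2)

theorem cl_trans_eventually {P : Finset ℝ} {x : E3} (hx : x ∈ good P) :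
    ∀ᶠ x' in 𝓝 x, cl P (trans P x') = cl P (trans P x) := by
  rcases lt_or_ge x.2.1 0 with ha | ha
  · filter_upwards [(isOpen_lt (f := fun x : E3 => x.2.1) (by fun_prop) continuous_const).mem_nhds ha] with x' hx'
    have hx' : x'.2.1 < 0 := hx'
    rw [trans, trans, if_pos hx'.le, if_pos ha.le]
  · have h1 : ∀ p ∈ P, ∀ᶠ x' : E3 in 𝓝 x, (p * x'.2.1 < x'.2.2 ↔ p * x.2.1 < x.2.2) := by
      intro p hp
      have hne : x.2.2 ≠ p * x.2.1 := fun h => hx p hp ⟨ha, h⟩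
      rcases lt_or_gt_of_ne hne with h | h
      · filter_upwards [(isOpen_lt (f := fun x : E3 => x.2.2) (g := fun x : E3 => p * x.2.1) (by fun_prop) (by fun_prop)).mem_nhds h] with x' hx'
        have hx' : x'.2.2 < p * x'.2.1 := hx'
        exact iff_of_false hx'.not_gt h.not_gt
      · filter_upwards [(isOpen_lt (g := fun x : E3 => x.2.2) (f := fun x : E3 => p * x.2.1) (by fun_prop) (by fun_prop)).mem_nhds h] with x' hx'
        exact iff_of_true hx' h
    have h2 : ∀ᶠ x' : E3 in 𝓝 x, (P.filter fun p => p * x'.2.1 < x'.2.2) = P.filter fun p => p * x.2.1 < x.2.2 := by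
      filter_upwards [(Filter.eventually_all_finset P).2 h1] with x' hx'
      exact Finset.filter_congr hx'
    rcases ha.eq_or_lt with ha | ha
    · filter_upwards [h2] with x' hx'
      rw [trans, trans, hx', if_pos ha.ge]
      split_ifs
      · rfl
      · by_cases hc : 0 < x.2.2
        · rw [Finset.filter_true_of_mem (by simpa [← ha] using fun _ _ => hc), map_one, cl_eq_one]
          exact pw_mem_NN P
        · rw [Finset.filter_false_of_mem (by simpa [← ha] using fun _ _ => not_lt.1 hc), pw_empty]
    · filter_upwards [h2, (isOpen_lt (g := fun x : E3 => x.2.1) continuous_const (by fun_prop)).mem_nhds ha] with x' hx' ha'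
      have ha' : 0 < x'.2.1 := ha'
      rw [trans, trans, hx', if_neg ha.not_ge, if_neg ha'.not_ge]

/-- The covering of the complement of the rays labelled by `P`. -/
def cov (P : Finset ℝ) : Glue (XP P) (Phi P) where
  U i := Subtype.val ⁻¹' WP P i
  isOpen_U i := (isOpen_WP P i).preimage continuous_subtype_val
  idx x := decide (0 ≤ x.1.1)
  mem_idx x := by
    rcases x.2 with h | h
    · left
      rcases lt_or_gt_of_ne h with h | h
      · simp [h.not_ge, h]
      · simp [h.le, h]
    · exact Or.inr h
  y x := cl P (trans P x)
  y_cont x h1 h2 := continuousAt_subtype_val.eventually (cl_trans_eventually (mem_good_of_mem_WP h1 h2))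

theorem Glue.exists_map {B B' G G' : Type} [TopologicalSpace B] [Group G] [TopologicalSpace G]
    [DiscreteTopology G] [TopologicalSpace B'] [Group G'] [TopologicalSpace G']
    [DiscreteTopology G'] (D : Glue B G) (D' : Glue B' G') (φ : B → B') (hφ : Continuous φ)
    (ψ : G → G') (hU : ∀ i x, x ∈ D.U i → φ x ∈ D'.U i)
    (hψ : ∀ a x, ψ (a * D.y x) = ψ a * D'.y (φ x)) :
    ∃ Φ : D.T → D'.T, Continuous Φ ∧ ∀ z, D'.pr (Φ z) = φ (D.pr z) ∧ ∀ j, D'.co j (Φ z) = ψ (D.co j z) := by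
  have h1 : ∀ z j, D'.co j (D'.sec true (ψ (D.co true z)) (φ (D.pr z))) = ψ (D.co j z) := by
    intro z j
    rw [Glue.co_sec', D.co_change true j z]
    cases j
    · simp [Glue.Y, hψ]
    · simp [Glue.Y]
  refine ⟨fun z => D'.sec true (ψ (D.co true z)) (φ (D.pr z)), ?_, fun z => ⟨rfl, h1 z⟩⟩
  rw [continuous_iff_continuousAt]
  intro z
  have h2 := D.mem_idx (D.pr z)
  refine D'.continuousAt_T (i := D.idx (D.pr z)) ?_ (hU _ _ h2) ?_
  · exact (hφ.comp D.continuous_pr).continuousAt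
  · filter_upwards [D.co_eventually h2] with z' hz'
    rw [h1, h1, hz']

end
end Wu

namespace Wu

open Topology

noncomputable section

variable {P : Finset ℝ}

/-- The base point, in the complement of all rays. -/
def bE : E3 := (1, 0, 0)

theorem bE_mem (P : Finset ℝ) : bE ∈ XP P := Or.inl one_ne_zero

theorem smul_mem_good {x : E3} (hx : x ∈ good P) {β : ℝ} (hβ : 0 < β) (h : ℝ) :
    ((h, β * x.2.1, β * x.2.2) : E3) ∈ good P := by
  rintro p hp ⟨h1, h2⟩
  refine hx p hp ⟨nonneg_of_mul_nonneg_right h1 hβ, ?_⟩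
  have h2 : β * x.2.2 = p * (β * x.2.1) := h2
  have h3 : β * (x.2.2 - p * x.2.1) = 0 := by linear_combination h2
  rcases mul_eq_zero.1 h3 with h4 | h4
  · exact absurd h4 hβ.ne'
  · linarith

theorem ep_WP (P : Finset ℝ) (i : Bool) : EP (WP P i) := by
  have key : ∀ s : ℝ, (if i then 0 < s else s < 0) → EP (WP P i) := by
    intro s hs
    refine EP.of_starConvex (c := (s, 0, 0)) (isOpen_WP P i) (Or.inl hs) ?_
    intro x hx α β hα hβ hαβ
    have e : α • ((s, 0, 0) : E3) + β • x = (α * s + β * x.1, β * x.2.1, β * x.2.2) := by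
      ext <;> simp
    rw [e]
    rcases hβ.eq_or_lt with rfl | hβ
    · left
      have : α = 1 := by linarith
      simpa [this] using hs
    · rcases hx with hx | hx
      · left
        cases i
        · simp only [Bool.false_eq_true, if_false] at hs hx ⊢
          nlinarith [mul_nonneg hα (neg_nonneg.2 hs.le), mul_pos hβ (neg_pos.2 hx)]
        · simp only [if_true] at hs hx ⊢
          nlinarith [mul_nonneg hα hs.le, mul_pos hβ hx]
      · exact Or.inr (smul_mem_good hx hβ _)
  cases i
  · exact key (-1) (by simp)
  · exact key 1 (by simp)

/-- The sector of the plane containing the negative axis. -/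
def sector₀ (P : Finset ℝ) : Set E3 :=
  {x | x.2.1 < 0 ∨ (∀ p ∈ P, p * x.2.1 < x.2.2) ∨ ∀ p ∈ P, x.2.2 < p * x.2.1}

/-- The sector just above the ray with label `t`. -/
def sector (P : Finset ℝ) (t : ℝ) : Set E3 :=
  {x | 0 < x.2.1 ∧ ∀ p ∈ P, (p ≤ t → p * x.2.1 < x.2.2) ∧ (t < p → x.2.2 < p * x.2.1)}

theorem sector₀_subset_good : sector₀ P ⊆ good P := by
  rintro x (h | h | h) p hp ⟨h1, h2⟩
  · exact h.not_ge h1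
  · exact (h p hp).ne' h2
  · exact (h p hp).ne h2

theorem sector_subset_good {t : ℝ} : sector P t ⊆ good P := by
  rintro x ⟨-, h⟩ p hp ⟨-, h2⟩
  rcases le_or_gt p t with hpt | hpt
  · exact ((h p hp).1 hpt).ne' h2
  · exact ((h p hp).2 hpt).ne h2

theorem continuous_lin (p : ℝ) : Continuous fun x : E3 => p * x.2.1 := by fun_prop
theorem continuous_c : Continuous fun x : E3 => x.2.2 := by fun_prop

theorem isOpen_sector₀ : IsOpen (sector₀ P) := by
  have : sector₀ P = {x | x.2.1 < 0} ∪ ((⋂ p ∈ P, {x | p * x.2.1 < x.2.2}) ∪ ⋂ p ∈ P, {x | x.2.2 < p * x.2.1}) := by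
    ext x; simp [sector₀]
  rw [this]
  refine (isOpen_lt (by fun_prop) continuous_const).union (IsOpen.union ?_ ?_)
  · exact isOpen_biInter_finset fun p _ => isOpen_lt (continuous_lin p) continuous_c
  · exact isOpen_biInter_finset fun p _ => isOpen_lt continuous_c (continuous_lin p)

theorem isOpen_sector (t : ℝ) : IsOpen (sector P t) := by
  have : sector P t = {x | 0 < x.2.1} ∩ ((⋂ p ∈ P.filter (· ≤ t), {x | p * x.2.1 < x.2.2}) ∩
      ⋂ p ∈ P.filter (t < ·), {x | x.2.2 < p * x.2.1}) := by
    ext x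
    simp only [sector, Finset.mem_filter, Set.mem_inter_iff, Set.mem_iInter, and_imp,
      Set.mem_ofPred_eq]
    exact and_congr_right fun _ => ⟨fun h => ⟨fun p hp hpt => (h p hp).1 hpt,
      fun p hp hpt => (h p hp).2 hpt⟩, fun h p hp => ⟨h.1 p hp, h.2 p hp⟩⟩
  rw [this]
  refine (isOpen_lt continuous_const (by fun_prop)).inter (IsOpen.inter ?_ ?_)
  · exact isOpen_biInter_finset fun p _ => isOpen_lt (continuous_lin p) continuous_c
  · exact isOpen_biInter_finset fun p _ => isOpen_lt continuous_c (continuous_lin p)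

theorem ep_sector₀ {m : ℝ} (hm : m ∈ P) (hP : ∀ x ∈ P, x ≤ m) : EP (sector₀ P) := by
  refine EP.of_starConvex (c := (0, -1, -m)) isOpen_sector₀ (Or.inl (by simp)) ?_
  intro x hx α β hα hβ hαβ
  have e : α • ((0, -1, -m) : E3) + β • x = (β * x.1, -α + β * x.2.1, -(α * m) + β * x.2.2) := by
    ext <;> simp
  rw [e]
  by_cases ha : -α + β * x.2.1 < 0
  · exact Or.inl ha
  · push Not at ha
    have hβ0 : 0 < β := by
      rcases hβ.eq_or_lt with rfl | h
      · exfalso; linarith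
      · exact h
    have hx0 : 0 ≤ x.2.1 := by
      by_contra h
      push Not at h
      nlinarith [mul_pos hβ0 (neg_pos.2 h)]
    right
    rcases hx with hx | hx | hx
    · exact absurd hx hx0.not_gt
    · left
      intro p hp
      show p * (-α + β * x.2.1) < -(α * m) + β * x.2.2
      have h1 := mul_pos hβ0 (sub_pos.2 (hx m hm))
      have h2 := mul_nonneg (sub_nonneg.2 (hP p hp)) ha
      nlinarith
    · right
      intro p hp
      show -(α * m) + β * x.2.2 < p * (-α + β * x.2.1)
      have h1 := mul_pos hβ0 (sub_pos.2 (hx p hp))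
      have h2 := mul_nonneg (sub_nonneg.2 (hP p hp)) hα
      nlinarith

theorem convex_sector (t : ℝ) : Convex ℝ (sector P t) := by
  intro x hx y hy α β hα hβ hαβ
  have key : ∀ u v : ℝ, 0 < u → 0 < v → 0 < α * u + β * v := by
    intro u v hu hv
    rcases hα.eq_or_lt with rfl | hα
    · have : β = 1 := by linarith
      simpa [this] using hv
    · nlinarith [mul_pos hα hu, mul_nonneg hβ hv.le]
  have e : α • x + β • y = (α * x.1 + β * y.1, α * x.2.1 + β * y.2.1, α * x.2.2 + β * y.2.2) := by
    ext <;> simp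
  rw [e]
  refine ⟨key _ _ hx.1 hy.1, fun p hp => ⟨fun h => ?_, fun h => ?_⟩⟩
  · have := key _ _ (sub_pos.2 ((hx.2 p hp).1 h)) (sub_pos.2 ((hy.2 p hp).1 h))
    show p * (α * x.2.1 + β * y.2.1) < α * x.2.2 + β * y.2.2
    nlinarith
  · have := key _ _ (sub_pos.2 ((hx.2 p hp).2 h)) (sub_pos.2 ((hy.2 p hp).2 h))
    show α * x.2.2 + β * y.2.2 < p * (α * x.2.1 + β * y.2.1)
    nlinarith

theorem ep_sector (t : ℝ) : EP (sector P t) := by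
  have hc : ∃ c, t < c ∧ ∀ p ∈ P, t < p → c < p := by
    by_cases h : (P.filter (t < ·)).Nonempty
    · have h1 := (Finset.mem_filter.1 ((P.filter (t < ·)).min'_mem h)).2
      obtain ⟨c, h2, h3⟩ := exists_between h1
      exact ⟨c, h2, fun p hp hpt => h3.trans_le (Finset.min'_le _ _ (Finset.mem_filter.2 ⟨hp, hpt⟩))⟩
    · rw [Finset.not_nonempty_iff_eq_empty, Finset.filter_eq_empty_iff] at h
      exact ⟨t + 1, by linarith, fun p hp hpt => (h hp hpt).elim⟩
  obtain ⟨c, h1, h2⟩ := hc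
  have hmem : ((0, 1, c) : E3) ∈ sector P t :=
    ⟨one_pos, fun p hp => ⟨fun h => by simpa using h.trans_lt h1, fun h => by simpa using h2 p hp h⟩⟩
  exact EP.of_starConvex (isOpen_sector t) hmem ((convex_sector t).starConvex hmem)

theorem trans_sector {t : ℝ} {x : E3} (hx : x ∈ sector P t) : trans P x = pw (P.filter (· ≤ t)) := by
  rw [trans, if_neg hx.1.not_ge]
  congr 1
  refine Finset.filter_congr fun p hp => ⟨fun h => ?_, (hx.2 p hp).1⟩
  by_contra h'
  exact ((hx.2 p hp).2 (not_le.1 h')).not_gt h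

theorem trans_sector₀ {x : E3} (hx : x ∈ sector₀ P) : cl P (trans P x) = 1 := by
  rw [trans]
  split_ifs with ha
  · exact map_one _
  · rcases hx with hx | hx | hx
    · exact absurd hx.le ha
    · rw [Finset.filter_true_of_mem hx, cl_eq_one]
      exact pw_mem_NN P
    · rw [Finset.filter_false_of_mem fun p hp => (hx p hp).not_gt, pw_empty, map_one]

theorem good_cases {m : ℝ} (hm : m ∈ P) (hP : ∀ x ∈ P, x ≤ m) {x : E3} (hx : x ∈ good P) :
    x ∈ sector₀ P ∨ ∃ t ∈ P.erase m, x ∈ sector P t := by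
  rcases lt_trichotomy x.2.1 0 with ha | ha | ha
  · exact Or.inl (Or.inl ha)
  · left; right
    have hc : x.2.2 ≠ 0 := fun h => hx m hm ⟨ha.ge, by rw [ha, h, mul_zero]⟩
    rcases lt_or_gt_of_ne hc with h | h
    · right; intro p _; simpa [ha] using h
    · left; intro p _; simpa [ha] using h
  · have hne : ∀ p ∈ P, x.2.2 ≠ p * x.2.1 := fun p hp h => hx p hp ⟨ha.le, h⟩
    by_cases h1 : (P.filter fun p => p * x.2.1 < x.2.2).Nonempty
    · have h2 := Finset.max'_mem _ h1
      set t := (P.filter fun p => p * x.2.1 < x.2.2).max' h1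
      obtain ⟨ht, htx⟩ := Finset.mem_filter.1 h2
      have h3 : ∀ p ∈ P, p ≤ t → p * x.2.1 < x.2.2 := fun p hp hpt =>
        (mul_le_mul_of_nonneg_right hpt ha.le).trans_lt htx
      by_cases htm : t = m
      · exact Or.inl (Or.inr (Or.inl fun p hp => h3 p hp (htm ▸ hP p hp)))
      · refine Or.inr ⟨t, Finset.mem_erase.2 ⟨htm, ht⟩, ha, fun p hp => ⟨h3 p hp, fun hpt => ?_⟩⟩
        refine lt_of_le_of_ne (not_lt.1 fun h => hpt.not_ge ?_) (hne p hp)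
        exact Finset.le_max' _ _ (Finset.mem_filter.2 ⟨hp, h⟩)
    · rw [Finset.not_nonempty_iff_eq_empty, Finset.filter_eq_empty_iff] at h1
      exact Or.inl (Or.inr (Or.inr fun p hp => lt_of_le_of_ne (not_lt.1 (h1 hp)) (hne p hp)))

/-- The part of a sheet lying over a subset of a chart. -/
def slab (P : Finset ℝ) (i : Bool) (a : Phi P) (U : Set E3) : Set (cov P).T :=
  {z | ((cov P).pr z : E3) ∈ U ∧ (cov P).co i z = a}

theorem continuous_prE : Continuous fun z : (cov P).T => ((cov P).pr z : E3) :=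
  continuous_subtype_val.comp (cov P).continuous_pr

theorem isOpen_slab {i : Bool} {a : Phi P} {U : Set E3} (hU : IsOpen U) (hUW : U ⊆ WP P i) :
    IsOpen (slab P i a U) := by
  rw [isOpen_iff_mem_nhds]
  rintro z ⟨hz, hza⟩
  filter_upwards [(hU.preimage continuous_prE).mem_nhds hz,
    (cov P).co_eventually (i := i) (z := z) (hUW hz)] with z' h1 h2
  exact ⟨h1, h2.trans hza⟩

open Classical in
theorem ep_slab {i : Bool} {a : Phi P} {U : Set E3} (h : EP U) (hUW : U ⊆ WP P i) :
    EP (slab P i a U) := by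
  let s : E3 → (cov P).T := fun x => (cov P).sec i a (if h : x ∈ XP P then ⟨x, h⟩ else ⟨bE, bE_mem P⟩)
  have hs : ∀ (x : E3) (h : x ∈ XP P), s x = (cov P).sec i a ⟨x, h⟩ := fun x h => by simp [s, h]
  have hUX : U ⊆ XP P := hUW.trans (WP_subset_XP P i)
  refine h.of_retract s (fun z => ((cov P).pr z : E3)) ?_ ?_ continuous_prE.continuousOn
    (fun z hz => hz.1) ?_
  · rw [continuousOn_iff_continuous_domRestrict]
    have h1 : U.domRestrict s = fun x : U => (cov P).sec i a ⟨x, hUX x.2⟩ := by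
      ext1 x; exact hs _ _
    rw [h1]
    exact ((cov P).continuousOn_sec i a).comp_continuous (by fun_prop) fun x => hUW x.2
  · intro x hx
    rw [hs x (hUX hx)]
    exact ⟨hx, (cov P).co_sec _ _ _⟩
  · rintro z ⟨hz, rfl⟩
    rw [hs _ (hUX hz)]
    exact (cov P).sec_co i z

theorem co_false (z : (cov P).T) : (cov P).co false z = (cov P).co true z * cl P (trans P ((cov P).pr z)) := by
  rw [(cov P).co_change true false]
  simp [Glue.Y, cov]

/-- A pair of sheets, one over each chart. -/
def sheet (P : Finset ℝ) (a : Phi P) : Set (cov P).T := slab P true a (WP P true) ∪ slab P false a (WP P false)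

theorem ep_sheet {m : ℝ} (hm : m ∈ P) (hP : ∀ x ∈ P, x ≤ m) (a : Phi P) : EP (sheet P a) := by
  refine EP.union (isOpen_slab (isOpen_WP P true) subset_rfl) (isOpen_slab (isOpen_WP P false) subset_rfl)
    (ep_slab (ep_WP P true) subset_rfl) (ep_slab (ep_WP P false) subset_rfl) ?_
  have h : slab P true a (WP P true) ∩ slab P false a (WP P false) = slab P true a (sector₀ P) := by
    ext z
    constructor
    · rintro ⟨⟨h1, h2⟩, h3, h4⟩
      have hg := mem_good_of_mem_WP h1 h3
      refine ⟨?_, h2⟩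
      rw [co_false, h2, mul_eq_left] at h4
      rcases good_cases hm hP hg with h | ⟨t, ht, h⟩
      · exact h
      · exfalso
        rw [trans_sector h] at h4
        have := freeMap_of (P := P) (m := m) ⟨t, ht⟩
        rw [h4, ← map_one (freeMap P m)] at this
        exact FreeGroup.of_ne_one _ (freeMap_injective hm hP this)
    · rintro ⟨h1, h2⟩
      have hg := sector₀_subset_good h1
      refine ⟨⟨Or.inr hg, h2⟩, Or.inr hg, ?_⟩
      rw [co_false, h2, trans_sector₀ h1, mul_one]
  rw [h]
  exact ep_slab (ep_sector₀ hm hP) (sector₀_subset_good.trans fun x hx => Or.inr hx)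

theorem sheet_adj {m : ℝ} (hm : m ∈ P) (hP : ∀ x ∈ P, x ≤ m) {a b : Phi P} (hab : a ≠ b) {z : (cov P).T}
    (h1 : z ∈ slab P true a (WP P true)) (h2 : z ∈ slab P false b (WP P false)) :
    ∃ t : ↥(P.erase m), b = a * freeMap P m (FreeGroup.of t) ∧ ((cov P).pr z : E3) ∈ sector P t := by
  have hg := mem_good_of_mem_WP h1.1 h2.1
  have h3 := h2.2
  rw [co_false, h1.2] at h3
  rcases good_cases hm hP hg with h | ⟨t, ht, h⟩
  · rw [trans_sector₀ h, mul_one] at h3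
    exact (hab h3).elim
  · refine ⟨⟨t, ht⟩, ?_, h⟩
    rw [freeMap_of, ← h3, trans_sector h]

theorem ep_cov (hne : P.Nonempty) : EP (Set.univ : Set (cov P).T) := by
  obtain ⟨m, hm, hP⟩ : ∃ m ∈ P, ∀ x ∈ P, x ≤ m := ⟨P.max' hne, P.max'_mem hne, fun x hx => P.le_max' x hx⟩
  have hinj := freeMap_injective hm hP
  have hn : ∀ w v : FreeGroup ↥(P.erase m), w ≠ v → (freeMap P m w)⁻¹ ≠ (freeMap P m v)⁻¹ :=
    fun w v h h' => h (hinj (inv_injective h'))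
  have hU : (⋃ w, sheet P (freeMap P m w)⁻¹) = Set.univ := by
    rw [Set.eq_univ_iff_forall]
    intro z
    have h1 : ∀ i, ((cov P).pr z : E3) ∈ WP P i → z ∈ ⋃ w, sheet P (freeMap P m w)⁻¹ := by
      intro i hi
      obtain ⟨w, hw⟩ := freeMap_surjective hP ((cov P).co i z)⁻¹
      refine Set.mem_iUnion.2 ⟨w, ?_⟩
      cases i
      · exact Or.inr ⟨hi, by rw [hw, inv_inv]⟩
      · exact Or.inl ⟨hi, by rw [hw, inv_inv]⟩
    exact h1 _ ((cov P).mem_idx ((cov P).pr z))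
  rw [← hU]
  have hslab : ∀ {w v : FreeGroup ↥(P.erase m)}, w ≠ v → ∀ {z}, z ∈ sheet P (freeMap P m w)⁻¹ →
      z ∈ sheet P (freeMap P m v)⁻¹ →
      (∃ t : ↥(P.erase m), w = FreeGroup.of t * v ∧ ((cov P).pr z : E3) ∈ sector P (t : ℝ) ∧ (cov P).co true z = (freeMap P m w)⁻¹) ∨
      (∃ t : ↥(P.erase m), v = FreeGroup.of t * w ∧ ((cov P).pr z : E3) ∈ sector P (t : ℝ) ∧ (cov P).co true z = (freeMap P m v)⁻¹) := by
    intro w v hwv z h1 h2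
    have aux : ∀ {w v : FreeGroup ↥(P.erase m)}, w ≠ v → z ∈ slab P true (freeMap P m w)⁻¹ (WP P true) →
        z ∈ slab P false (freeMap P m v)⁻¹ (WP P false) →
        (∃ t : ↥(P.erase m), w = FreeGroup.of t * v ∧ ((cov P).pr z : E3) ∈ sector P (t : ℝ) ∧ (cov P).co true z = (freeMap P m w)⁻¹) := by
      intro w v hwv h1 h2
      obtain ⟨t, ht, htz⟩ := sheet_adj hm hP (hn w v hwv) h1 h2
      refine ⟨t, hinj ?_, htz, h1.2⟩
      rw [map_mul, ← inv_inv (freeMap P m v), ht]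
      group
    rcases h1 with h1 | h1 <;> rcases h2 with h2 | h2
    · exact (hn w v hwv (h1.2.symm.trans h2.2)).elim
    · exact Or.inl (aux hwv h1 h2)
    · exact Or.inr (aux hwv.symm h2 h1)
    · exact (hn w v hwv (h1.2.symm.trans h2.2)).elim
  have hep : ∀ (w : FreeGroup ↥(P.erase m)) (t : ↥(P.erase m)),
      EP (sheet P (freeMap P m w)⁻¹ ∩ sheet P (freeMap P m (FreeGroup.of t * w))⁻¹) := by
    intro w t
    have hne : w ≠ FreeGroup.of t * w := fun h => FreeGroup.of_ne_one t (mul_eq_right.1 h.symm)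
    have h : sheet P (freeMap P m w)⁻¹ ∩ sheet P (freeMap P m (FreeGroup.of t * w))⁻¹ =
        slab P true (freeMap P m (FreeGroup.of t * w))⁻¹ (sector P t) := by
      ext z
      constructor
      · rintro ⟨h1, h2⟩
        rcases hslab hne h1 h2 with ⟨s, hs, -⟩ | ⟨s, hs, h3⟩
        · exfalso
          rw [← mul_assoc, eq_comm, mul_eq_right] at hs
          have := congrArg (FreeGroup.lift fun _ => Multiplicative.ofAdd (1 : ℤ)) hs
          simp only [map_mul, FreeGroup.lift_apply_of, map_one, ← ofAdd_add] at this
          exact absurd (Multiplicative.ofAdd.injective this) (by decide)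
        · rw [mul_left_inj, FreeGroup.of_injective.eq_iff] at hs
          exact ⟨hs ▸ h3.1, h3.2⟩
      · rintro ⟨h1, h2⟩
        have hg := sector_subset_good h1
        refine ⟨Or.inr ⟨Or.inr hg, ?_⟩, Or.inl ⟨Or.inr hg, h2⟩⟩
        rw [co_false, h2, trans_sector h1, ← freeMap_of, map_mul]
        group
    rw [h]
    exact ep_slab (ep_sector _) (sector_subset_good.trans fun x hx => Or.inr hx)
  refine EP.tree (fun w => sheet P (freeMap P m w)⁻¹) (fun w => ?_) (fun w => ep_sheet hm hP _) ?_ ?_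
  · exact (isOpen_slab (isOpen_WP P true) subset_rfl).union (isOpen_slab (isOpen_WP P false) subset_rfl)
  · rintro w v hwv ⟨z, h1, h2⟩
    rcases hslab hwv h1 h2 with ⟨t, rfl, -⟩ | ⟨t, rfl, -⟩
    · refine ⟨(t, false), ?_⟩
      have : FreeGroup.mk [(t, false)] = (FreeGroup.of t)⁻¹ := rfl
      rw [this, inv_mul_cancel_left]
    · exact ⟨(t, true), rfl⟩
  · rintro w ⟨t, b⟩
    cases b
    · have h := hep (FreeGroup.mk [(t, false)] * w) t
      have h2 : FreeGroup.of t * (FreeGroup.mk [(t, false)] * w) = w := by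
        have : FreeGroup.mk [(t, false)] = (FreeGroup.of t)⁻¹ := rfl
        rw [this, mul_inv_cancel_left]
      rw [h2] at h
      rwa [Set.inter_comm]
    · exact hep w t

end
end Wu

namespace Wu

open Topology

noncomputable section

/-- The points of the covering over the base point. -/
def pt (P : Finset ℝ) (a : Phi P) : (cov P).T := (cov P).sec true a ⟨bE, bE_mem P⟩

theorem bE_mem_chart (P : Finset ℝ) : (⟨bE, bE_mem P⟩ : XP P) ∈ (cov P).U true :=
  Or.inl (by simp [bE])

theorem pr_pt (P : Finset ℝ) (a : Phi P) : ((cov P).pr (pt P a) : E3) = bE := rfl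

theorem pt_co {P : Finset ℝ} {z : (cov P).T} (hz : ((cov P).pr z : E3) = bE) :
    z = pt P ((cov P).co true z) := by
  have h : (cov P).pr z = ⟨bE, bE_mem P⟩ := Subtype.ext hz
  rw [pt, ← h, Glue.sec_co]

theorem co_pt (P : Finset ℝ) (a : Phi P) : (cov P).co true (pt P a) = a := (cov P).co_sec _ _ _

theorem pt_injective (P : Finset ℝ) : Function.Injective (pt P) := fun a b h => by
  have := congrArg ((cov P).co true) h
  rwa [co_pt, co_pt] at this

/-- The loop `ω` avoids the rays labelled by `P` and represents the word `g`. -/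
def HasWord (P : Finset ℝ) (ω : unitInterval → E3) (g : F) : Prop :=
  ∃ Γ : unitInterval → (cov P).T, Continuous Γ ∧ (∀ t, ((cov P).pr (Γ t) : E3) = ω t) ∧
    Γ 0 = pt P 1 ∧ Γ 1 = pt P (cl P g)

variable {P Q : Finset ℝ} {ω ω' : unitInterval → E3} {g g' : F}

theorem HasWord.congr (h : HasWord P ω g) (hg : cl P g = cl P g') : HasWord P ω g' := by
  rwa [HasWord, ← hg]

theorem HasWord.continuous (h : HasWord P ω g) : Continuous ω := by
  obtain ⟨Γ, h1, h2, -⟩ := h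
  rw [← funext h2]
  exact continuous_prE.comp h1

theorem HasWord.mem (h : HasWord P ω g) (t) : ω t ∈ XP P := by
  obtain ⟨Γ, h1, h2, -⟩ := h
  rw [← h2]
  exact Subtype.coe_prop _

theorem HasWord.zero (h : HasWord P ω g) : ω 0 = bE := by
  obtain ⟨Γ, h1, h2, h3, h4⟩ := h
  rw [← h2, h3, pr_pt]

theorem HasWord.one (h : HasWord P ω g) : ω 1 = bE := by
  obtain ⟨Γ, h1, h2, h3, h4⟩ := h
  rw [← h2, h4, pr_pt]

theorem HasWord.mono (h : HasWord P ω g) (hQ : Q ⊆ P) : HasWord Q ω g := by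
  obtain ⟨Γ, h1, h2, h3, h4⟩ := h
  obtain ⟨Φ, hΦ, hΦ2⟩ := Glue.exists_map (cov P) (cov Q) (fun x => ⟨x.1, XP_anti hQ x.2⟩) (by fun_prop)
    (clMap hQ) (fun i x hx => WP_anti hQ i hx) (by
      intro a x
      rw [map_mul]
      congr 1
      show cl Q (trans P x) = cl Q (trans Q x)
      rw [trans, trans]
      split_ifs with ha
      · rfl
      · refine map_pw_sub (cl Q) _ _ (Finset.filter_subset_filter _ hQ) fun q hq hq' => ?_
        rw [Finset.mem_filter] at hq hq'
        exact mk_of_eq_one fun h => hq' ⟨h, hq.2⟩)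
  have h5 : ∀ a, Φ (pt P a) = pt Q (clMap hQ a) := by
    intro a
    have h6 : ((cov Q).pr (Φ (pt P a)) : E3) = bE := congrArg Subtype.val (hΦ2 _).1
    rw [pt_co h6, (hΦ2 _).2, co_pt]
  refine ⟨Φ ∘ Γ, hΦ.comp h1, fun t => ?_, ?_, ?_⟩
  · rw [← h2, Function.comp_apply, (hΦ2 _).1]
  · rw [Function.comp_apply, h3, h5, map_one]
  · rw [Function.comp_apply, h4, h5, clMap_cl]

theorem exists_lift {A : Type} [TopologicalSpace A] (f : A × unitInterval → E3) (hf : Continuous f)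
    (hP : ∀ x, f x ∈ XP P) (h0 : ∀ a, f (a, 0) = bE) :
    ∃ Λ : A × unitInterval → (cov P).T, Continuous Λ ∧ (∀ x, ((cov P).pr (Λ x) : E3) = f x) ∧
      ∀ a, Λ (a, 0) = pt P 1 := by
  let H : C(unitInterval × A, XP P) := ⟨fun x => ⟨f (x.2, x.1), hP _⟩, by fun_prop⟩
  let L := (cov P).isCoveringMap_pr.liftHomotopy H (.const A (pt P 1)) (fun a => Subtype.ext (h0 a))
  have h1 : ∀ x, (cov P).pr (L x) = H x := fun x => congrFun
    ((cov P).isCoveringMap_pr.liftHomotopy_lifts H (.const A (pt P 1)) (fun a => Subtype.ext (h0 a))) x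
  have h2 : ∀ a, L (0, a) = pt P 1 := fun a =>
    (cov P).isCoveringMap_pr.liftHomotopy_zero H (.const A (pt P 1)) (fun a => Subtype.ext (h0 a)) a
  exact ⟨fun x => L (x.2, x.1), by fun_prop, fun x => congrArg Subtype.val (h1 _), h2⟩

theorem lift_unique {Γ Γ' : unitInterval → (cov P).T} (h : Continuous Γ) (h' : Continuous Γ')
    (hp : ∀ t, ((cov P).pr (Γ t) : E3) = (cov P).pr (Γ' t)) (h0 : Γ 0 = Γ' 0) : Γ = Γ' :=
  (cov P).isCoveringMap_pr.eq_of_comp_eq h h' (funext fun t => Subtype.ext (hp t)) 0 h0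

theorem HasWord.exists (hω : Continuous ω) (hP : ∀ t, ω t ∈ XP P) (h0 : ω 0 = bE) (h1 : ω 1 = bE) :
    ∃ g, HasWord P ω g := by
  obtain ⟨Λ, h2, h3, h4⟩ := exists_lift (A := Unit) (fun x => ω x.2) (by fun_prop) (fun x => hP _) fun _ => h0
  obtain ⟨g, hg⟩ := cl_surjective P ((cov P).co true (Λ ((), 1)))
  refine ⟨g, fun t => Λ ((), t), by fun_prop, fun t => h3 _, h4 _, ?_⟩
  rw [hg]
  exact pt_co ((h3 _).trans h1)

theorem HasWord.unique (h : HasWord P ω g) (h' : HasWord P ω g') : cl P g = cl P g' := by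
  obtain ⟨Γ, h1, h2, h3, h4⟩ := h
  obtain ⟨Γ', h1', h2', h3', h4'⟩ := h'
  have := lift_unique h1 h1' (fun t => (h2 t).trans (h2' t).symm) (h3.trans h3'.symm)
  apply pt_injective P
  rw [← h4, ← h4', this]

theorem HasWord.inv_mul_mem (h : HasWord P ω g) (h' : HasWord P ω g') : g⁻¹ * g' ∈ NN P :=
  cl_eq.1 (h.unique h')

theorem HasWord.const : HasWord P (fun _ => bE) 1 :=
  ⟨fun _ => pt P 1, continuous_const, fun _ => rfl, rfl, by rw [map_one]⟩

theorem HasWord.concat (h : HasWord P ω g) (h' : HasWord P ω' g') :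
    HasWord P (fun t => if (t : ℝ) ≤ 1 / 2 then ω (Set.projIcc 0 1 zero_le_one (2 * (t : ℝ)))
      else ω' (Set.projIcc 0 1 zero_le_one (2 * (t : ℝ) - 1))) (g * g') := by
  obtain ⟨Γ, h1, h2, h3, h4⟩ := h
  obtain ⟨Γ', h1', h2', h3', h4'⟩ := h'
  obtain ⟨Φ, hΦ, hΦ2⟩ := Glue.exists_map (cov P) (cov P) id continuous_id
    (fun a => cl P g * a) (fun _ _ => id) (fun a x => (mul_assoc _ _ _).symm)
  have h5 : ∀ a, Φ (pt P a) = pt P (cl P g * a) := by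
    intro a
    have h6 : ((cov P).pr (Φ (pt P a)) : E3) = bE := congrArg Subtype.val (hΦ2 _).1
    rw [pt_co h6, (hΦ2 _).2, co_pt]
  have e1 : ∀ t : ℝ, t = 1 / 2 → Set.projIcc (0 : ℝ) 1 zero_le_one (2 * t) = 1 := by
    rintro t rfl
    exact Set.projIcc_of_right_le _ (by norm_num)
  have e0 : ∀ t : ℝ, t = 1 / 2 → Set.projIcc (0 : ℝ) 1 zero_le_one (2 * t - 1) = 0 := by
    rintro t rfl
    exact Set.projIcc_of_le_left _ (by norm_num)
  refine ⟨fun t => if (t : ℝ) ≤ 1 / 2 then Γ (Set.projIcc 0 1 zero_le_one (2 * (t : ℝ)))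
      else Φ (Γ' (Set.projIcc 0 1 zero_le_one (2 * (t : ℝ) - 1))), ?_, fun t => ?_, ?_, ?_⟩
  · refine Continuous.if_le ?_ ?_ (by fun_prop) continuous_const fun t ht => ?_
    · exact h1.comp (continuous_projIcc.comp (by fun_prop))
    · exact hΦ.comp (h1'.comp (continuous_projIcc.comp (by fun_prop)))
    · rw [e1 _ ht, e0 _ ht, h3', h4, h5, mul_one]
  · dsimp only
    split_ifs
    · exact h2 _
    · rw [(hΦ2 _).1]; exact h2' _
  · have : Set.projIcc (0 : ℝ) 1 zero_le_one (2 * ((0 : unitInterval) : ℝ)) = 0 :=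
      Set.projIcc_of_le_left _ (by simp)
    dsimp only
    rw [if_pos (by simp), this, h3]
  · have : Set.projIcc (0 : ℝ) 1 zero_le_one (2 * ((1 : unitInterval) : ℝ) - 1) = 1 :=
      Set.projIcc_of_right_le _ (by norm_num)
    dsimp only
    rw [if_neg (by norm_num), this, h4', h5, map_mul]

theorem HasWord.of_isPreconnected {Y : Type} [TopologicalSpace Y] {S : Set Y} (hS : IsPreconnected S)
    {f : Y × unitInterval → E3} (hf : ContinuousOn f (S ×ˢ Set.univ))
    (hP : ∀ y ∈ S, ∀ t, f (y, t) ∈ XP P) (h0 : ∀ y ∈ S, f (y, 0) = bE) (h1 : ∀ y ∈ S, f (y, 1) = bE)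
    {y y' : Y} (hy : y ∈ S) (hy' : y' ∈ S) (h : HasWord P (fun t => f (y, t)) g) :
    HasWord P (fun t => f (y', t)) g := by
  have hc : Continuous fun x : S × unitInterval => f (x.1, x.2) :=
    hf.comp_continuous (by fun_prop) fun x => ⟨x.1.2, trivial⟩
  obtain ⟨Λ, h2, h3, h4⟩ := exists_lift (P := P) _ hc (fun x => hP _ x.1.2 _) fun y => h0 _ y.2
  have h5 : ∀ y : S, ((cov P).pr (Λ (y, 1)) : E3) = bE := fun y => (h3 _).trans (h1 _ y.2)
  have h6 : ∀ y : S, ∀ g, cl P g = (cov P).co true (Λ (y, 1)) → HasWord P (fun t => f (y, t)) g := by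
    intro y g hg
    exact ⟨fun t => Λ (y, t), by fun_prop, fun t => h3 _, h4 _, by rw [hg]; exact pt_co (h5 y)⟩
  have h7 : IsLocallyConstant fun y : S => (cov P).co true (Λ (y, 1)) := by
    rw [IsLocallyConstant.iff_eventually_eq]
    intro y
    have hcy : ContinuousAt (fun y : S => Λ (y, 1)) y := by fun_prop
    refine hcy.eventually ((cov P).co_eventually ?_)
    have h8 : (cov P).pr (Λ (y, 1)) = ⟨bE, bE_mem P⟩ := Subtype.ext (h5 y)
    rw [h8]
    exact bE_mem_chart P
  have : PreconnectedSpace S := isPreconnected_iff_preconnectedSpace.1 hS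
  obtain ⟨g₁, hg₁⟩ := cl_surjective P ((cov P).co true (Λ (⟨y, hy⟩, 1)))
  have h9 := h.unique (h6 ⟨y, hy⟩ g₁ hg₁)
  refine h6 ⟨y', hy'⟩ g ?_
  rw [h9, hg₁]
  exact h7.apply_eq_of_isPreconnected isPreconnected_univ trivial trivial

theorem HasWord.extend (hne : P.Nonempty) {Y : Type} [TopologicalSpace Y] [CompactSpace Y] [T2Space Y]
    {B : Set Y} (hB : IsClosed B) {f : Y × unitInterval → E3} (hf : ContinuousOn f (B ×ˢ Set.univ))
    (h : ∀ y ∈ B, HasWord P (fun t => f (y, t)) g) :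
    ∃ k : Y × unitInterval → E3, Continuous k ∧ Set.EqOn k f (B ×ˢ Set.univ) ∧
      ∀ y, HasWord P (fun t => k (y, t)) g := by
  classical
  have hc : Continuous fun x : B × unitInterval => f (x.1, x.2) :=
    hf.comp_continuous (by fun_prop) fun x => ⟨x.1.2, trivial⟩
  obtain ⟨Λ, h2, h3, h4⟩ := exists_lift (P := P) _ hc (fun x => (h _ x.1.2).mem _) fun y => (h _ y.2).zero
  have h5 : ∀ y : B, Λ (y, 1) = pt P (cl P g) := by
    intro y
    obtain ⟨Γ, k1, k2, k3, k4⟩ := h _ y.2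
    have := lift_unique (Γ := fun t => Λ (y, t)) (by fun_prop) k1 (fun t => (h3 _).trans (k2 t).symm)
      ((h4 y).trans k3.symm)
    rw [← k4, ← this]
  let Λ' : Y × unitInterval → (cov P).T := fun x => if h : x.1 ∈ B then Λ (⟨x.1, h⟩, x.2) else pt P 1
  have hΛ' : ∀ (y : B) t, Λ' (y, t) = Λ (y, t) := fun y t => by simp [Λ']
  let C₀ : Set (Y × unitInterval) := {x | x.2 = 0}
  let C₁ : Set (Y × unitInterval) := {x | x.2 = 1}
  have hC₀ : IsClosed C₀ := isClosed_eq continuous_snd continuous_const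
  have hC₁ : IsClosed C₁ := isClosed_eq continuous_snd continuous_const
  have hCB : IsClosed (B ×ˢ (Set.univ : Set unitInterval)) := hB.prod isClosed_univ
  let m : Y × unitInterval → (cov P).T := fun x =>
    if x.2 = 0 then pt P 1 else if x.2 = 1 then pt P (cl P g) else Λ' x
  have hm0 : ∀ y, m (y, 0) = pt P 1 := fun y => by simp [m]
  have hm1 : ∀ y, m (y, 1) = pt P (cl P g) := fun y => by simp [m]
  have hmB : ∀ (y : B) t, m (y, t) = Λ (y, t) := by
    intro y t
    simp only [m]
    split_ifs with e0 e1
    · rw [e0, h4]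
    · rw [e1, h5]
    · exact hΛ' y t
  have hm : ContinuousOn m ((B ×ˢ Set.univ ∪ C₀) ∪ C₁) := by
    refine (ContinuousOn.union_of_isClosed ?_ ?_ hCB hC₀).union_of_isClosed ?_ (hCB.union hC₀) hC₁
    · rw [continuousOn_iff_continuous_domRestrict]
      have e : (B ×ˢ Set.univ).domRestrict m = fun x : ↥(B ×ˢ (Set.univ : Set unitInterval)) =>
          Λ (⟨x.1.1, x.2.1⟩, x.1.2) := by
        ext1 x; exact hmB ⟨x.1.1, x.2.1⟩ x.1.2
      rw [e]
      fun_prop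
    · refine (continuous_const (y := pt P 1)).continuousOn.congr ?_
      rintro ⟨y, t⟩ rfl
      exact hm0 y
    · refine (continuous_const (y := pt P (cl P g))).continuousOn.congr ?_
      rintro ⟨y, t⟩ rfl
      exact hm1 y
  obtain ⟨k, hk, -, hkm⟩ := ep_cov hne (Y × unitInterval) _ m ((hCB.union hC₀).union hC₁) hm fun _ _ => trivial
  refine ⟨fun x => (cov P).pr (k x), continuous_prE.comp hk, ?_, fun y => ⟨fun t => k (y, t), by fun_prop, fun t => rfl, ?_, ?_⟩⟩
  · rintro ⟨y, t⟩ ⟨hy, -⟩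
    dsimp only at hy ⊢
    rw [hkm (Or.inl (Or.inl ⟨hy, trivial⟩)), hmB ⟨y, hy⟩]
    exact h3 _
  · exact (hkm (Or.inl (Or.inr rfl))).trans (hm0 y)
  · exact (hkm (Or.inr rfl)).trans (hm1 y)

end
end Wu

namespace Wu

open Topology

theorem realize {V Y : Type} [Fintype V] [DecidableEq V] [TopologicalSpace Y] [CompactSpace Y] [T2Space Y]
    (ℓ : V → ℝ) (C : V → Set Y) (hC : ∀ v, IsClosed (C v)) {B : Set Y} (hB : IsClosed B)
    {f : Y × unitInterval → E3} (hf : ContinuousOn f (B ×ˢ Set.univ)) (u : F)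
    (h : ∀ y ∈ B, ∀ σ : Finset V, σ.Nonempty → (∀ v ∈ σ, y ∈ C v) →
      HasWord (σ.image ℓ) (fun t => f (y, t)) u) :
    ∃ k : Y × unitInterval → E3, ContinuousOn k ((B ∪ ⋃ v, C v) ×ˢ Set.univ) ∧
      Set.EqOn k f (B ×ˢ Set.univ) ∧
      ∀ y, ∀ σ : Finset V, σ.Nonempty → (∀ v ∈ σ, y ∈ C v) →
        HasWord (σ.image ℓ) (fun t => k (y, t)) u := by
  classical
  have key : ∀ S : Finset (Finset V), (∀ σ ∈ S, σ.Nonempty) → (∀ σ ∈ S, ∀ τ, σ ⊆ τ → τ ∈ S) →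
      ∃ k : Y × unitInterval → E3, ContinuousOn k ((B ∪ ⋃ σ ∈ S, {y | ∀ v ∈ σ, y ∈ C v}) ×ˢ Set.univ) ∧
      Set.EqOn k f (B ×ˢ Set.univ) ∧
      ∀ y ∈ (B ∪ ⋃ σ ∈ S, {y | ∀ v ∈ σ, y ∈ C v}), ∀ σ : Finset V, σ.Nonempty → (∀ v ∈ σ, y ∈ C v) →
        HasWord (σ.image ℓ) (fun t => k (y, t)) u := by
    intro S
    induction S using Finset.strongInduction with
    | H S ih =>
    intro hS hup
    rcases S.eq_empty_or_nonempty with rfl | hne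
    · refine ⟨f, by simpa using hf, fun _ _ => rfl, fun y hy => h y ?_⟩
      simpa using hy
    obtain ⟨σ, hσ, hmin⟩ := S.exists_min_image Finset.card hne
    have hup' : ∀ τ ∈ S, σ ⊆ τ → τ ≠ σ → τ ∈ S.erase σ := fun τ hτ _ h => Finset.mem_erase.2 ⟨h, hτ⟩
    obtain ⟨k, hk, hkf, hkw⟩ := ih (S.erase σ) (Finset.erase_ssubset hσ)
      (fun τ hτ => hS τ (Finset.mem_of_mem_erase hτ)) (fun τ hτ ρ hρ => by
        have hτ' := Finset.mem_erase.1 hτ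
        refine Finset.mem_erase.2 ⟨?_, hup τ hτ'.2 ρ hρ⟩
        rintro rfl
        exact hτ'.1 (Finset.eq_of_subset_of_card_le hρ (hmin τ hτ'.2)))
    set B' := B ∪ ⋃ τ ∈ S.erase σ, {y | ∀ v ∈ τ, y ∈ C v} with hB'
    have hcl : ∀ τ : Finset V, IsClosed {y | ∀ v ∈ τ, y ∈ C v} := fun τ => by
      have : {y | ∀ v ∈ τ, y ∈ C v} = ⋂ v ∈ τ, C v := by ext; simp
      rw [this]
      exact isClosed_biInter fun v _ => hC v
    have hB'c : IsClosed B' := hB.union (Set.Finite.isClosed_biUnion (Finset.finite_toSet _) fun τ _ => hcl τ)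
    obtain ⟨k', hk', hk'f, hk'w⟩ := HasWord.extend (P := σ.image ℓ) ((hS σ hσ).image ℓ) (hB'c.inter (hcl σ))
      (f := k) (hk.mono (Set.prod_mono Set.inter_subset_left subset_rfl))
      (fun y hy => hkw y hy.1 σ (hS σ hσ) hy.2)
    have hun : B ∪ ⋃ τ ∈ S, {y | ∀ v ∈ τ, y ∈ C v} = B' ∪ {y | ∀ v ∈ σ, y ∈ C v} := by
      conv_lhs => rw [← Finset.insert_erase hσ]
      rw [Finset.set_biUnion_insert, hB', Set.union_assoc, Set.union_comm (⋃ _, _)]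
    let K : Y × unitInterval → E3 := fun x => if x.1 ∈ B' then k x else k' x
    have hK1 : ∀ y ∈ B', ∀ t, K (y, t) = k (y, t) := fun y hy t => if_pos hy
    have hK2 : ∀ y, (∀ v ∈ σ, y ∈ C v) → ∀ t, K (y, t) = k' (y, t) := by
      intro y hy t
      by_cases h : y ∈ B'
      · exact (hK1 y h t).trans (hk'f (x := (y, t)) ⟨⟨h, hy⟩, trivial⟩).symm
      · exact if_neg h
    refine ⟨K, ?_, ?_, ?_⟩
    · rw [hun, Set.union_prod]
      refine ContinuousOn.union_of_isClosed ?_ ?_ (hB'c.prod isClosed_univ) ((hcl σ).prod isClosed_univ)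
      · exact hk.congr fun x hx => hK1 x.1 hx.1 x.2
      · exact hk'.continuousOn.congr fun x hx => hK2 x.1 hx.1 x.2
    · intro x hx
      exact (hK1 x.1 (Or.inl hx.1) x.2).trans (hkf hx)
    · intro y hy τ hτ hyτ
      by_cases h : y ∈ B'
      · have e : (fun t => K (y, t)) = fun t => k (y, t) := funext (hK1 y h)
        rw [e]
        exact hkw y h τ hτ hyτ
      · rw [hun] at hy
        have hyσ := hy.resolve_left h
        have e : (fun t => K (y, t)) = fun t => k' (y, t) := funext (hK2 y hyσ)
        rw [e]
        refine (hk'w y).mono (Finset.image_subset_image ?_)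
        by_contra hsub
        refine h (Or.inr (Set.mem_biUnion (x := σ ∪ τ) (hup' _ (hup σ hσ _ Finset.subset_union_left)
          Finset.subset_union_left fun e => hsub (Finset.union_eq_left.1 e)) ?_))
        intro v hv
        exact (Finset.mem_union.1 hv).elim (hyσ v) (hyτ v)
  obtain ⟨k, hk, hkf, hkw⟩ := key (Finset.univ.filter fun σ => σ.Nonempty) (by simp) (by
    simp only [Finset.mem_filter, Finset.mem_univ, true_and]
    exact fun σ hσ τ hτ => hσ.mono hτ)
  refine ⟨k, hk.mono (Set.prod_mono (Set.union_subset_union_right _ ?_) subset_rfl), hkf, fun y σ hσ hy => ?_⟩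
  · intro y hy
    obtain ⟨v, hv⟩ := Set.mem_iUnion.1 hy
    exact Set.mem_biUnion (x := {v}) (by simp) (by simpa using hv)
  · exact hkw y (Or.inr (Set.mem_biUnion (x := σ) (by simpa using hσ) hy)) σ hσ hy

end Wu

namespace Wu

open Topology

/-- A family of based loops in the complement of the origin. -/
structure Fam {X : Type} [TopologicalSpace X] (f : X × I → E3) : Prop where
  continuous : Continuous f
  ne_zero : ∀ z, f z ≠ 0
  source : ∀ x, f (x, 0) = bE
  target : ∀ x, f (x, 1) = bE

theorem mem_XP_image {ι : Type} [DecidableEq ι] {p : ι → ℝ} {σ : Finset ι} {z : E3} :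
    z ∈ XP (σ.image p) ↔ ∀ i ∈ σ, z ∈ XP {p i} := by
  simp only [XP, good, Set.mem_ofPred_eq, Finset.mem_singleton, Finset.forall_mem_image, forall_eq]
  constructor
  · rintro (h | h) i hi
    · exact Or.inl h
    · exact Or.inr (h hi)
  · intro h
    by_cases h0 : z.1 = 0
    · exact Or.inr fun i hi => (h i hi).resolve_left (not_not.2 h0)
    · exact Or.inl h0

theorem mem_XP_singleton {q : ℝ} {z : E3} : z ∈ XP {q} ↔ (0 ≤ z.2.1 → z.2.2 = q * z.2.1 → z.1 ≠ 0) := by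
  simp only [XP, good, Set.mem_ofPred_eq, Finset.mem_singleton, forall_eq]
  tauto

theorem ne_zero_of_mem_XP {P : Finset ℝ} (hP : P.Nonempty) {z : E3} (hz : z ∈ XP P) : z ≠ 0 := by
  rintro rfl
  obtain ⟨p, hp⟩ := hP
  rcases hz with h | h
  · exact h rfl
  · exact h p hp ⟨le_rfl, by simp⟩

/-- A homotopy of families of loops that keeps avoiding prescribed rays over prescribed sets. -/
def Htpy {X ι : Type} [TopologicalSpace X] (A : ι → Set X) (p : ι → ℝ) (f g : X × I → E3) : Prop :=
  ∃ H : (I × X) × I → E3, Fam H ∧ (∀ x t, H ((0, x), t) = f (x, t)) ∧ (∀ x t, H ((1, x), t) = g (x, t)) ∧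
    ∀ i, ∀ x ∈ A i, ∀ s t, H ((s, x), t) ∈ XP {p i}

section
variable {X ι : Type} [TopologicalSpace X] {A : ι → Set X} {p : ι → ℝ} {f g k : X × I → E3}

theorem Htpy.fam_left (h : Htpy A p f g) : Fam f := by
  obtain ⟨H, hH, h0, h1, hA⟩ := h
  have : f = fun z => H ((0, z.1), z.2) := funext fun z => (h0 _ _).symm
  have hc := hH.continuous
  rw [this]
  exact ⟨by fun_prop, fun z => hH.ne_zero _, fun x => hH.source _, fun x => hH.target _⟩

theorem Htpy.symm (h : Htpy A p f g) : Htpy A p g f := by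
  obtain ⟨H, hH, h0, h1, hA⟩ := h
  have hc := hH.continuous
  refine ⟨fun z => H ((unitInterval.symm z.1.1, z.1.2), z.2),
    ⟨by fun_prop, fun z => hH.ne_zero _, fun x => hH.source _, fun x => hH.target _⟩, ?_, ?_, ?_⟩
  · intro x t; simp [h1]
  · intro x t; simp [h0]
  · intro i x hx s t; exact hA i x hx _ t

theorem Htpy.trans (h : Htpy A p f g) (h' : Htpy A p g k) : Htpy A p f k := by
  obtain ⟨H, hH, h0, h1, hA⟩ := h
  obtain ⟨H', hH', h0', h1', hA'⟩ := h'
  have hc := hH.continuous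
  have hc' := hH'.continuous
  refine ⟨fun z => if (z.1.1 : ℝ) ≤ 1 / 2 then H ((Set.projIcc 0 1 zero_le_one (2 * (z.1.1 : ℝ)), z.1.2), z.2)
    else H' ((Set.projIcc 0 1 zero_le_one (2 * (z.1.1 : ℝ) - 1), z.1.2), z.2), ⟨?_, ?_, ?_, ?_⟩, ?_, ?_, ?_⟩
  · refine Continuous.if_le ?_ ?_ (by fun_prop) continuous_const fun z hz => ?_
    · exact hc.comp (((continuous_projIcc.comp (by fun_prop)).prodMk (by fun_prop)).prodMk (by fun_prop))
    · exact hc'.comp (((continuous_projIcc.comp (by fun_prop)).prodMk (by fun_prop)).prodMk (by fun_prop))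
    · rw [hz, Set.projIcc_of_right_le _ (by norm_num), Set.projIcc_of_le_left _ (by norm_num)]
      exact (h1 _ _).trans (h0' _ _).symm
  · intro z
    split_ifs
    · exact hH.ne_zero _
    · exact hH'.ne_zero _
  · intro z
    dsimp only
    split_ifs
    · exact hH.source _
    · exact hH'.source _
  · intro z
    dsimp only
    split_ifs
    · exact hH.target _
    · exact hH'.target _
  · intro x t
    dsimp only
    rw [if_pos (by simp), Set.projIcc_of_le_left _ (by simp)]
    exact h0 _ _
  · intro x t
    dsimp only
    rw [if_neg (by norm_num), Set.projIcc_of_right_le _ (by norm_num)]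
    exact h1' _ _
  · intro i x hx s t
    dsimp only
    split_ifs
    · exact hA i x hx _ _
    · exact hA' i x hx _ _

end

/-- Functions on a cylinder that are polynomial along the interval. -/
def polyAlg (X : Type) [TopologicalSpace X] : Subalgebra ℝ C(X × I, ℝ) where
  carrier := {g | ∀ x, ∃ p : Polynomial ℝ, ∀ t : I, g (x, t) = p.eval (t : ℝ)}
  mul_mem' {a b} ha hb x := by
    obtain ⟨p, hp⟩ := ha x
    obtain ⟨q, hq⟩ := hb x
    exact ⟨p * q, fun t => by simp [hp, hq]⟩
  add_mem' {a b} ha hb x := by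
    obtain ⟨p, hp⟩ := ha x
    obtain ⟨q, hq⟩ := hb x
    exact ⟨p + q, fun t => by simp [hp, hq]⟩
  algebraMap_mem' r x := ⟨Polynomial.C r, fun t => by simp⟩

theorem polyAlg_near {n : ℕ} (h : (Fin n → I) × I → ℝ) (hc : Continuous h) {ε : ℝ} (hε : 0 < ε) :
    ∃ g : (Fin n → I) × I → ℝ, Continuous g ∧ (∀ z, |g z - h z| < ε) ∧
      ∀ x, ∃ p : Polynomial ℝ, ∀ t : I, g (x, t) = p.eval (t : ℝ) := by
  have hsep : (polyAlg (Fin n → I)).SeparatesPoints := by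
    rintro ⟨x, t⟩ ⟨x', t'⟩ hne
    by_cases ht : t = t'
    · have hx : x ≠ x' := fun h => hne (by rw [h, ht])
      obtain ⟨j, hj⟩ := Function.ne_iff.1 hx
      let c : C((Fin n → I) × I, ℝ) := ⟨fun z => (z.1 j : ℝ), by fun_prop⟩
      have hcm : c ∈ polyAlg (Fin n → I) := fun x => ⟨Polynomial.C (x j : ℝ), fun t => by simp [c]⟩
      exact ⟨c, ⟨c, hcm, rfl⟩, fun h => hj (Subtype.ext h)⟩
    · let c : C((Fin n → I) × I, ℝ) := ⟨fun z => (z.2 : ℝ), by fun_prop⟩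
      have hcm : c ∈ polyAlg (Fin n → I) := fun x => ⟨Polynomial.X, fun t => by simp [c]⟩
      exact ⟨c, ⟨c, hcm, rfl⟩, fun h => ht (Subtype.ext h)⟩
  obtain ⟨g, hg⟩ := ContinuousMap.exists_mem_subalgebra_near_continuous_of_separatesPoints
    (polyAlg (Fin n → I)) hsep h hc ε hε
  exact ⟨fun z => (g : C((Fin n → I) × I, ℝ)) z, (g : C((Fin n → I) × I, ℝ)).continuous, hg, g.2⟩

theorem exists_poly {n : ℕ} (h : (Fin n → I) × I → ℝ) (hc : Continuous h) (h0 : ∀ x, h (x, 0) = 1)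
    (h1 : ∀ x, h (x, 1) = 1) {ε : ℝ} (hε : 0 < ε) :
    ∃ g : (Fin n → I) × I → ℝ, Continuous g ∧ (∀ z, |g z - h z| < ε) ∧ (∀ x, g (x, 0) = 1) ∧
      (∀ x, g (x, 1) = 1) ∧ ∀ x, {t : I | g (x, t) = 0}.Finite := by
  obtain ⟨g, hg, hgh, hgp⟩ := polyAlg_near h hc (show 0 < ε / 4 by linarith)
  have e0 : ∀ x, g (x, 0) + (1 - ((0 : I) : ℝ)) * (1 - g (x, 0)) + ((0 : I) : ℝ) * (1 - g (x, 1)) = 1 := by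
    intro x; simp
  have e1 : ∀ x, g (x, 1) + (1 - ((1 : I) : ℝ)) * (1 - g (x, 0)) + ((1 : I) : ℝ) * (1 - g (x, 1)) = 1 := by
    intro x; simp
  refine ⟨fun z => g z + (1 - (z.2 : ℝ)) * (1 - g (z.1, 0)) + z.2 * (1 - g (z.1, 1)), by fun_prop, ?_, e0, e1, ?_⟩
  · rintro ⟨x, t⟩
    have a1 := abs_lt.1 (hgh (x, t))
    have a2 := abs_lt.1 (hgh (x, 0))
    have a3 := abs_lt.1 (hgh (x, 1))
    rw [h0] at a2
    rw [h1] at a3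
    have t0 := t.2.1
    have t1 := t.2.2
    dsimp only
    rw [abs_lt]
    constructor <;> nlinarith
  · intro x
    obtain ⟨p, hp⟩ := hgp x
    let q : Polynomial ℝ := p + (1 - Polynomial.X) * Polynomial.C (1 - g (x, 0)) +
      Polynomial.X * Polynomial.C (1 - g (x, 1))
    have hq : ∀ t : I, g (x, t) + (1 - (t : ℝ)) * (1 - g (x, 0)) + t * (1 - g (x, 1)) = q.eval (t : ℝ) := by
      intro t; simp [q, hp]
    have hq0 : q ≠ 0 := by
      intro h
      have := (hq 0).symm.trans (e0 x)
      simp [h] at this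
    refine Set.Finite.of_finite_image (f := Subtype.val) ?_ Subtype.val_injective.injOn
    refine (q.roots.toFinset.finite_toSet).subset ?_
    rintro _ ⟨t, ht, rfl⟩
    simp only [Finset.mem_coe, Multiset.mem_toFinset, Polynomial.mem_roots hq0, Polynomial.IsRoot]
    rw [← hq]
    exact ht

theorem exists_htpy_finite {n : ℕ} {ι : Type} [Finite ι] {A : ι → Set (Fin n → I)} (hA : ∀ i, IsClosed (A i))
    {p : ι → ℝ} {f : (Fin n → I) × I → E3} (hf : Fam f) (hfA : ∀ i, ∀ x ∈ A i, ∀ t, f (x, t) ∈ XP {p i}) :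
    ∃ g, Htpy A p f g ∧ Fam g ∧ (∀ i, ∀ x ∈ A i, ∀ t, g (x, t) ∈ XP {p i}) ∧
      ∀ x, {q : ℝ | ∃ t, g (x, t) ∉ XP {q}}.Finite := by
  have hc := hf.continuous
  let K : Set ((Fin n → I) × I) := {z | (f z).2.1 = 0 ∧ (f z).2.2 = 0} ∪
    ⋃ i, {z | z.1 ∈ A i ∧ 0 ≤ (f z).2.1 ∧ (f z).2.2 = p i * (f z).2.1}
  have hK : IsClosed K := by
    refine IsClosed.union ?_ (isClosed_iUnion_of_finite fun i => ?_)
    · exact (isClosed_eq (f := fun z => (f z).2.1) (by fun_prop) continuous_const).inter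
        (isClosed_eq (f := fun z => (f z).2.2) (by fun_prop) continuous_const)
    · exact ((hA i).preimage continuous_fst).inter ((isClosed_le (f := fun _ => (0 : ℝ))
        (g := fun z => (f z).2.1) continuous_const (by fun_prop)).inter
        (isClosed_eq (f := fun z => (f z).2.2) (g := fun z => p i * (f z).2.1) (by fun_prop) (by fun_prop)))
  have hK0 : ∀ z ∈ K, (f z).1 ≠ 0 := by
    rintro z (⟨h1, h2⟩ | hz) h0
    · exact hf.ne_zero z (Prod.ext h0 (Prod.ext h1 h2))
    · obtain ⟨i, h1, h2, h3⟩ := Set.mem_iUnion.1 hz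
      exact mem_XP_singleton.1 (hfA i z.1 h1 z.2) h2 h3 h0
  obtain ⟨ε, hε, hKε⟩ : ∃ ε > 0, ∀ z ∈ K, ε ≤ |(f z).1| := by
    rcases K.eq_empty_or_nonempty with h | h
    · exact ⟨1, one_pos, by simp [h]⟩
    · obtain ⟨z, hz, hmin⟩ := hK.isCompact.exists_isMinOn h (f := fun z => |(f z).1|) (by fun_prop)
      exact ⟨|(f z).1|, abs_pos.2 (hK0 z hz), fun z' hz' => hmin hz'⟩
  obtain ⟨h', hc', hh', h0', h1', hfin⟩ := exists_poly (fun z => (f z).1) (by fun_prop)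
    (fun x => by rw [hf.source]; rfl) (fun x => by rw [hf.target]; rfl) hε
  have hline : ∀ z ∈ K, ∀ s : I, (1 - (s : ℝ)) * (f z).1 + s * h' z ≠ 0 := by
    intro z hz s h
    have h2 : (f z).1 = - (s * (h' z - (f z).1)) := by linear_combination h
    have h3 := hKε z hz
    rw [h2, abs_neg, abs_mul, abs_of_nonneg s.2.1] at h3
    nlinarith [hh' z, s.2.2, abs_nonneg (h' z - (f z).1), s.2.1]
  have hG : Fam fun z : (I × (Fin n → I)) × I => (((1 - (z.1.1 : ℝ)) * (f (z.1.2, z.2)).1 + z.1.1 * h' (z.1.2, z.2),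
      (f (z.1.2, z.2)).2) : E3) := by
    refine ⟨by fun_prop, fun z h => ?_, fun z => ?_, fun z => ?_⟩
    · have e1 := congrArg Prod.fst h
      have e2 := congrArg Prod.snd h
      exact hline (z.1.2, z.2) (Or.inl ⟨congrArg Prod.fst e2, congrArg Prod.snd e2⟩) z.1.1 e1
    · simp [hf.source, h0', bE]
    · simp [hf.target, h1', bE]
  have hGA : ∀ i, ∀ x ∈ A i, ∀ (s : I) t, (((1 - (s : ℝ)) * (f (x, t)).1 + s * h' (x, t), (f (x, t)).2) : E3) ∈ XP {p i} := by
    intro i x hx s t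
    rw [mem_XP_singleton]
    intro h1 h2
    exact hline (x, t) (Or.inr (Set.mem_iUnion.2 ⟨i, hx, h1, h2⟩)) s
  have e1 : ∀ z, (((1 - ((1 : I) : ℝ)) * (f z).1 + ((1 : I) : ℝ) * h' z, (f z).2) : E3) = (h' z, (f z).2) := by
    intro z; simp
  have hT : Htpy A p f fun z => (h' z, (f z).2) :=
    ⟨_, hG, fun x t => by simp, fun x t => e1 (x, t), hGA⟩
  refine ⟨_, hT, hT.symm.fam_left, fun i x hx t => ?_, fun x => ?_⟩
  · have := hGA i x hx 1 t
    rwa [e1] at this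
  · refine ((hfin x).image fun t => (f (x, t)).2.2 / (f (x, t)).2.1).subset ?_
    rintro q ⟨t, ht⟩
    simp only [mem_XP_singleton, not_forall, not_not] at ht
    obtain ⟨h1, h2, h3⟩ := ht
    refine ⟨t, h3, ?_⟩
    have h4 : (f (x, t)).2.1 ≠ 0 := fun h => hT.symm.fam_left.ne_zero (x, t)
      (Prod.ext h3 (Prod.ext h (by simpa [h] using h2)))
    dsimp only at h2 ⊢
    rw [h2, mul_div_cancel_right₀ _ h4]

end Wu

namespace Wu

open Topology

theorem isOpen_forall {A Y : Type} [TopologicalSpace A] [TopologicalSpace Y] [CompactSpace Y] {K : Set Y}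
    (hK : IsClosed K) {U : Set (A × Y)} (hU : IsOpen U) : IsOpen {a | ∀ y ∈ K, (a, y) ∈ U} := by
  have h : {a | ∀ y ∈ K, (a, y) ∈ U} = (Prod.fst '' (Uᶜ ∩ Prod.snd ⁻¹' K))ᶜ := by
    ext a
    simp only [Set.mem_ofPred_eq, Set.mem_compl_iff, Set.mem_image, Set.mem_inter_iff, Set.mem_preimage,
      Prod.exists, exists_and_right, exists_eq_right, not_exists, not_and]
    exact forall_congr' fun y => ⟨fun h h1 h2 => h1 (h h2), fun h h1 => by_contra fun h2 => h h2 h1⟩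
  rw [h, isOpen_compl_iff]
  exact isClosedMap_fst_of_compactSpace _ (hU.isClosed_compl.inter (hK.preimage continuous_snd))

theorem isOpen_mem_XP : IsOpen {z : ℝ × E3 | z.2 ∈ XP {z.1}} := by
  have h : {z : ℝ × E3 | z.2 ∈ XP {z.1}} = {z | 0 ≤ z.2.2.1 ∧ z.2.2.2 = z.1 * z.2.2.1 ∧ z.2.1 = 0}ᶜ := by
    ext z
    simp only [Set.mem_ofPred_eq, mem_XP_singleton, Set.mem_compl_iff]
    tauto
  rw [h, isOpen_compl_iff]
  exact (isClosed_le (f := fun _ => (0 : ℝ)) (g := fun z : ℝ × E3 => z.2.2.1) continuous_const (by fun_prop)).inter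
    ((isClosed_eq (f := fun z : ℝ × E3 => z.2.2.2) (g := fun z => z.1 * z.2.2.1) (by fun_prop) (by fun_prop)).inter
    (isClosed_eq (f := fun z : ℝ × E3 => z.2.1) (g := fun _ => 0) (by fun_prop) continuous_const))

theorem exists_injective_choice {C : Type} [Fintype C] (Q : C → Set ℝ) (hQ : ∀ c, (Q c).Infinite) :
    ∃ ℓ : C → ℝ, Function.Injective ℓ ∧ ∀ c, ℓ c ∈ Q c := by
  classical
  have key : ∀ s : Finset C, ∃ ℓ : C → ℝ, Set.InjOn ℓ s ∧ ∀ c ∈ s, ℓ c ∈ Q c := by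
    intro s
    induction s using Finset.induction_on with
    | empty => exact ⟨fun _ => 0, by simp, by simp⟩
    | insert a s ha ih =>
      obtain ⟨ℓ, h1, h2⟩ := ih
      obtain ⟨q, hq, hq'⟩ := (hQ a).exists_notMem_finset (s.image ℓ)
      have hne : ∀ c ∈ s, c ≠ a := fun c hc h => ha (h ▸ hc)
      refine ⟨Function.update ℓ a q, ?_, ?_⟩
      · rw [Finset.coe_insert, Set.injOn_insert (by simpa using ha)]
        refine ⟨fun x hx y hy h => ?_, ?_⟩
        · rw [Function.update_of_ne (hne x hx), Function.update_of_ne (hne y hy)] at h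
          exact h1 hx hy h
        · rintro ⟨x, hx, h⟩
          rw [Function.update_of_ne (hne x hx), Function.update_self] at h
          exact hq' (Finset.mem_image.2 ⟨x, hx, h⟩)
      · intro c hc
        by_cases h : c = a
        · subst h
          simpa using hq
        · rw [Function.update_of_ne h]
          exact h2 c (Finset.mem_of_mem_insert_of_ne hc h)
  obtain ⟨ℓ, h1, h2⟩ := key Finset.univ
  exact ⟨ℓ, by simpa using h1, fun c => h2 c (Finset.mem_univ c)⟩

theorem dist_le_of_mem_box {M n : ℕ} {c : Fin n → Fin (M + 1)} {x y : Fin n → I}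
    (hx : x ∈ cell M (Sum.inl c)) (hy : y ∈ cell M (Sum.inl c)) : dist x y ≤ 1 / ((M : ℝ) + 1) := by
  have hM : (0 : ℝ) < M + 1 := by positivity
  refine (dist_pi_le_iff (by positivity)).2 fun k => ?_
  have h1 := hx k
  have h2 := hy k
  rw [Subtype.dist_eq, Real.dist_eq, le_div_iff₀ hM]
  have e : |(x k : ℝ) - y k| * (M + 1) = |((x k : ℝ) - y k) * (M + 1)| := by rw [abs_mul, abs_of_pos hM]
  rw [e, abs_le]
  constructor <;> nlinarith [h1.1, h1.2, h2.1, h2.2]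

theorem exists_labels {n : ℕ} {f : (Fin n → I) × I → E3} (hf : Continuous f)
    (hfin : ∀ x, {q : ℝ | ∃ t, f (x, t) ∉ XP {q}}.Finite) {p : Fin (n + 1) → ℝ} (hp : Function.Injective p)
    (hE : ∀ i, ∀ x ∈ E n i, ∀ t, f (x, t) ∈ XP {p i}) :
    ∃ M, ∃ ℓ : GV M n → ℝ, Function.Injective ℓ ∧ (∀ i, ℓ (Sum.inr i) = p i) ∧
      ∀ v, ∀ x ∈ cell M v, ∀ t, f (x, t) ∈ XP {ℓ v} := by
  let W : Set (ℝ × ((Fin n → I) × I)) := {z | f z.2 ∈ XP {z.1}}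
  have hW : IsOpen W := isOpen_mem_XP.preimage (f := fun z : ℝ × ((Fin n → I) × I) => (z.1, f z.2)) (by fun_prop)
  let U : ℝ → Set (Fin n → I) := fun q => {x | ∀ t, f (x, t) ∈ XP {q}}
  have hU : ∀ q, IsOpen (U q) := fun q => by
    have := isOpen_forall (A := Fin n → I) (Y := I) isClosed_univ
      (hW.preimage (f := fun z : (Fin n → I) × I => (q, z)) (by fun_prop))
    simpa [W, U] using this
  have hcov : (Set.univ : Set (Fin n → I)) ⊆ ⋃ q, U q := fun x _ => by
    obtain ⟨q, hq⟩ := (hfin x).infinite_compl.nonempty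
    exact Set.mem_iUnion.2 ⟨q, fun t => by_contra fun h => hq ⟨t, h⟩⟩
  obtain ⟨δ, hδ, hδ'⟩ := lebesgue_number_lemma_of_metric isCompact_univ hU hcov
  obtain ⟨M, hM⟩ := exists_nat_one_div_lt hδ
  let Q : (Fin n → Fin (M + 1)) → Set ℝ := fun c =>
    {q | ∀ y ∈ cell M (Sum.inl c) ×ˢ (Set.univ : Set I), (q, y) ∈ W}
  have hQo : ∀ c, IsOpen (Q c) := fun c => isOpen_forall ((isClosed_cell M _).prod isClosed_univ) hW
  have hQ : ∀ c, (Q c \ Set.range p).Infinite := fun c => by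
    obtain ⟨x, hx⟩ := box_nonempty M c
    obtain ⟨q, hq⟩ := hδ' x trivial
    have hqQ : q ∈ Q c := fun y hy => hq (lt_of_le_of_lt (dist_le_of_mem_box hy.1 hx) hM) y.2
    exact (infinite_of_mem_nhds q ((hQo c).mem_nhds hqQ)).sdiff (Set.finite_range p)
  obtain ⟨ℓ, hℓ, hℓQ⟩ := exists_injective_choice _ hQ
  refine ⟨M, Sum.elim ℓ p, ?_, fun _ => rfl, ?_⟩
  · exact hℓ.sumElim hp fun c i h => (hℓQ c).2 ⟨i, h.symm⟩
  · rintro (c | i) x hx t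
    · exact (hℓQ c).1 (x, t) ⟨hx, trivial⟩
    · exact hE i x hx t

theorem kan_image {V : Type} [DecidableEq V] {ℓ : V → ℝ} (hℓ : Function.Injective ℓ) (P : Finset V) :
    Kan (fun σ : Finset V => NN (σ.image ℓ)) P := by
  intro p hp S hS a ha
  have : Nonempty V := ⟨p⟩
  have hinv : ∀ v, Function.invFun ℓ (ℓ v) = v := Function.leftInverse_invFun hℓ
  obtain ⟨g, hg⟩ := kan_NN (P.image ℓ) (ℓ p) (Finset.mem_image_of_mem ℓ hp) (S.image ℓ)
    (by rw [← Finset.image_erase hℓ]; exact Finset.image_subset_image hS) (fun r => a (Function.invFun ℓ r)) (by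
      simp only [Finset.forall_mem_image, hinv, ← Finset.image_erase hℓ]
      exact fun i hi j hj hij => ha i hi j hj fun h => hij (by rw [h]))
  refine ⟨g, fun i hi => ?_⟩
  have := hg (ℓ i) (Finset.mem_image_of_mem ℓ hi)
  rwa [hinv, ← Finset.image_erase hℓ] at this

theorem exists_word_labels {n M : ℕ} {f : (Fin n → I) × I → E3} (hf : Fam f) {ℓ : GV M n → ℝ}
    (hℓ : Function.Injective ℓ) (h : ∀ v, ∀ x ∈ cell M v, ∀ t, f (x, t) ∈ XP {ℓ v}) :
    ∃ u, ∀ x, ∀ σ : Finset (GV M n), σ.Nonempty → (∀ v ∈ σ, x ∈ cell M v) →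
      HasWord (σ.image ℓ) (fun t => f (x, t)) u := by
  have hc := hf.continuous
  have hw : ∀ σ : Finset (GV M n), ∃ g, ∀ x, (∀ v ∈ σ, x ∈ cell M v) → HasWord (σ.image ℓ) (fun t => f (x, t)) g := by
    intro σ
    by_cases hσ : nerve M n σ
    · obtain ⟨x, hx⟩ := hσ
      have hm : ∀ y, (∀ v ∈ σ, y ∈ cell M v) → ∀ t, f (y, t) ∈ XP (σ.image ℓ) := fun y hy t =>
        mem_XP_image.2 fun v hv => h v y (hy v hv) t
      obtain ⟨g, hg⟩ := HasWord.exists (ω := fun t => f (x, t)) (by fun_prop) (hm x hx) (hf.source x) (hf.target x)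
      refine ⟨g, fun y hy => ?_⟩
      exact HasWord.of_isPreconnected (isPreconnected_cells M n (σ : Set (GV M n))) hc.continuousOn
        (fun y hy => hm y hy) (fun y _ => hf.source y) (fun y _ => hf.target y) hx hy hg
    · exact ⟨1, fun x hx => (hσ ⟨x, hx⟩).elim⟩
  choose a ha using hw
  obtain ⟨u, hu⟩ := LP_nerve M n F (fun σ => NN (σ.image ℓ)) (fun _ => inferInstance)
    (fun σ τ hστ => NN_anti (Finset.image_subset_image hστ)) (fun P _ => kan_image hℓ P) a (by
      rintro σ τ ⟨x, hx⟩ hτ -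
      exact (ha τ x fun v hv => hx v (hτ hv)).inv_mul_mem ((ha σ x hx).mono (Finset.image_subset_image hτ)))
  exact ⟨u, fun x σ hσ hx => (ha σ x hx).congr (cl_eq.2 (hu σ ⟨x, hx⟩ hσ)).symm⟩

/-- Every word is realized by a loop. -/
theorem HasWord.exists_loop (P : Finset ℝ) (u : F) : ∃ ω, HasWord P ω u := by
  obtain ⟨k, -, -, hk⟩ := HasWord.extend (P := insert 0 P) (g := u) (Finset.insert_nonempty _ _) (Y := Unit)
    isClosed_empty (f := fun _ => bE) (by simp) (by simp)
  exact ⟨_, (hk ()).mono (Finset.subset_insert _ _)⟩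

/-- The family is homotopic, avoiding the prescribed rays, to one with a single global word. -/
def Rel {n : ℕ} (p : Fin (n + 1) → ℝ) (w : F) (f : (Fin n → I) × I → E3) : Prop :=
  ∃ g, Htpy (E n) p f g ∧ ∀ x, HasWord (Finset.univ.image p) (fun t => g (x, t)) w

theorem exists_rel {n : ℕ} {f : (Fin n → I) × I → E3} (hf : Fam f) {p : Fin (n + 1) → ℝ}
    (hp : Function.Injective p) (hE : ∀ i, ∀ x ∈ E n i, ∀ t, f (x, t) ∈ XP {p i}) : ∃ w, Rel p w f := by
  obtain ⟨f', hff', hf', hE', hfin⟩ := exists_htpy_finite (isClosed_E n) hf hE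
  have hc' := hf'.continuous
  obtain ⟨M, ℓ, hℓ, hℓp, hℓE⟩ := exists_labels hf'.continuous hfin hp hE'
  obtain ⟨u, hu⟩ := exists_word_labels hf' hℓ hℓE
  obtain ⟨ω, hω⟩ := HasWord.exists_loop (Finset.univ.image ℓ) u
  have hωc := hω.continuous
  refine ⟨u, fun z => ω z.2, hff'.trans ?_, fun x => hω.mono ?_⟩
  swap
  · intro q hq
    obtain ⟨i, -, rfl⟩ := Finset.mem_image.1 hq
    exact Finset.mem_image.2 ⟨Sum.inr i, Finset.mem_univ _, hℓp i⟩
  let k0 : (I × (Fin n → I)) × I → E3 := fun z => if z.1.1 = 0 then f' (z.1.2, z.2) else ω z.2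
  have hk00 : ∀ x t, k0 ((0, x), t) = f' (x, t) := fun x t => if_pos rfl
  have hk01 : ∀ x t, k0 ((1, x), t) = ω t := fun x t => if_neg (by simp)
  have hB0 : IsClosed {y : I × (Fin n → I) | y.1 = 0} := isClosed_eq continuous_fst continuous_const
  have hB1 : IsClosed {y : I × (Fin n → I) | y.1 = 1} := isClosed_eq continuous_fst continuous_const
  obtain ⟨H, hH, hHk, hHw⟩ := realize ℓ (fun v => {y : I × (Fin n → I) | y.2 ∈ cell M v})
    (fun v => (isClosed_cell M v).preimage continuous_snd)
    (B := {y | y.1 = 0} ∪ {y | y.1 = 1}) (hB0.union hB1) (f := k0) (by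
      rw [Set.union_prod]
      refine ContinuousOn.union_of_isClosed ?_ ?_ (hB0.prod isClosed_univ) (hB1.prod isClosed_univ)
      · refine (show Continuous fun z : (I × (Fin n → I)) × I => f' (z.1.2, z.2) by fun_prop).continuousOn.congr ?_
        rintro ⟨⟨s, x⟩, t⟩ ⟨hs : s = 0, -⟩
        subst hs
        exact hk00 x t
      · refine (show Continuous fun z : (I × (Fin n → I)) × I => ω z.2 by fun_prop).continuousOn.congr ?_
        rintro ⟨⟨s, x⟩, t⟩ ⟨hs : s = 1, -⟩
        subst hs
        exact hk01 x t) u (by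
      rintro ⟨s, x⟩ ((hs : s = 0) | (hs : s = 1)) σ hσ hx
      · subst hs
        simp only [hk00]
        exact hu x σ hσ hx
      · subst hs
        simp only [hk01]
        exact hω.mono (Finset.image_subset_image (Finset.subset_univ σ)))
  have hun : (({y | y.1 = 0} ∪ {y | y.1 = 1}) ∪ ⋃ v, {y : I × (Fin n → I) | y.2 ∈ cell M v}) = Set.univ := by
    refine Set.eq_univ_of_forall fun y => Or.inr ?_
    obtain ⟨c, hc⟩ := exists_mem_box M y.2
    exact Set.mem_iUnion.2 ⟨Sum.inl c, hc⟩
  rw [hun, Set.univ_prod_univ, continuousOn_univ] at hH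
  have hw1 : ∀ v, ∀ x ∈ cell M v, ∀ s, HasWord {ℓ v} (fun t => H ((s, x), t)) u := fun v x hx s => by
    have := hHw (s, x) {v} (Finset.singleton_nonempty v) (by simpa using hx)
    rwa [Finset.image_singleton] at this
  have hw2 : ∀ s x, ∃ q : ℝ, HasWord {q} (fun t => H ((s, x), t)) u := fun s x => by
    obtain ⟨c, hc⟩ := exists_mem_box M x
    exact ⟨_, hw1 _ x hc s⟩
  refine ⟨H, ⟨hH, ?_, ?_, ?_⟩, ?_, ?_, ?_⟩
  · rintro ⟨⟨s, x⟩, t⟩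
    obtain ⟨q, hq⟩ := hw2 s x
    exact ne_zero_of_mem_XP (Finset.singleton_nonempty q) (hq.mem t)
  · rintro ⟨s, x⟩
    obtain ⟨q, hq⟩ := hw2 s x
    exact hq.zero
  · rintro ⟨s, x⟩
    obtain ⟨q, hq⟩ := hw2 s x
    exact hq.one
  · exact fun x t => (hHk (x := ((0, x), t)) ⟨Or.inl rfl, trivial⟩).trans (hk00 x t)
  · exact fun x t => (hHk (x := ((1, x), t)) ⟨Or.inr rfl, trivial⟩).trans (hk01 x t)
  · intro i x hx s t
    have := (hw1 (Sum.inr i) x hx s).mem t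
    rwa [hℓp] at this

theorem Rel.hasWord {n : ℕ} {p : Fin (n + 1) → ℝ} {w : F} {f : (Fin n → I) × I → E3} (h : Rel p w f)
    {x : Fin n → I} {σ : Finset (Fin (n + 1))} (hx : ∀ i ∈ σ, x ∈ E n i) :
    HasWord (σ.image p) (fun t => f (x, t)) w := by
  obtain ⟨g, ⟨H, hH, h0, h1, hE⟩, hg⟩ := h
  have hc := hH.continuous
  have := HasWord.of_isPreconnected (P := σ.image p) (g := w) (S := (Set.univ : Set I)) isPreconnected_univ
    (f := fun z : I × I => H ((z.1, x), z.2)) (by fun_prop)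
    (fun s _ t => mem_XP_image.2 fun i hi => hE i x (hx i hi) s t) (fun s _ => hH.source _) (fun s _ => hH.target _)
    (y := 1) (y' := 0) trivial trivial (by
      simp only [h1]
      exact (hg x).mono (Finset.image_subset_image (Finset.subset_univ σ)))
  simpa only [h0] using this

end Wu

namespace Wu

open Topology

/-- The pair formed by a space and a subset admits a retraction of the cylinder onto the top and the sides. -/
def CylRetract {Q : Type} [TopologicalSpace Q] (D : Set Q) : Prop :=
  ∃ r : I × Q → I × Q, Continuous r ∧ (∀ z, (r z).1 = 1 ∨ (r z).2 ∈ D) ∧ ∀ z, (z.1 = 1 ∨ z.2 ∈ D) → r z = z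

theorem cylRetract_cube (n : ℕ) : CylRetract (Cube.boundary (Fin n)) := by
  let y : I × (Fin n → I) → Fin n → ℝ := fun z k => 2 * (z.2 k : ℝ) - 1
  have hy : Continuous y := by fun_prop
  let m : I × (Fin n → I) → ℝ := fun z => max (((z.1 : ℝ) + 1) / 2) ‖y z‖
  have hm : Continuous m := by fun_prop
  have hm0 : ∀ z, 0 < m z := fun z => lt_max_of_lt_left (by have := z.1.2.1; positivity)
  have hm0' : ∀ z, m z ≠ 0 := fun z => (hm0 z).ne'
  have hyk : ∀ z k, |y z k| ≤ 1 := fun z k => by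
    have h1 := (z.2 k).2.1
    have h2 := (z.2 k).2.2
    rw [abs_le]
    constructor <;> simp only [y] <;> linarith
  refine ⟨fun z => (Set.projIcc 0 1 zero_le_one (((z.1 : ℝ) + 1) / m z - 1),
    fun k => Set.projIcc 0 1 zero_le_one ((y z k / m z + 1) / 2)), ?_, ?_, ?_⟩
  · refine Continuous.prodMk (continuous_projIcc.comp ?_) (continuous_pi fun k => continuous_projIcc.comp ?_)
    · exact ((by fun_prop : Continuous fun z : I × (Fin n → I) => (z.1 : ℝ) + 1).div hm hm0').sub continuous_const
    · exact ((((continuous_apply k).comp hy).div hm hm0').add continuous_const).div_const 2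
  · intro z
    by_cases h : ∀ k, |y z k| < m z
    · left
      have h1 : ‖y z‖ < m z := (pi_norm_lt_iff (hm0 z)).2 h
      have h2 : m z = ((z.1 : ℝ) + 1) / 2 := by
        rcases max_choice (((z.1 : ℝ) + 1) / 2) ‖y z‖ with h' | h'
        · exact h'
        · exact absurd h' h1.ne'
      have h3 : ((z.1 : ℝ) + 1) / m z - 1 = 1 := by
        have := hm0' z
        field_simp
        linarith
      dsimp only
      rw [h3]
      exact Set.projIcc_right zero_le_one
    · right
      push Not at h
      obtain ⟨k, hk⟩ := h
      have h1 : |y z k| = m z := le_antisymm ((norm_le_pi_norm (y z) k).trans (le_max_right _ _)) hk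
      refine ⟨k, ?_⟩
      dsimp only
      rcases abs_choice (y z k) with h2 | h2 <;> rw [h2] at h1
      · right
        rw [h1, div_self (hm0' z)]
        exact Set.projIcc_of_right_le _ (by norm_num)
      · left
        rw [← neg_neg (y z k), h1, neg_div, div_self (hm0' z)]
        exact Set.projIcc_of_le_left _ (by norm_num)
  · intro z hz
    have h1 : m z = 1 := by
      have hle : ‖y z‖ ≤ 1 := (pi_norm_le_iff_of_nonneg zero_le_one).2 (hyk z)
      have hs := z.1.2.2
      rcases hz with hz | ⟨k, hk⟩
      · refine le_antisymm (max_le (by linarith) hle) (le_max_of_le_left ?_)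
        rw [hz]
        norm_num
      · refine le_antisymm (max_le (by linarith) hle) (le_max_of_le_right ?_)
        have h2 : |y z k| = 1 := by
          rcases hk with hk | hk <;> simp only [y, hk] <;> norm_num
        exact h2.symm.le.trans (norm_le_pi_norm (y z) k)
    dsimp only
    refine Prod.ext ?_ (funext fun k => ?_)
    · dsimp only
      rw [h1, div_one, add_sub_cancel_right]
      exact Set.projIcc_val _ _
    · dsimp only
      have : (y z k / m z + 1) / 2 = z.2 k := by rw [h1, div_one]; simp only [y]; ring
      rw [this]
      exact Set.projIcc_val _ _

theorem cylRetract_prod (n : ℕ) :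
    CylRetract {q : I × (Fin n → I) | (q.1 = 0 ∨ q.1 = 1) ∨ q.2 ∈ Cube.boundary (Fin n)} := by
  obtain ⟨r, hr, h1, h2⟩ := cylRetract_cube (n + 1)
  have hcons : Continuous fun q : I × (Fin n → I) => (Fin.cons q.1 q.2 : Fin (n + 1) → I) :=
    continuous_pi fun i => by
      refine Fin.cases ?_ (fun i => ?_) i
      · simpa using continuous_fst
      · simpa using (by fun_prop : Continuous fun q : I × (Fin n → I) => q.2 i)
  have hmem : ∀ q : Fin (n + 1) → I, q ∈ Cube.boundary (Fin (n + 1)) ↔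
      (q 0 = 0 ∨ q 0 = 1) ∨ Fin.tail q ∈ Cube.boundary (Fin n) := fun q => by
    simp only [Cube.boundary, Set.mem_ofPred_eq, Fin.exists_fin_succ]
    rfl
  have ht : Continuous fun z : I × (I × (Fin n → I)) => (z.1, (Fin.cons z.2.1 z.2.2 : Fin (n + 1) → I)) :=
    continuous_fst.prodMk (hcons.comp continuous_snd)
  have hr' := hr.comp ht
  refine ⟨fun z => ((r (z.1, Fin.cons z.2.1 z.2.2)).1, ((r (z.1, Fin.cons z.2.1 z.2.2)).2 0,
    Fin.tail (r (z.1, Fin.cons z.2.1 z.2.2)).2)), ?_, ?_, ?_⟩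
  · exact (continuous_fst.comp hr').prodMk (((continuous_apply 0).comp (continuous_snd.comp hr')).prodMk
      (continuous_tail.comp (continuous_snd.comp hr')))
  · intro z
    exact (h1 _).imp id fun h => (hmem _).1 h
  · rintro ⟨s, a, x⟩ hz
    dsimp only
    rw [h2]
    · rfl
    · refine hz.imp id fun h => (hmem _).2 ?_
      simpa using h

/-- Families of loops that are constant on the boundary of the cube. -/
structure BFam {n : ℕ} (f : (Fin n → I) × I → E3) : Prop extends Fam f where
  boundary : ∀ x ∈ Cube.boundary (Fin n), ∀ t, f (x, t) = bE

/-- Null-homotopies relative to the boundary. -/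
def Null {n : ℕ} (f : (Fin n → I) × I → E3) : Prop :=
  ∃ H : (I × (Fin n → I)) × I → E3, Fam H ∧ (∀ x t, H ((0, x), t) = f (x, t)) ∧ (∀ x t, H ((1, x), t) = bE) ∧
    ∀ x ∈ Cube.boundary (Fin n), ∀ s t, H ((s, x), t) = bE

theorem bE_ne_zero : bE ≠ 0 := ne_zero_of_mem_XP (Finset.singleton_nonempty 0) (bE_mem _)

variable {n : ℕ} {p : Fin (n + 1) → ℝ} {f g : (Fin n → I) × I → E3} {w w' : F}

theorem mem_boundary_of_mem_E {i : Fin (n + 1)} {x : Fin n → I} (h : x ∈ E n i) : x ∈ Cube.boundary (Fin n) :=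
  (exists_mem_E n x).1 ⟨i, h⟩

theorem BFam.exists_rel (hf : BFam f) (hp : Function.Injective p) : ∃ w, Rel p w f :=
  Wu.exists_rel hf.toFam hp fun i x hx t => by
    rw [hf.boundary x (mem_boundary_of_mem_E hx)]
    exact bE_mem _

theorem Rel.mem_NN (hn : 1 ≤ n) (hf : BFam f) (h : Rel p w f) (j : Fin (n + 1)) :
    w ∈ NN ((Finset.univ.erase j).image p) := by
  obtain ⟨x, hx⟩ := exists_mem_E_of_ne n j
  have hw := h.hasWord (x := x) (σ := Finset.univ.erase j) fun i hi => hx i (Finset.ne_of_mem_erase hi)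
  obtain ⟨i, hi⟩ : ∃ i, i ≠ j := by
    have : Nontrivial (Fin (n + 1)) := Fin.nontrivial_iff_two_le.2 (by omega)
    exact exists_ne j
  simp only [hf.boundary x (mem_boundary_of_mem_E (hx i hi))] at hw
  simpa using HasWord.const.inv_mul_mem hw

theorem mem_NN_of_forall (hw : ∀ j, w ∈ NN ((Finset.univ.erase j).image p)) {x : Fin n → I}
    {σ : Finset (Fin (n + 1))} (hx : ∀ i ∈ σ, x ∈ E n i) : w ∈ NN (σ.image p) := by
  obtain ⟨j, hj⟩ := exists_notMem_E n x
  exact NN_anti (Finset.image_subset_image fun i hi =>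
    Finset.mem_erase.2 ⟨fun h : i = j => hj (h ▸ hx i hi), Finset.mem_univ i⟩) (hw j)

theorem HasWord.const_of_mem {P : Finset ℝ} (h : w ∈ NN P) : HasWord P (fun _ => bE) w :=
  HasWord.const.congr (cl_eq.2 (by simpa using h))

theorem exists_of_forall_mem_NN (hw : ∀ j, w ∈ NN ((Finset.univ.erase j).image p)) :
    ∃ f : (Fin n → I) × I → E3, BFam f ∧ Rel p w f := by
  obtain ⟨ω, hω⟩ := HasWord.exists_loop (Finset.univ.image p) w
  have hωc := hω.continuous
  let k0 : (I × (Fin n → I)) × I → E3 := fun z => if z.1.1 = 0 then bE else ω z.2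
  have hk00 : ∀ x t, k0 ((0, x), t) = bE := fun x t => if_pos rfl
  have hk01 : ∀ x t, k0 ((1, x), t) = ω t := fun x t => if_neg (by simp)
  have hB0 : IsClosed {y : I × (Fin n → I) | y.1 = 0} := isClosed_eq continuous_fst continuous_const
  have hB1 : IsClosed {y : I × (Fin n → I) | y.1 = 1} := isClosed_eq continuous_fst continuous_const
  obtain ⟨k, hk, hkk, hkw⟩ := realize p (fun v => {y : I × (Fin n → I) | y.2 ∈ E n v})
    (fun v => (isClosed_E n v).preimage continuous_snd)
    (B := {y | y.1 = 0} ∪ {y | y.1 = 1}) (hB0.union hB1) (f := k0) (by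
      rw [Set.union_prod]
      refine ContinuousOn.union_of_isClosed ?_ ?_ (hB0.prod isClosed_univ) (hB1.prod isClosed_univ)
      · refine (continuous_const (y := bE)).continuousOn.congr ?_
        rintro ⟨⟨s, x⟩, t⟩ ⟨hs : s = 0, -⟩
        subst hs
        exact hk00 x t
      · refine (show Continuous fun z : (I × (Fin n → I)) × I => ω z.2 by fun_prop).continuousOn.congr ?_
        rintro ⟨⟨s, x⟩, t⟩ ⟨hs : s = 1, -⟩
        subst hs
        exact hk01 x t) w (by
      rintro ⟨s, x⟩ ((hs : s = 0) | (hs : s = 1)) σ hσ hx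
      · subst hs
        simp only [hk00]
        exact HasWord.const_of_mem (mem_NN_of_forall hw hx)
      · subst hs
        simp only [hk01]
        exact hω.mono (Finset.image_subset_image (Finset.subset_univ σ)))
  have h0 : ∀ x t, k ((0, x), t) = bE := fun x t =>
    (hkk (x := ((0, x), t)) ⟨Or.inl rfl, trivial⟩).trans (hk00 x t)
  have h1 : ∀ x t, k ((1, x), t) = ω t := fun x t =>
    (hkk (x := ((1, x), t)) ⟨Or.inr rfl, trivial⟩).trans (hk01 x t)
  have hE : ∀ i, ∀ x ∈ E n i, ∀ s, HasWord {p i} (fun t => k ((s, x), t)) w := fun i x hx s => by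
    have := hkw (s, x) {i} (Finset.singleton_nonempty i) (by simpa using hx)
    rwa [Finset.image_singleton] at this
  obtain ⟨r, hr, hr1, hr2⟩ := cylRetract_cube n
  have hword : ∀ z, ∃ q : ℝ, HasWord {q} (fun t => k (r z, t)) w := by
    intro z
    rcases hr1 z with h | h
    · refine ⟨p 0, ?_⟩
      have e : r z = (1, (r z).2) := Prod.ext h rfl
      rw [e]
      simp only [h1]
      exact hω.mono (by simp)
    · obtain ⟨i, hi⟩ := (exists_mem_E n _).2 h
      exact ⟨p i, hE i _ hi _⟩
  have hH : Fam fun z : (I × (Fin n → I)) × I => k (r z.1, z.2) := by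
    refine ⟨?_, ?_, ?_, ?_⟩
    · refine hk.comp_continuous (by fun_prop) fun z => ⟨?_, trivial⟩
      rcases hr1 z.1 with h | h
      · exact Or.inl (Or.inr h)
      · obtain ⟨i, hi⟩ := (exists_mem_E n _).2 h
        exact Or.inr (Set.mem_iUnion.2 ⟨i, hi⟩)
    · intro z
      obtain ⟨q, hq⟩ := hword z.1
      exact ne_zero_of_mem_XP (Finset.singleton_nonempty q) (hq.mem z.2)
    · intro z
      obtain ⟨q, hq⟩ := hword z
      exact hq.zero
    · intro z
      obtain ⟨q, hq⟩ := hword z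
      exact hq.one
  have hT : Htpy (E n) p (fun z => k (r (0, z.1), z.2)) (fun z => ω z.2) := by
    refine ⟨_, hH, fun x t => rfl, fun x t => ?_, fun i x hx s t => ?_⟩
    · dsimp only
      rw [hr2 _ (Or.inl rfl), h1]
    · dsimp only
      rw [hr2 _ (Or.inr (mem_boundary_of_mem_E hx))]
      exact (hE i x hx s).mem t
  refine ⟨_, ⟨hT.fam_left, fun x hx t => ?_⟩, _, hT, fun x => hω⟩
  dsimp only
  rw [hr2 _ (Or.inr hx), h0]

/-- Pointwise concatenation of families of loops. -/
noncomputable def cat {X : Type} (f g : X × I → E3) : X × I → E3 := fun z =>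
  if (z.2 : ℝ) ≤ 1 / 2 then f (z.1, Set.projIcc 0 1 zero_le_one (2 * (z.2 : ℝ)))
  else g (z.1, Set.projIcc 0 1 zero_le_one (2 * (z.2 : ℝ) - 1))

theorem Fam.cat {X : Type} [TopologicalSpace X] {f g : X × I → E3} (hf : Fam f) (hg : Fam g) : Fam (cat f g) := by
  have hc := hf.continuous
  have hc' := hg.continuous
  refine ⟨?_, ?_, ?_, ?_⟩
  · refine Continuous.if_le ?_ ?_ (by fun_prop) continuous_const fun z hz => ?_
    · exact hc.comp (continuous_fst.prodMk (continuous_projIcc.comp (by fun_prop)))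
    · exact hc'.comp (continuous_fst.prodMk (continuous_projIcc.comp (by fun_prop)))
    · rw [hz, Set.projIcc_of_right_le _ (by norm_num), Set.projIcc_of_le_left _ (by norm_num)]
      exact (hf.target _).trans (hg.source _).symm
  · intro z
    unfold Wu.cat
    split_ifs
    · exact hf.ne_zero _
    · exact hg.ne_zero _
  · intro x
    unfold Wu.cat
    rw [if_pos (by simp), Set.projIcc_of_le_left _ (by simp)]
    exact hf.source x
  · intro x
    unfold Wu.cat
    rw [if_neg (by norm_num), Set.projIcc_of_right_le _ (by norm_num)]
    exact hg.target x

theorem Rel.cat {f' : (Fin n → I) × I → E3} (h : Rel p w f) (h' : Rel p w' f') : Rel p (w * w') (cat f f') := by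
  obtain ⟨g, ⟨H, hH, h0, h1, hE⟩, hg⟩ := h
  obtain ⟨g', ⟨H', hH', h0', h1', hE'⟩, hg'⟩ := h'
  refine ⟨Wu.cat g g', ⟨Wu.cat H H', hH.cat hH', ?_, ?_, ?_⟩, fun x => (hg x).concat (hg' x)⟩
  · intro x t
    simp only [Wu.cat, h0, h0']
  · intro x t
    simp only [Wu.cat, h1, h1']
  · intro i x hx s t
    unfold Wu.cat
    split_ifs
    · exact hE i x hx _ _
    · exact hE' i x hx _ _

theorem Rel.of_htpy (h : Rel p w f) (hg : Htpy (E n) p g f) : Rel p w g := by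
  obtain ⟨k, hk, hw⟩ := h
  exact ⟨k, hg.trans hk, hw⟩

end Wu

namespace Wu

open Topology

variable {n : ℕ} {p : Fin (n + 1) → ℝ} {f g : (Fin n → I) × I → E3} {w w' u : F}

theorem Rel.null (h : Rel p 1 f) (hf : BFam f) : Null f := by
  obtain ⟨g, ⟨H, hH, h0, h1, hE⟩, hg⟩ := h
  have hc := hH.continuous
  have hHw : ∀ x, ∀ σ : Finset (Fin (n + 1)), (∀ i ∈ σ, x ∈ E n i) → ∀ s,
      HasWord (σ.image p) (fun t => H ((s, x), t)) 1 := fun x σ hx s =>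
    HasWord.of_isPreconnected (P := σ.image p) (S := (Set.univ : Set I)) isPreconnected_univ
      (f := fun z : I × I => H ((z.1, x), z.2)) (by fun_prop)
      (fun s _ t => mem_XP_image.2 fun i hi => hE i x (hx i hi) s t) (fun s _ => hH.source _)
      (fun s _ => hH.target _) (y := 1) (y' := s) trivial trivial (by
        simp only [h1]
        exact (hg x).mono (Finset.image_subset_image (Finset.subset_univ σ)))
  have hH1 : ∀ x, HasWord (Finset.univ.image p) (fun t => H ((1, x), t)) 1 := fun x => by
    simp only [h1]
    exact hg x
  let k0 : (I × (I × (Fin n → I))) × I → E3 := fun z => if z.1.1 = 0 then H (z.1.2, z.2) else bE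
  have hk00 : ∀ y t, k0 ((0, y), t) = H (y, t) := fun y t => if_pos rfl
  have hk01 : ∀ y t, k0 ((1, y), t) = bE := fun y t => if_neg (by simp)
  have hk0b : ∀ s, ∀ x ∈ Cube.boundary (Fin n), ∀ t, k0 ((s, (0, x)), t) = bE := fun s x hx t => by
    by_cases hs : s = 0
    · subst hs
      rw [hk00, h0, hf.boundary x hx]
    · exact if_neg hs
  have hbd : IsClosed (Cube.boundary (Fin n)) := by
    have : Cube.boundary (Fin n) = ⋃ i, E n i := Set.ext fun x => by
      rw [Set.mem_iUnion, exists_mem_E]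
    rw [this]
    exact isClosed_iUnion_of_finite fun i => isClosed_E n i
  have hB0 : IsClosed {y : I × (I × (Fin n → I)) | y.1 = 0} := isClosed_eq continuous_fst continuous_const
  have hB1 : IsClosed {y : I × (I × (Fin n → I)) | y.1 = 1} := isClosed_eq continuous_fst continuous_const
  have hB2 : IsClosed {y : I × (I × (Fin n → I)) | y.2.1 = 0 ∧ y.2.2 ∈ Cube.boundary (Fin n)} :=
    (isClosed_eq (f := fun y : I × (I × (Fin n → I)) => y.2.1) (g := fun _ => 0) (by fun_prop) continuous_const).inter
      (hbd.preimage (f := fun y : I × (I × (Fin n → I)) => y.2.2) (by fun_prop))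
  obtain ⟨k, hk, hkk, hkw⟩ := realize p (fun v => {y : I × (I × (Fin n → I)) | y.2.1 = 1 ∨ y.2.2 ∈ E n v})
    (fun v => (isClosed_eq (f := fun y : I × (I × (Fin n → I)) => y.2.1) (g := fun _ => 1) (by fun_prop) continuous_const).union
      ((isClosed_E n v).preimage (f := fun y : I × (I × (Fin n → I)) => y.2.2) (by fun_prop)))
    (B := {y | y.1 = 0} ∪ ({y | y.1 = 1} ∪ {y | y.2.1 = 0 ∧ y.2.2 ∈ Cube.boundary (Fin n)}))
    (hB0.union (hB1.union hB2)) (f := k0) (by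
      rw [Set.union_prod]
      refine ContinuousOn.union_of_isClosed ?_ ?_ (hB0.prod isClosed_univ) ((hB1.union hB2).prod isClosed_univ)
      · refine (show Continuous fun z : (I × (I × (Fin n → I))) × I => H (z.1.2, z.2) by fun_prop).continuousOn.congr ?_
        rintro ⟨⟨s, x⟩, t⟩ ⟨hs : s = 0, -⟩
        subst hs
        exact hk00 x t
      · refine (continuous_const (y := bE)).continuousOn.congr ?_
        rintro ⟨⟨s, a, x⟩, t⟩ ⟨((hs : s = 1) | ⟨(hs : a = 0), hx⟩), -⟩
        · subst hs
          exact hk01 _ t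
        · subst hs
          exact hk0b s x hx t) 1 (by
      rintro ⟨s, a, x⟩ ((hs : s = 0) | ((hs : s = 1) | ⟨(hs : a = 0), hx⟩)) σ hσ hσx
      · subst hs
        simp only [hk00]
        by_cases ha : a = 1
        · subst ha
          exact (hH1 x).mono (Finset.image_subset_image (Finset.subset_univ σ))
        · exact hHw x σ (fun i hi => (hσx i hi).resolve_left ha) a
      · subst hs
        simp only [hk01]
        exact HasWord.const
      · subst hs
        simp only [hk0b s x hx]
        exact HasWord.const)
  have e0 : ∀ y t, k ((0, y), t) = H (y, t) := fun y t =>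
    (hkk (x := ((0, y), t)) ⟨Or.inl rfl, trivial⟩).trans (hk00 y t)
  have e1 : ∀ y t, k ((1, y), t) = bE := fun y t =>
    (hkk (x := ((1, y), t)) ⟨Or.inr (Or.inl rfl), trivial⟩).trans (hk01 y t)
  have eb : ∀ s, ∀ x ∈ Cube.boundary (Fin n), ∀ t, k ((s, (0, x)), t) = bE := fun s x hx t =>
    (hkk (x := ((s, (0, x)), t)) ⟨Or.inr (Or.inr ⟨rfl, hx⟩), trivial⟩).trans (hk0b s x hx t)
  have hE' : ∀ i, ∀ y : I × (I × (Fin n → I)), (y.2.1 = 1 ∨ y.2.2 ∈ E n i) → HasWord {p i} (fun t => k (y, t)) 1 := fun i y hy => by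
    have := hkw y {i} (Finset.singleton_nonempty i) (by simpa using hy)
    rwa [Finset.image_singleton] at this
  obtain ⟨r, hr, hr1, hr2⟩ := cylRetract_prod n
  let q : I × (Fin n → I) → I × (I × (Fin n → I)) := fun z => ((r (0, z)).2.1, ((r (0, z)).1, (r (0, z)).2.2))
  have hq : Continuous q := by fun_prop
  have hqr : ∀ z, (z.1 = 0 ∨ z.1 = 1) ∨ z.2 ∈ Cube.boundary (Fin n) → q z = (z.1, (0, z.2)) := fun z hz => by
    have := hr2 (0, z) (Or.inr hz)
    simp only [q, this]
  have hcase : ∀ z, (q z).1 = 0 ∨ (q z).1 = 1 ∨ ∃ i, (q z).2.1 = 1 ∨ (q z).2.2 ∈ E n i := fun z => by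
    rcases hr1 (0, z) with h | ((h | h) | h)
    · exact Or.inr (Or.inr ⟨0, Or.inl h⟩)
    · exact Or.inl h
    · exact Or.inr (Or.inl h)
    · obtain ⟨i, hi⟩ := (exists_mem_E n _).2 h
      exact Or.inr (Or.inr ⟨i, Or.inr hi⟩)
  have hz : ∀ z, (∀ t, k (q z, t) ≠ 0) ∧ k (q z, 0) = bE ∧ k (q z, 1) = bE := by
    intro z
    rcases hcase z with h | h | ⟨i, hi⟩
    · have e : q z = (0, (q z).2) := Prod.ext h rfl
      rw [e]
      simp only [e0]
      exact ⟨fun t => hH.ne_zero _, hH.source _, hH.target _⟩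
    · have e : q z = (1, (q z).2) := Prod.ext h rfl
      rw [e]
      simp only [e1]
      exact ⟨fun t => bE_ne_zero, trivial, trivial⟩
    · have := hE' i _ hi
      exact ⟨fun t => ne_zero_of_mem_XP (Finset.singleton_nonempty _) (this.mem t), this.zero, this.one⟩
  refine ⟨fun z => k (q z.1, z.2), ⟨?_, fun z => (hz z.1).1 z.2, fun z => (hz z).2.1, fun z => (hz z).2.2⟩,
    fun x t => ?_, fun x t => ?_, fun x hx s t => ?_⟩
  · refine hk.comp_continuous (by fun_prop) fun z => ⟨?_, trivial⟩
    rcases hcase z.1 with h | h | ⟨i, hi⟩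
    · exact Or.inl (Or.inl h)
    · exact Or.inl (Or.inr (Or.inl h))
    · exact Or.inr (Set.mem_iUnion.2 ⟨i, hi⟩)
  · dsimp only
    rw [hqr _ (Or.inl (Or.inl rfl)), e0, h0]
  · dsimp only
    rw [hqr _ (Or.inl (Or.inr rfl)), e1]
  · dsimp only
    rw [hqr _ (Or.inr hx), eb s x hx]

theorem Null.htpy (h : Null f) : Htpy (E n) p f (fun _ => bE) := by
  obtain ⟨H, hH, h0, h1, hb⟩ := h
  refine ⟨H, hH, h0, h1, fun i x hx s t => ?_⟩
  rw [hb x (mem_boundary_of_mem_E hx)]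
  exact bE_mem _

theorem Rel.exists_word_of_htpy (h : Rel p w f) (hf : Htpy (E n) p f (fun _ => bE)) (hp : Function.Injective p)
    {q : ℝ} (hq : ∀ i, p i ≠ q) :
    ∃ u, (∀ i, u ∈ NN ((insert q (Finset.univ.image p)).erase (p i))) ∧ u⁻¹ * w ∈ NN (Finset.univ.image p) := by
  obtain ⟨g, hg, hw⟩ := h
  obtain ⟨H, hH, h0, h1, hE⟩ := hg.symm.trans hf
  have hc := hH.continuous
  let f' : (Fin (n + 1) → I) × I → E3 := fun z => H ((z.1 0, Fin.tail z.1), z.2)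
  have ht : Continuous fun x : Fin (n + 1) → I => Fin.tail x := continuous_tail
  have hf'c : Continuous f' := by
    refine hc.comp (Continuous.prodMk (Continuous.prodMk (by fun_prop) (ht.comp continuous_fst)) continuous_snd)
  have hf' : Fam f' := ⟨hf'c, fun z => hH.ne_zero _, fun x => hH.source _, fun x => hH.target _⟩
  let p' : Fin (n + 2) → ℝ := Fin.cons q p
  have hp' : Function.Injective p' := Fin.cons_injective_iff.2 ⟨by rintro ⟨i, hi⟩; exact hq i hi, hp⟩
  have hmem : ∀ j, ∀ x ∈ E (n + 1) j, ∀ t, f' (x, t) ∈ XP {p' j} := by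
    intro j x hx t
    induction j using Fin.cases with
    | zero =>
      rw [mem_E_zero] at hx
      simp only [f', hx, h1]
      exact bE_mem _
    | succ j =>
      rcases mem_E_succ.1 hx with hx | hx
      · simp only [f', hx, h0]
        exact XP_anti (by simp [p']) ((hw _).mem t)
      · exact hE j _ hx _ t
  obtain ⟨u, hu⟩ := exists_rel hf' hp' hmem
  refine ⟨u, fun i => ?_, ?_⟩
  · obtain ⟨x, hx⟩ := exists_mem_E_of_ne n i
    have h2 := hu.hasWord (x := Fin.cons 1 x) (σ := Finset.univ.erase i.succ) (by
      intro j hj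
      induction j using Fin.cases with
      | zero => rw [mem_E_zero]; simp
      | succ j =>
        refine mem_E_succ.2 (Or.inr ?_)
        rw [Fin.tail_cons]
        exact hx j fun h => Finset.ne_of_mem_erase hj (by rw [h]))
    simp only [f', Fin.cons_zero, Fin.tail_cons, h1] at h2
    have h3 := HasWord.const.inv_mul_mem h2
    rw [inv_one, one_mul] at h3
    refine NN_anti ?_ h3
    rw [Finset.image_erase hp']
    intro a ha
    rw [Finset.mem_erase] at ha ⊢
    refine ⟨ha.1, ?_⟩
    rcases Finset.mem_insert.1 ha.2 with rfl | ha
    · exact Finset.mem_image_of_mem p' (Finset.mem_univ 0)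
    · obtain ⟨j, -, rfl⟩ := Finset.mem_image.1 ha
      exact Finset.mem_image_of_mem p' (Finset.mem_univ j.succ)
  · have h2 := hu.hasWord (x := fun _ => 0) (σ := Finset.univ.image Fin.succ) (by
      intro j hj
      obtain ⟨j, -, rfl⟩ := Finset.mem_image.1 hj
      exact mem_E_succ.2 (Or.inl rfl))
    simp only [f', h0] at h2
    rw [Finset.image_image] at h2
    exact h2.inv_mul_mem (hw _)

theorem rel_const_of_word (hp : Function.Injective p) {q : ℝ} (hq : ∀ i, p i ≠ q)
    (hu : ∀ i, u ∈ NN ((insert q (Finset.univ.image p)).erase (p i))) (huw : u⁻¹ * w ∈ NN (Finset.univ.image p)) :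
    Rel p w (fun _ => bE) := by
  let p' : Fin (n + 2) → ℝ := Fin.cons q p
  have hp' : Function.Injective p' := Fin.cons_injective_iff.2 ⟨by rintro ⟨i, hi⟩; exact hq i hi, hp⟩
  let Y := I × (Fin n → I)
  let C : Fin (n + 2) → Set Y := Fin.cons Set.univ fun j => {y : Y | y.1 = 1 ∨ y.2 ∈ E n j}
  have hC : ∀ v, IsClosed (C v) := fun v => by
    induction v using Fin.cases with
    | zero => exact isClosed_univ
    | succ j => exact (isClosed_eq continuous_fst continuous_const).union ((isClosed_E n j).preimage continuous_snd)
  obtain ⟨k, hk, hkk, hkw⟩ := realize p' C hC (B := {y | y.1 = 0}) (isClosed_eq continuous_fst continuous_const)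
    (f := fun _ => bE) continuousOn_const u (by
      rintro ⟨s, x⟩ (hs : s = 0) σ hσ hx
      subst hs
      obtain ⟨i, hi⟩ := exists_notMem_E n x
      refine HasWord.const_of_mem (NN_anti ?_ (hu i))
      intro a ha
      obtain ⟨j, hj, rfl⟩ := Finset.mem_image.1 ha
      induction j using Fin.cases with
      | zero => exact Finset.mem_erase.2 ⟨(hq i).symm, Finset.mem_insert_self _ _⟩
      | succ j =>
        refine Finset.mem_erase.2 ⟨fun h => hi ?_,
          Finset.mem_insert_of_mem (Finset.mem_image_of_mem _ (Finset.mem_univ j))⟩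
        have hji : j = i := hp h
        subst hji
        exact (hx _ hj).resolve_left (by simp))
  have hun : ({y : Y | y.1 = 0} ∪ ⋃ v, C v) = Set.univ :=
    Set.eq_univ_of_forall fun y => Or.inr (Set.mem_iUnion.2 ⟨0, trivial⟩)
  rw [hun, Set.univ_prod_univ, continuousOn_univ] at hk
  have hw0 : ∀ y, HasWord {q} (fun t => k (y, t)) u := fun y => by
    have := hkw y {0} (Finset.singleton_nonempty 0) (by simp [C])
    rwa [Finset.image_singleton] at this
  refine ⟨fun z => k ((1, z.1), z.2), ⟨k, ⟨hk, fun z => ?_, fun y => (hw0 y).zero, fun y => (hw0 y).one⟩,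
    fun x t => hkk (x := ((0, x), t)) ⟨rfl, trivial⟩, fun x t => rfl, fun i x hx s t => ?_⟩, fun x => ?_⟩
  · exact ne_zero_of_mem_XP (Finset.singleton_nonempty q) ((hw0 z.1).mem z.2)
  · have := hkw (s, x) {i.succ} (Finset.singleton_nonempty _) (by
      intro v hv
      rw [Finset.mem_singleton] at hv
      subst hv
      exact Or.inr hx)
    rw [Finset.image_singleton] at this
    exact this.mem t
  · have := hkw (1, x) Finset.univ Finset.univ_nonempty (by
      intro v _
      induction v using Fin.cases with
      | zero => trivial
      | succ j => exact Or.inl rfl)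
    refine (this.mono ?_).congr (cl_eq.2 huw)
    intro a ha
    obtain ⟨j, -, rfl⟩ := Finset.mem_image.1 ha
    exact Finset.mem_image.2 ⟨j.succ, Finset.mem_univ _, rfl⟩

end Wu

namespace Wu

open Topology

/-- A relation between the elements of two groups that is compatible with the products and whose fibres
over the identities are controlled induces a homomorphism with prescribed kernel. -/
theorem exists_hom_of_rel {W A P : Type*} [Group W] [Group A] [Group P] (θ : W →* A)
    (hθ : Function.Surjective θ) (D M : Subgroup A) (S : W → P → Prop)
    (h_left : ∀ z, ∃ w, θ w ∈ D ∧ S w z) (h_right : ∀ w, θ w ∈ D → ∃ z, S w z)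
    (h_mul : ∀ w w' z z', S w z → S w' z' → S (w * w') (z * z')) (h_one : ∀ z, S 1 z → z = 1)
    (h_ker : ∀ w, S w 1 → θ w ∈ M) (h_ker' : ∀ w, θ w ∈ M → S w 1) :
    ∃ φ : D →* P, Function.Surjective φ ∧ φ.ker = M.subgroupOf D := by
  have huniq : ∀ w z z', S w z → S w z' → z = z' := by
    intro w z z' hz hz'
    obtain ⟨w₁, -, h₁⟩ := h_left z'⁻¹
    have h2 := h_mul _ _ _ _ hz' h₁
    rw [mul_inv_cancel] at h2
    have h3 : S (w * w₁)⁻¹ 1 := h_ker' _ (by rw [map_inv]; exact M.inv_mem (h_ker _ h2))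
    have h4 := h_mul _ _ _ _ (h_mul _ _ _ _ hz h₁) h3
    rw [mul_inv_cancel, mul_one] at h4
    exact mul_inv_eq_one.1 (h_one _ h4)
  have hfib : ∀ w w' z z', θ w = θ w' → S w z → S w' z' → z = z' := by
    intro w w' z z' hw hz hz'
    have h1 : S (w⁻¹ * w') 1 := h_ker' _ (by rw [map_mul, map_inv, hw, inv_mul_cancel]; exact M.one_mem)
    have h2 := h_mul _ _ _ _ hz h1
    rw [mul_inv_cancel_left, mul_one] at h2
    exact huniq _ _ _ h2 hz'
  have hex : ∀ a : D, ∃ w z, θ w = a ∧ S w z := fun a => by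
    obtain ⟨w, hw⟩ := hθ a
    obtain ⟨z, hz⟩ := h_right w (by rw [hw]; exact a.2)
    exact ⟨w, z, hw, hz⟩
  choose ω ζ hω hζ using hex
  refine ⟨MonoidHom.mk' ζ fun a b => ?_, fun z => ?_, ?_⟩
  · exact hfib _ _ _ _ (by rw [hω, map_mul, hω, hω]; rfl) (hζ (a * b)) (h_mul _ _ _ _ (hζ a) (hζ b))
  · obtain ⟨w, hw, hz⟩ := h_left z
    exact ⟨⟨θ w, hw⟩, hfib _ _ _ _ (hω _) (hζ _) hz⟩
  · ext a
    rw [MonoidHom.mem_ker, Subgroup.mem_subgroupOf, ← hω]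
    refine ⟨fun h : ζ a = 1 => h_ker _ (h ▸ hζ a), fun h => huniq _ _ _ (hζ a) (h_ker' _ h)⟩

/-- The unit sphere in three-space. -/
abbrev S2 : Type := Metric.sphere (0 : EuclideanSpace ℝ (Fin 3)) 1

/-- The basepoint of the sphere. -/
noncomputable abbrev base : S2 := ⟨EuclideanSpace.single 0 1, by simp⟩

/-- The coordinates of a vector. -/
def coords (v : EuclideanSpace ℝ (Fin 3)) : E3 := (v 0, v 1, v 2)

/-- The vector with given coordinates. -/
def vec (z : E3) : EuclideanSpace ℝ (Fin 3) := !₂[z.1, z.2.1, z.2.2]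

theorem continuous_coords : Continuous coords := by
  unfold coords
  fun_prop

theorem continuous_vec : Continuous vec := by
  unfold vec
  refine (PiLp.continuous_toLp 2 _).comp (continuous_pi fun i => ?_)
  fin_cases i
  · exact continuous_fst
  · exact continuous_fst.comp continuous_snd
  · exact continuous_snd.comp continuous_snd

theorem vec_coords (v : EuclideanSpace ℝ (Fin 3)) : vec (coords v) = v := by
  ext i
  fin_cases i <;> rfl

theorem coords_vec (z : E3) : coords (vec z) = z := rfl

theorem coords_smul (c : ℝ) (v : EuclideanSpace ℝ (Fin 3)) : coords (c • v) = c • coords v := rfl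

theorem vec_ne_zero {z : E3} (hz : z ≠ 0) : vec z ≠ 0 := fun h => hz (by rw [← coords_vec z, h]; rfl)

theorem coords_ne_zero {v : EuclideanSpace ℝ (Fin 3)} (hv : v ≠ 0) : coords v ≠ 0 := fun h => hv (by
  rw [← vec_coords v, h]
  ext i
  fin_cases i <;> rfl)

theorem coords_base : coords (base : S2) = bE := by
  simp [coords, bE]

theorem coords_S2_ne_zero (v : S2) : coords v ≠ 0 := coords_ne_zero (ne_zero_of_mem_unit_sphere v)

/-- Radial projection to the sphere of a map to the punctured space. -/
noncomputable def radial {Y : Type} (G : Y → E3) (h : ∀ y, G y ≠ 0) (y : Y) : S2 :=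
  ⟨‖vec (G y)‖⁻¹ • vec (G y), by simp [norm_smul, norm_ne_zero_iff.2 (vec_ne_zero (h y))]⟩

theorem continuous_radial {Y : Type} [TopologicalSpace Y] {G : Y → E3} (hG : Continuous G) (h : ∀ y, G y ≠ 0) :
    Continuous (radial G h) := by
  have h1 := continuous_vec.comp hG
  exact ((h1.norm.inv₀ fun y => norm_ne_zero_iff.2 (vec_ne_zero (h y))).smul h1).subtype_mk _

theorem radial_eq {Y : Type} {G : Y → E3} (h : ∀ y, G y ≠ 0) {y : Y} {v : S2} (hv : G y = coords v) :
    radial G h y = v := by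
  apply Subtype.ext
  simp [radial, hv, vec_coords]

theorem radial_eq_base {Y : Type} {G : Y → E3} (h : ∀ y, G y ≠ 0) {y : Y} (hv : G y = bE) :
    radial G h y = base := radial_eq h (hv.trans coords_base.symm)

theorem coords_radial {Y : Type} {G : Y → E3} (h : ∀ y, G y ≠ 0) (y : Y) :
    coords (radial G h y) = ‖vec (G y)‖⁻¹ • G y := by
  rw [radial, coords_smul, coords_vec]

theorem norm_vec_bE : ‖vec bE‖ = 1 := by
  rw [← coords_base, vec_coords]
  simp

/-- The family of loops underlying a generalized loop in the sphere. -/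
noncomputable def hat {n : ℕ} (f : GenLoop (Fin (n + 1)) S2 base) : (Fin n → I) × I → E3 :=
  fun z => coords (f (Fin.cons z.2 z.1))

theorem continuous_cons (n : ℕ) : Continuous fun z : (Fin n → I) × I => (Fin.cons z.2 z.1 : Fin (n + 1) → I) :=
  continuous_pi fun i => by
    refine Fin.cases ?_ (fun i => ?_) i
    · simpa using continuous_snd
    · simpa using (by fun_prop : Continuous fun q : (Fin n → I) × I => q.1 i)

theorem mem_boundary_succ {n : ℕ} {q : Fin (n + 1) → I} : q ∈ Cube.boundary (Fin (n + 1)) ↔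
    (q 0 = 0 ∨ q 0 = 1) ∨ Fin.tail q ∈ Cube.boundary (Fin n) := by
  simp only [Cube.boundary, Set.mem_ofPred_eq, Fin.exists_fin_succ]
  rfl

theorem continuous_tail_zero (n : ℕ) : Continuous fun y : Fin (n + 1) → I => (Fin.tail y, y 0) :=
  continuous_tail.prodMk (continuous_apply 0)

variable {n : ℕ} {p : Fin (n + 1) → ℝ} {w w' : F}

theorem bFam_hat (f : GenLoop (Fin (n + 1)) S2 base) : BFam (hat f) := by
  refine ⟨⟨?_, fun z => coords_S2_ne_zero _, fun x => ?_, fun x => ?_⟩, fun x hx t => ?_⟩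
  · exact continuous_coords.comp (continuous_subtype_val.comp (f.1.continuous.comp (continuous_cons n)))
  all_goals
    unfold hat
    rw [GenLoop.boundary f _ (mem_boundary_succ.2 (by simp [*])), coords_base]

theorem hat_const : hat (GenLoop.const : GenLoop (Fin (n + 1)) S2 base) = fun _ => bE :=
  funext fun _ => coords_base

theorem hat_transAt (f g : GenLoop (Fin (n + 1)) S2 base) :
    hat (GenLoop.transAt 0 f g) = cat (hat f) (hat g) := by
  funext z
  simp only [hat, cat, GenLoop.transAt, GenLoop.coe_copy, Fin.cons_zero, Fin.update_cons_zero]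
  split_ifs <;> rfl

/-- The homotopy class is represented by a loop attached to the word. -/
def Assoc (p : Fin (n + 1) → ℝ) (w : F) (z : HomotopyGroup.Pi (n + 1) S2 base) : Prop :=
  ∃ f : GenLoop (Fin (n + 1)) S2 base, (Quotient.mk (GenLoop.Homotopic.setoid _ _) f) = z ∧ Rel p w (hat f)

theorem exists_assoc_of_class (hp : Function.Injective p) (z : HomotopyGroup.Pi (n + 1) S2 base) :
    ∃ w, Assoc p w z := by
  induction z using Quotient.inductionOn with
  | h f =>
    obtain ⟨w, hw⟩ := (bFam_hat f).exists_rel hp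
    exact ⟨w, f, rfl, hw⟩

theorem Assoc.mem_NN (hn : 1 ≤ n) {z : HomotopyGroup.Pi (n + 1) S2 base} (h : Assoc p w z) (j : Fin (n + 1)) :
    w ∈ NN ((Finset.univ.erase j).image p) := by
  obtain ⟨f, -, hf⟩ := h
  exact hf.mem_NN hn (bFam_hat f) j

theorem exists_assoc_of_word (hw : ∀ j, w ∈ NN ((Finset.univ.erase j).image p)) :
    ∃ z : HomotopyGroup.Pi (n + 1) S2 base, Assoc p w z := by
  obtain ⟨f₀, hf, hr⟩ := exists_of_forall_mem_NN hw
  let G : (Fin (n + 1) → I) → E3 := fun y => f₀ (Fin.tail y, y 0)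
  have hG : ∀ y, G y ≠ 0 := fun y => hf.ne_zero _
  have hGc : Continuous G := hf.continuous.comp (continuous_tail_zero n)
  let f : GenLoop (Fin (n + 1)) S2 base := ⟨⟨radial G hG, continuous_radial hGc hG⟩, fun y hy => by
    refine radial_eq_base hG ?_
    rcases mem_boundary_succ.1 hy with (h | h) | h
    · simp only [G, h]
      exact hf.source _
    · simp only [G, h]
      exact hf.target _
    · exact hf.boundary _ h _⟩
  have hhat : ∀ z, hat f z = ‖vec (f₀ z)‖⁻¹ • f₀ z := fun z => coords_radial hG _
  have hc := hf.continuous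
  let c : I → E3 → ℝ := fun s z => (1 - (s : ℝ)) * ‖vec z‖⁻¹ + s
  have hcb : ∀ s, c s bE • bE = bE := fun s => by
    simp [c, norm_vec_bE]
  have hcpos : ∀ s z, z ≠ 0 → c s z ≠ 0 := fun s z hz => by
    have h1 : 0 < ‖vec z‖⁻¹ := inv_pos.2 (norm_pos_iff.2 (vec_ne_zero hz))
    have h2 := s.2.1
    have h3 := s.2.2
    rcases h2.eq_or_lt with h2 | h2
    · simp only [c, ← h2, sub_zero, one_mul, add_zero]
      exact h1.ne'
    · have := mul_nonneg (sub_nonneg.2 h3) h1.le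
      exact (add_pos_of_nonneg_of_pos this h2).ne'
  refine ⟨_, f, rfl, hr.of_htpy ⟨fun z => c z.1.1 (f₀ (z.1.2, z.2)) • f₀ (z.1.2, z.2), ⟨?_, ?_, ?_, ?_⟩, ?_, ?_, ?_⟩⟩
  · have h1 : Continuous fun z : (I × (Fin n → I)) × I => f₀ (z.1.2, z.2) := by fun_prop
    have h2 := (continuous_vec.comp h1).norm.inv₀ fun z => norm_ne_zero_iff.2 (vec_ne_zero (hf.ne_zero _))
    exact (((by fun_prop : Continuous fun z : (I × (Fin n → I)) × I => 1 - (z.1.1 : ℝ)).mul h2).add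
      (by fun_prop)).smul h1
  · exact fun z => smul_ne_zero (hcpos _ _ (hf.ne_zero _)) (hf.ne_zero _)
  · rintro ⟨s, x⟩
    dsimp only
    rw [hf.source, hcb]
  · rintro ⟨s, x⟩
    dsimp only
    rw [hf.target, hcb]
  · intro x t
    rw [hhat]
    simp [c]
  · intro x t
    simp [c]
  · intro i x hx s t
    dsimp only
    rw [hf.boundary x (mem_boundary_of_mem_E hx), hcb]
    exact bE_mem _

theorem Assoc.mul (hn : 1 ≤ n) {z z' : HomotopyGroup.Pi (n + 1) S2 base} (h : Assoc p w z) (h' : Assoc p w' z') :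
    Assoc p (w * w') (z * z') := by
  obtain ⟨f, rfl, hf⟩ := h
  obtain ⟨f', rfl, hf'⟩ := h'
  have : Nontrivial (Fin (n + 1)) := Fin.nontrivial_iff_two_le.2 (by omega)
  refine ⟨GenLoop.transAt 0 f f', ?_, ?_⟩
  · exact (HomotopyGroup.mul_spec (i := 0) (p := f') (q := f)).symm.trans
      ((HomotopyGroup.commGroup (N := Fin (n + 1)) (X := S2) (x := base)).mul_comm _ _)
  · rw [hat_transAt]
    exact hf.cat hf'

theorem Assoc.eq_one {z : HomotopyGroup.Pi (n + 1) S2 base} (h : Assoc p 1 z) : z = 1 := by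
  obtain ⟨f, rfl, hf⟩ := h
  obtain ⟨H, hH, h0, h1, hb⟩ := hf.null (bFam_hat f)
  rw [HomotopyGroup.one_def]
  let G : I × (Fin (n + 1) → I) → E3 := fun y => H ((y.1, Fin.tail y.2), y.2 0)
  have hG : ∀ y, G y ≠ 0 := fun y => hH.ne_zero _
  have ht : Continuous fun y : Fin (n + 1) → I => Fin.tail y := continuous_tail
  have hGc : Continuous G := by
    refine hH.continuous.comp (Continuous.prodMk (Continuous.prodMk continuous_fst (ht.comp continuous_snd)) ?_)
    fun_prop
  have hG0 : ∀ y, radial G hG (0, y) = f y := fun y => radial_eq hG (by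
    simp only [G, h0, hat]
    rw [Fin.cons_self_tail])
  have hG1 : ∀ y, radial G hG (1, y) = base := fun y => radial_eq_base hG (h1 _ _)
  refine Quotient.sound ⟨⟨⟨⟨radial G hG, continuous_radial hGc hG⟩, hG0, hG1⟩, fun s y hy => ?_⟩⟩
  refine Eq.trans (radial_eq_base hG ?_) (GenLoop.boundary f y hy).symm
  rcases mem_boundary_succ.1 hy with (h | h) | h
  · simp only [G, h]
    exact hH.source _
  · simp only [G, h]
    exact hH.target _
  · exact hb _ h _ _

theorem Assoc.exists_word (hp : Function.Injective p) {q : ℝ} (hq : ∀ i, p i ≠ q)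
    (h : Assoc p w (1 : HomotopyGroup.Pi (n + 1) S2 base)) :
    ∃ u, (∀ i, u ∈ NN ((insert q (Finset.univ.image p)).erase (p i))) ∧ u⁻¹ * w ∈ NN (Finset.univ.image p) := by
  obtain ⟨f, hf1, hf⟩ := h
  rw [HomotopyGroup.one_def] at hf1
  obtain ⟨K⟩ := Quotient.exact hf1
  refine hf.exists_word_of_htpy (Null.htpy ?_) hp hq
  have hKb : ∀ s, ∀ y ∈ Cube.boundary (Fin (n + 1)), coords (K (s, y)) = bE := fun s y hy => by
    rw [K.eq_fst s hy, ← coords_base]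
    exact congrArg (fun v : S2 => coords v) (GenLoop.boundary f y hy)
  refine ⟨fun z => coords (K (z.1.1, Fin.cons z.2 z.1.2)), ⟨?_, fun z => coords_S2_ne_zero _, ?_, ?_⟩, ?_, ?_, ?_⟩
  · refine continuous_coords.comp (continuous_subtype_val.comp (K.continuous.comp ?_))
    exact (by fun_prop : Continuous fun z : (I × (Fin n → I)) × I => z.1.1).prodMk
      ((continuous_cons n).comp (by fun_prop : Continuous fun z : (I × (Fin n → I)) × I => (z.1.2, z.2)))
  · exact fun z => hKb _ _ (mem_boundary_succ.2 (by simp))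
  · exact fun z => hKb _ _ (mem_boundary_succ.2 (by simp))
  · intro x t
    dsimp only
    rw [K.apply_zero]
    rfl
  · intro x t
    dsimp only
    rw [K.apply_one]
    exact coords_base
  · exact fun x hx s t => hKb _ _ (mem_boundary_succ.2 (by simp [hx]))

theorem assoc_one_of_word (hp : Function.Injective p) {q : ℝ} (hq : ∀ i, p i ≠ q)
    (h : ∃ u, (∀ i, u ∈ NN ((insert q (Finset.univ.image p)).erase (p i))) ∧
      u⁻¹ * w ∈ NN (Finset.univ.image p)) :
    Assoc p w (1 : HomotopyGroup.Pi (n + 1) S2 base) := by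
  obtain ⟨u, hu, huw⟩ := h
  refine ⟨GenLoop.const, (HomotopyGroup.one_def).symm, ?_⟩
  rw [hat_const]
  exact rel_const_of_word hp hq hu huw

end Wu

open Wu in
/-- Wu's formula: for `n ≥ 1`, the homotopy group `π_{n+1}(S²)` of the `2`-sphere
(the unit sphere in `ℝ³`, with basepoint) is isomorphic to the quotient
`(R₀ ∩ R₁ ∩ ⋯ ∩ Rₙ) / [R₀, R₁, …, Rₙ]_S`; moreover the symmetric commutator subgroup
`[R₀, …, Rₙ]_S` is a normal subgroup of the free group contained in the intersection.
The isomorphism with the quotient is expressed by a surjective homomorphism from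
`R₀ ∩ ⋯ ∩ Rₙ` onto `π_{n+1}(S²)` whose kernel is `[R₀, …, Rₙ]_S` (viewed as a subgroup
of the intersection), so that the first isomorphism theorem yields
`π_{n+1}(S²) ≅ (R₀ ∩ ⋯ ∩ Rₙ)/[R₀, …, Rₙ]_S`. -/
theorem wu_formula (n : ℕ) (hn : 1 ≤ n) :
    (symmComm (R n)).Normal ∧
    symmComm (R n) ≤ (⨅ i : Fin (n + 1), R n i) ∧
    ∃ φ : ↥(⨅ i : Fin (n + 1), R n i) →*
        HomotopyGroup.Pi (n + 1) (Metric.sphere (0 : EuclideanSpace ℝ (Fin 3)) 1)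
          ⟨EuclideanSpace.single 0 1, by simp⟩,
      Function.Surjective φ ∧
      φ.ker = (symmComm (R n)).subgroupOf (⨅ i : Fin (n + 1), R n i) := by
  refine ⟨?_, ?_, ?_⟩
  · rw [symmComm_eq]
    exact SC_normal _ R_normal _
  · rw [symmComm_eq]
    exact le_iInf fun i => SC_le_mem _ R_normal _ i (List.mem_finRange i)
  · let p : Fin (n + 1) → ℝ := fun i => ((i : ℕ) : ℝ)
    have hp : Function.Injective p := fun i j h => Fin.ext (Nat.cast_injective h)
    have hq : ∀ i, p i ≠ -1 := fun i => by
      have : (0 : ℝ) ≤ p i := Nat.cast_nonneg _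
      linarith
    have hlab : Finset.univ.image p = lab n := by
      ext a
      simp only [lab, p, Finset.mem_image, Finset.mem_univ, true_and, Finset.mem_range]
      exact ⟨fun ⟨i, hi⟩ => ⟨i, i.2, hi⟩, fun ⟨i, hi, h⟩ => ⟨⟨i, hi⟩, h⟩⟩
    have hmem : ∀ w, theta n w ∈ (⨅ i : Fin (n + 1), R n i) ↔
        ∀ j, w ∈ NN ((Finset.univ.erase j).image p) := fun w => by
      rw [Subgroup.mem_iInf]
      refine forall_congr' fun i => ?_
      rw [Finset.image_erase hp, hlab, ← comap_R, Subgroup.mem_comap]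
    refine exists_hom_of_rel (theta n) theta_surj _ _ (Assoc p) ?_ ?_ ?_ ?_ ?_ ?_
    · intro z
      obtain ⟨w, hw⟩ := exists_assoc_of_class hp z
      exact ⟨w, (hmem w).2 fun j => hw.mem_NN hn j, hw⟩
    · exact fun w hw => exists_assoc_of_word ((hmem w).1 hw)
    · exact fun w w' z z' h h' => h.mul hn h'
    · exact fun z h => h.eq_one
    · intro w h
      rw [theta_mem_symmComm, ← hlab]
      exact h.exists_word hp hq
    · intro w h
      rw [theta_mem_symmComm, ← hlab] at h
      exact assoc_one_of_word hp hq h
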